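/- arXiv:math/0405475 — 2 statements merged into one kernel-verified Lean document; each statement's English description precedes it below -/
import Mathlib

section
/- Every non-negative real ternary quartic form is a sum of three squares of real quadratic forms; that is, if f is a homogeneous polynomial of degree 4 in three variables with real coefficients such that f(x,y,z) ≥ 0 for all real x, y, z, then there exist homogeneous polynomials p, q, r of degree 2 in three variables with real coefficients such that f = p² + q² + r². -/
section

open MvPolynomial

theorem homogeneousComponent_mul_right {σ R : Type*} [CommSemiring R] {p : MvPolynomial σ R}
    {i : ℕ} (hp : p.IsHomogeneous i) (n : ℕ) (a : MvPolynomial σ R) :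
    homogeneousComponent (n + i) (a * p) = homogeneousComponent n a * p := by
  classical
  let : GradedAlgebra (homogeneousSubmodule σ R) := gradedAlgebra
  have h := DirectSum.coe_decompose_mul_of_right_mem_of_le (homogeneousSubmodule σ R)
    (a := a) (b := p) (i := i) (n := n + i) hp (Nat.le_add_left _ _)
  rw [Nat.add_sub_cancel] at h
  exact (decomposition.decompose'_apply _ _).symm.trans
    (h.trans (congrArg (· * p) (decomposition.decompose'_apply _ _)))

theorem exists_quadratic_coeffs {R : Type*} [CommRing R] {p : MvPolynomial (Fin 3) R}
    (hp : p.IsHomogeneous 2) : ∃ a b c d e f : R,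
      p = C a * X 0 ^ 2 + C b * (X 0 * X 1) + C c * X 1 ^ 2 +
        X 2 * (C d * X 0 + C e * X 1 + C f * X 2) := by
  rw [← mem_homogeneousSubmodule, ← homogeneousSubmodule_one_pow, pow_two,
    homogeneousSubmodule_one_eq_span_X, Submodule.span_mul_span] at hp
  induction hp using Submodule.span_induction with
  | mem x hx =>
    obtain ⟨_, ⟨i, rfl⟩, _, ⟨j, rfl⟩, rfl⟩ := hx
    fin_cases i <;> fin_cases j
    · exact ⟨1, 0, 0, 0, 0, 0, by simp; ring⟩
    · exact ⟨0, 1, 0, 0, 0, 0, by simp⟩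
    · exact ⟨0, 0, 0, 1, 0, 0, by simp; ring⟩
    · exact ⟨0, 1, 0, 0, 0, 0, by simp; ring⟩
    · exact ⟨0, 0, 1, 0, 0, 0, by simp; ring⟩
    · exact ⟨0, 0, 0, 0, 1, 0, by simp; ring⟩
    · exact ⟨0, 0, 0, 1, 0, 0, by simp⟩
    · exact ⟨0, 0, 0, 0, 1, 0, by simp⟩
    · exact ⟨0, 0, 0, 0, 0, 1, by simp⟩
  | zero => exact ⟨0, 0, 0, 0, 0, 0, by simp⟩
  | add x y hx hy ihx ihy =>
    obtain ⟨a, b, c, d, e, f, rfl⟩ := ihx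
    obtain ⟨a', b', c', d', e', f', rfl⟩ := ihy
    exact ⟨a + a', b + b', c + c', d + d', e + e', f + f', by simp only [map_add]; ring⟩
  | smul r x hx ih =>
    obtain ⟨a, b, c, d, e, f, rfl⟩ := ih
    exact ⟨r * a, r * b, r * c, r * d, r * e, r * f, by
      simp only [smul_eq_C_mul, map_mul]; ring⟩

theorem isHomogeneous_quadratic {R : Type*} [CommRing R] (a b c : R) {l : MvPolynomial (Fin 3) R}
    (hl : l.IsHomogeneous 1) : (C a * X 0 ^ 2 + C b * (X 0 * X 1) + C c * X 1 ^ 2 +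
      X 2 * l).IsHomogeneous 2 := by
  refine IsHomogeneous.add (.add (.add ?_ ?_) ?_) ((isHomogeneous_X R 2).mul hl)
  · exact isHomogeneous_C_mul_X_pow _ _ _
  · exact ((isHomogeneous_X R 0).mul (isHomogeneous_X R 1)).C_mul _
  · exact isHomogeneous_C_mul_X_pow _ _ _

theorem X_two_dvd_sub_aeval {k : Type*} [Field k] (u : MvPolynomial (Fin 3) k) :
    (X 2 : MvPolynomial (Fin 3) k) ∣
      u - aeval (![X 0, X 1, 0] : Fin 3 → MvPolynomial (Fin 3) k) u := by
  rw [← Ideal.mem_span_singleton, ← Ideal.Quotient.eq]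
  have h : Ideal.Quotient.mkₐ k (Ideal.span {(X 2 : MvPolynomial (Fin 3) k)}) =
      (Ideal.Quotient.mkₐ k (Ideal.span {(X 2 : MvPolynomial (Fin 3) k)})).comp
        (aeval (![X 0, X 1, 0] : Fin 3 → MvPolynomial (Fin 3) k)) := by
    ext i
    fin_cases i
    · simp
    · simp
    · simp only [Fin.reduceFinMk, Ideal.Quotient.mkₐ_eq_mk, AlgHom.comp_apply, aeval_X]
      simp
  exact congrArg (fun φ => φ u) h

/-- The binary cubic monomials lie in the ideal of two binary quadratic forms whose resultant is a
unit. -/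
theorem resultant_mul_mem {R : Type*} [CommRing R] {I : Ideal R} {a b c a' b' c' x y : R}
    (hp : a * x ^ 2 + b * (x * y) + c * y ^ 2 ∈ I)
    (hq : a' * x ^ 2 + b' * (x * y) + c' * y ^ 2 ∈ I)
    (hr : IsUnit ((a * c' - c * a') ^ 2 - (a * b' - b * a') * (b * c' - c * b'))) :
    x ^ 3 ∈ I ∧ x ^ 2 * y ∈ I ∧ x * y ^ 2 ∈ I ∧ y ^ 3 ∈ I := by
  have hV := I.sub_mem (I.mul_mem_left c' hp) (I.mul_mem_left c hq)
  have hU := I.sub_mem (I.mul_mem_left a hq) (I.mul_mem_left a' hp)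
  have hW := I.sub_mem (I.mul_mem_left b' hp) (I.mul_mem_left b hq)
  refine ⟨?_, ?_, ?_, ?_⟩ <;> rw [← I.unit_mul_mem_iff_mem hr]
  · convert I.add_mem (I.mul_mem_left ((a * c' - c * a') * x - (b * c' - c * b') * y) hV)
      (I.mul_mem_left (-(b * c' - c * b') * x) hW) using 1
    ring
  · convert I.sub_mem (I.mul_mem_left ((a * c' - c * a') * y) hV)
      (I.mul_mem_left ((b * c' - c * b') * x) hU) using 1
    ring
  · convert I.sub_mem (I.mul_mem_left ((a * c' - c * a') * x) hU)
      (I.mul_mem_left ((a * b' - b * a') * y) hV) using 1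
    ring
  · convert I.add_mem (I.mul_mem_left ((a * c' - c * a') * y - (a * b' - b * a') * x) hU)
      (I.mul_mem_left ((a * b' - b * a') * y) hW) using 1
    ring

theorem isRelPrime_of_pow_mem {A : Type*} [CommRing A] [IsDomain A] {x y p q : A} {n : ℕ}
    (hx : Prime x) (hxy : ¬ x ∣ y)
    (hxn : x ^ n ∈ Ideal.span {p, q}) (hyn : y ^ n ∈ Ideal.span {p, q}) : IsRelPrime p q := by
  intro d hdp hdq
  have hd : Ideal.span {p, q} ≤ Ideal.span {d} := by
    rw [Ideal.span_le]
    rintro _ (rfl | rfl) <;> simpa [Ideal.mem_span_singleton]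
  obtain ⟨i, -, hi⟩ := (dvd_prime_pow hx n).1 (Ideal.mem_span_singleton.1 (hd hxn))
  rcases Nat.eq_zero_or_pos i with rfl | hi0
  · exact associated_one_iff_isUnit.1 (by rwa [pow_zero] at hi)
  · refine absurd (hx.dvd_of_dvd_pow (n := n) ?_) hxy
    exact ((dvd_pow_self x hi0.ne').trans hi.symm.dvd).trans (Ideal.mem_span_singleton.1 (hd hyn))

/-- If the resultant of the restrictions of `p` and `q` to the line `X 2 = 0` is nonzero, then
`X 2` is a non-zero-divisor modulo the ideal generated by `p` and `q`. -/
theorem mem_span_of_X_two_mul_mem {k : Type*} [Field k] {a b c a' b' c' : k}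
    {l l' u : MvPolynomial (Fin 3) k}
    (hr : (a * c' - c * a') ^ 2 - (a * b' - b * a') * (b * c' - c * b') ≠ 0)
    (hu : X 2 * u ∈ Ideal.span
      {C a * X 0 ^ 2 + C b * (X 0 * X 1) + C c * X 1 ^ 2 + X 2 * l,
        C a' * X 0 ^ 2 + C b' * (X 0 * X 1) + C c' * X 1 ^ 2 + X 2 * l'}) :
    u ∈ Ideal.span
      {C a * X 0 ^ 2 + C b * (X 0 * X 1) + C c * X 1 ^ 2 + X 2 * l,
        C a' * X 0 ^ 2 + C b' * (X 0 * X 1) + C c' * X 1 ^ 2 + X 2 * l'} := by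
  set p₀ : MvPolynomial (Fin 3) k := C a * X 0 ^ 2 + C b * (X 0 * X 1) + C c * X 1 ^ 2 with hp₀
  set q₀ : MvPolynomial (Fin 3) k := C a' * X 0 ^ 2 + C b' * (X 0 * X 1) + C c' * X 1 ^ 2 with hq₀
  have hrel : IsRelPrime p₀ q₀ := by
    have h := resultant_mul_mem (I := Ideal.span {p₀, q₀}) (a := C a) (b := C b) (c := C c)
      (a' := C a') (b' := C b') (c' := C c') (x := X 0) (y := X 1)
      (Ideal.subset_span (by simp [hp₀])) (Ideal.subset_span (by simp [hq₀]))
      (by simpa only [map_sub, map_mul, map_pow] using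
        (Ne.isUnit hr).map (C : k →+* MvPolynomial (Fin 3) k))
    exact isRelPrime_of_pow_mem (X_prime (i := 0)) (by simp [X_dvd_X]) h.1 h.2.2.2
  have hp0 : p₀ ≠ 0 := by
    intro h0
    rw [h0, isRelPrime_zero_left] at hrel
    simpa [hq₀] using hrel.map (eval (0 : Fin 3 → k))
  obtain ⟨s, t, hst⟩ := Ideal.mem_span_pair.1 hu
  set ρ := aeval (R := k) (![X 0, X 1, 0] : Fin 3 → MvPolynomial (Fin 3) k) with hρ
  have hρp : ρ p₀ = p₀ := by simp [hp₀, hρ]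
  have hρq : ρ q₀ = q₀ := by simp [hq₀, hρ]
  have hρX : ρ (X 2) = 0 := by simp [hρ]
  have h0 : ρ s * p₀ + ρ t * q₀ = 0 := by
    have := congrArg ρ hst
    simpa [hρp, hρq, hρX] using this
  obtain ⟨e, he⟩ : p₀ ∣ ρ t := hrel.dvd_of_dvd_mul_right ⟨-ρ s, by linear_combination h0⟩
  have he' : ρ s = - e * q₀ := mul_left_cancel₀ hp0 (by rw [he] at h0; linear_combination h0)
  obtain ⟨s', hs⟩ := X_two_dvd_sub_aeval s
  obtain ⟨t', ht⟩ := X_two_dvd_sub_aeval t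
  rw [← hρ] at hs ht
  refine Ideal.mem_span_pair.2 ⟨s' + e * l', t' - e * l, ?_⟩
  refine mul_left_cancel₀ (X_ne_zero (2 : Fin 3)) (hst ▸ ?_)
  linear_combination (-p₀ - X 2 * l) * hs + (-q₀ - X 2 * l') * ht
    - (p₀ + X 2 * l) * he' - (q₀ + X 2 * l') * he

theorem MvPolynomial.IsHomogeneous.mem_of_cubic_mem {R : Type*} [CommRing R]
    {J : Ideal (MvPolynomial (Fin 3) R)}
    (h : X 0 ^ 3 ∈ J ∧ X 0 ^ 2 * X 1 ∈ J ∧ X 0 * X 1 ^ 2 ∈ J ∧ X 1 ^ 3 ∈ J) (hX : X 2 ∈ J)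
    {n : ℕ} (hn : 3 ≤ n) {u : MvPolynomial (Fin 3) R} (hu : u.IsHomogeneous n) : u ∈ J := by
  rw [u.as_sum]
  refine J.sum_mem fun d hd => ?_
  have hdeg : d 0 + d 1 + d 2 = n := by
    rw [← hu (mem_support_iff.1 hd), Finsupp.weight_apply, Finsupp.sum_fintype _ _ (by simp)]
    simp [Fin.sum_univ_three]
  rw [monomial_eq, Finsupp.prod_fintype _ _ (by simp), Fin.prod_univ_three]
  refine J.mul_mem_left _ ?_
  rcases Nat.eq_zero_or_pos (d 2) with h2 | h2
  · refine J.mul_mem_right _ ?_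
    obtain ⟨h30, h21, h12, h03⟩ := h
    rcases (by omega : 3 ≤ d 0 ∨ (2 ≤ d 0 ∧ 1 ≤ d 1) ∨ (1 ≤ d 0 ∧ 2 ≤ d 1) ∨ 3 ≤ d 1) with
      h | ⟨h, h'⟩ | ⟨h, h'⟩ | h
    · exact J.mem_of_dvd (Dvd.dvd.mul_right (pow_dvd_pow _ h) _) h30
    · exact J.mem_of_dvd (mul_dvd_mul (pow_dvd_pow _ h) (dvd_pow_self _ (by omega))) h21
    · exact J.mem_of_dvd (mul_dvd_mul (dvd_pow_self _ (by omega)) (pow_dvd_pow _ h')) h12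
    · exact J.mem_of_dvd (Dvd.dvd.mul_left (pow_dvd_pow _ h) _) h03
  · exact J.mul_mem_left _ (J.mem_of_dvd (dvd_pow_self _ h2.ne') hX)

/-- A form in the ideal of three forms is a combination with homogeneous coefficients. -/
theorem MvPolynomial.IsHomogeneous.exists_combination {σ R : Type*} [CommRing R]
    {p q r u : MvPolynomial σ R} {i j l m : ℕ} (hp : p.IsHomogeneous i) (hq : q.IsHomogeneous i)
    (hr : r.IsHomogeneous j) (hu : u.IsHomogeneous (l + i)) (hlm : l + i = m + j) (h : u ∈ Ideal.span {p, q, r}) :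
    ∃ a b c : MvPolynomial σ R, a.IsHomogeneous l ∧ b.IsHomogeneous l ∧ c.IsHomogeneous m ∧
      u = a * p + b * q + c * r := by
  obtain ⟨a, b, c, rfl⟩ := Submodule.mem_span_triple.1 h
  refine ⟨_, _, _, homogeneousComponent_isHomogeneous l a, homogeneousComponent_isHomogeneous l b,
    homogeneousComponent_isHomogeneous m c, ?_⟩
  rw [← homogeneousComponent_mul_right hp, ← homogeneousComponent_mul_right hq,
    ← homogeneousComponent_mul_right hr, ← hlm, ← map_add, ← map_add]
  exact (homogeneousComponent_eq_self hu).symm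

/-- Modulo two quadratic forms whose restrictions to `X 2 = 0` have nonzero resultant, every form
of degree at least two is congruent to a power of `X 2` times a quadratic form. -/
theorem exists_sub_X_two_pow_mul_mem {k : Type*} [Field k] {a b c a' b' c' : k}
    {l l' : MvPolynomial (Fin 3) k}
    (hr : (a * c' - c * a') ^ 2 - (a * b' - b * a') * (b * c' - c * b') ≠ 0)
    (hl : l.IsHomogeneous 1) (hl' : l'.IsHomogeneous 1) (n : ℕ) {u : MvPolynomial (Fin 3) k}
    (hu : u.IsHomogeneous (n + 2)) :
    ∃ v : MvPolynomial (Fin 3) k, v.IsHomogeneous 2 ∧ u - X 2 ^ n * v ∈ Ideal.span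
      {C a * X 0 ^ 2 + C b * (X 0 * X 1) + C c * X 1 ^ 2 + X 2 * l,
        C a' * X 0 ^ 2 + C b' * (X 0 * X 1) + C c' * X 1 ^ 2 + X 2 * l'} := by
  set p : MvPolynomial (Fin 3) k :=
    C a * X 0 ^ 2 + C b * (X 0 * X 1) + C c * X 1 ^ 2 + X 2 * l with hp
  set q : MvPolynomial (Fin 3) k :=
    C a' * X 0 ^ 2 + C b' * (X 0 * X 1) + C c' * X 1 ^ 2 + X 2 * l' with hq
  have hph : p.IsHomogeneous 2 := isHomogeneous_quadratic _ _ _ hl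
  have hqh : q.IsHomogeneous 2 := isHomogeneous_quadratic _ _ _ hl'
  induction n generalizing u with
  | zero => exact ⟨u, hu, by simp⟩
  | succ n ih =>
    have hX : X 2 ∈ Ideal.span {p, q, X 2} := Ideal.subset_span (by simp)
    have h := resultant_mul_mem (I := Ideal.span {p, q, X 2}) (a := C a) (b := C b) (c := C c)
      (a' := C a') (b' := C b') (c' := C c') (x := X 0) (y := X 1)
      (by
        rw [← Ideal.add_mem_iff_left _ (Ideal.mul_mem_right l _ hX)]
        exact Ideal.subset_span (by simp [hp]))
      (by
        rw [← Ideal.add_mem_iff_left _ (Ideal.mul_mem_right l' _ hX)]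
        exact Ideal.subset_span (by simp [hq]))
      (by simpa only [map_sub, map_mul, map_pow] using
        (Ne.isUnit hr).map (C : k →+* MvPolynomial (Fin 3) k))
    obtain ⟨s, t, w, -, -, hw, rfl⟩ := hph.exists_combination (l := n + 1) (m := n + 2) hqh
      (isHomogeneous_X k 2) hu (by omega) (hu.mem_of_cubic_mem h hX (by omega))
    obtain ⟨v, hv, hwv⟩ := ih hw
    refine ⟨v, hv, ?_⟩
    have hpm : p ∈ Ideal.span {p, q} := Ideal.subset_span (by simp)
    have hqm : q ∈ Ideal.span {p, q} := Ideal.subset_span (by simp)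
    convert Ideal.add_mem _ (Ideal.add_mem _ (Ideal.mul_mem_left _ s hpm)
      (Ideal.mul_mem_left _ t hqm)) (Ideal.mul_mem_left _ (X 2) hwv) using 1
    ring

theorem exists_X_pow_mem {k K : Type*} [Field k] [Field K] [IsAlgClosed K] [Algebra k K]
    {σ : Type*} [Finite σ] {s : Set (MvPolynomial σ k)}
    (h : ∀ x : σ → K, (∀ p ∈ s, aeval x p = 0) → x = 0) (i : σ) :
    ∃ n : ℕ, (X i : MvPolynomial σ k) ^ n ∈ Ideal.span s := by
  change X i ∈ (Ideal.span s).radical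
  rw [← vanishingIdeal_zeroLocus_eq_radical (K := K), mem_vanishingIdeal_iff]
  intro x hx
  rw [h x fun p hp => hx p (Ideal.subset_span hp)]
  simp

theorem mem_span_of_resultant_ne_zero {k : Type*} [Field k] {a b c a' b' c' : k}
    {l l' r : MvPolynomial (Fin 3) k}
    (hr : (a * c' - c * a') ^ 2 - (a * b' - b * a') * (b * c' - c * b') ≠ 0)
    (hl : l.IsHomogeneous 1) (hl' : l'.IsHomogeneous 1) (hrh : r.IsHomogeneous 2)
    {N : ℕ} (hN : X 2 ^ N ∈ Ideal.span
      {C a * X 0 ^ 2 + C b * (X 0 * X 1) + C c * X 1 ^ 2 + X 2 * l,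
        C a' * X 0 ^ 2 + C b' * (X 0 * X 1) + C c' * X 1 ^ 2 + X 2 * l', r})
    {u : MvPolynomial (Fin 3) k} (hu : u.IsHomogeneous 4) :
    u ∈ Ideal.span
      {C a * X 0 ^ 2 + C b * (X 0 * X 1) + C c * X 1 ^ 2 + X 2 * l,
        C a' * X 0 ^ 2 + C b' * (X 0 * X 1) + C c' * X 1 ^ 2 + X 2 * l', r} := by
  have hmem := fun v => mem_span_of_X_two_mul_mem (l := l) (l' := l') (u := v) hr
  have hred := fun n v => exists_sub_X_two_pow_mul_mem (u := v) hr hl hl' n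
  have hph := isHomogeneous_quadratic a b c hl
  have hqh := isHomogeneous_quadratic a' b' c' hl'
  generalize C a * X 0 ^ 2 + C b * (X 0 * X 1) + C c * X 1 ^ 2 + X 2 * l = p at *
  generalize C a' * X 0 ^ 2 + C b' * (X 0 * X 1) + C c' * X 1 ^ 2 + X 2 * l' = q at *
  have hpow : ∀ n v, X 2 ^ n * v ∈ Ideal.span {p, q} → v ∈ Ideal.span {p, q} := by
    intro n
    induction n with
    | zero => intro v hv; simpa using hv
    | succ n ih => intro v hv; exact ih v (hmem _ (by convert hv using 1; ring))
  have hle : Ideal.span {p, q} ≤ Ideal.span {p, q, r} :=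
    Ideal.span_mono (by intro x; simp; tauto)
  obtain ⟨s, t, w, -, -, hw, hstw⟩ := hph.exists_combination (l := N + 2) (m := N + 2)
    (u := X 2 ^ N * u) hqh hrh (by simpa using (isHomogeneous_X_pow (R := k) 2 N).mul hu) rfl
    (Ideal.mul_mem_right _ _ hN)
  obtain ⟨v, hv, hwv⟩ := hred N w hw
  have hmain : u - v * r ∈ Ideal.span {p, q} := by
    refine hpow N _ ?_
    have hpm : p ∈ Ideal.span {p, q} := Ideal.subset_span (by simp)
    have hqm : q ∈ Ideal.span {p, q} := Ideal.subset_span (by simp)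
    convert Ideal.add_mem _ (Ideal.add_mem _ (Ideal.mul_mem_left _ s hpm)
      (Ideal.mul_mem_left _ t hqm)) (Ideal.mul_mem_left _ r hwv) using 1
    linear_combination hstw
  rw [← sub_add_cancel u (v * r)]
  exact Ideal.add_mem _ (hle hmain) (Ideal.mul_mem_left _ _ (Ideal.subset_span (by simp)))

theorem exists_linear_factors (a b c : ℂ) (h : ¬ (a = 0 ∧ b = 0 ∧ c = 0)) :
    ∃ s t s' t' : ℂ, (s ≠ 0 ∨ t ≠ 0) ∧ (s' ≠ 0 ∨ t' ≠ 0) ∧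
      a = s * s' ∧ b = s * t' + t * s' ∧ c = t * t' := by
  by_cases ha : a = 0
  · refine ⟨0, 1, b, c, by simp, ?_, by simp [ha], by simp, by simp⟩
    tauto
  · obtain ⟨z, hz⟩ := exists_quadratic_eq_zero (b := b) (c := c) ha
      (IsAlgClosed.exists_pow_nat_eq (discrim a b c) two_pos |>.imp fun d hd => by rw [← hd, sq])
    exact ⟨1, -z, a, b + a * z, by simp, by simp [ha], by simp, by ring, by linear_combination hz⟩

theorem finite_setOf_add_mul_eq_zero {A B : ℂ} (h : ¬ (A = 0 ∧ B = 0)) :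
    {τ : ℝ | A + τ * B = 0}.Finite := by
  refine Set.Subsingleton.finite fun x hx y hy => ?_
  have hB : B ≠ 0 := by
    rintro rfl
    exact h ⟨by simpa using hx, rfl⟩
  have : ((x : ℂ) - y) * B = 0 := by
    linear_combination Set.mem_ofPred.1 hx - Set.mem_ofPred.1 hy
  rcases mul_eq_zero.1 this with h | h
  · exact_mod_cast sub_eq_zero.1 h
  · exact absurd h hB

/-- Three real binary quadratic forms without common complex zero contain, up to a change of
generators, two forms with nonzero resultant. -/
theorem exists_resultant_ne_zero {a b c a' b' c' a'' b'' c'' : ℝ}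
    (h0 : ¬ (a = 0 ∧ b = 0 ∧ c = 0))
    (h : ∀ x y : ℂ, a * x ^ 2 + b * (x * y) + c * y ^ 2 = 0 →
      a' * x ^ 2 + b' * (x * y) + c' * y ^ 2 = 0 →
      a'' * x ^ 2 + b'' * (x * y) + c'' * y ^ 2 = 0 → x = 0 ∧ y = 0) :
    ∃ τ : ℝ, (a * (c' + τ * c'') - c * (a' + τ * a'')) ^ 2 -
      (a * (b' + τ * b'') - b * (a' + τ * a'')) * (b * (c' + τ * c'') - c * (b' + τ * b'')) ≠ 0 := by
  obtain ⟨s, t, s', t', hst, hst', ha, hb, hc⟩ := exists_linear_factors a b c (by exact_mod_cast h0)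
  have hfin {x y : ℂ} (hxy : x ≠ 0 ∨ y ≠ 0) (hroot : a * x ^ 2 + b * (x * y) + c * y ^ 2 = 0) :=
    finite_setOf_add_mul_eq_zero (A := a' * x ^ 2 + b' * (x * y) + c' * y ^ 2)
      (B := a'' * x ^ 2 + b'' * (x * y) + c'' * y ^ 2)
      (fun hh => not_and_or.2 hxy (h x y hroot hh.1 hh.2))
  obtain ⟨τ, hτ⟩ := ((hfin (x := t) (y := -s) (by rwa [neg_ne_zero, or_comm])
    (by rw [ha, hb, hc]; ring)).union (hfin (x := t') (y := -s') (by rwa [neg_ne_zero, or_comm])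
    (by rw [ha, hb, hc]; ring))).infinite_compl.nonempty
  simp only [Set.mem_compl_iff, Set.mem_union, Set.mem_ofPred_eq, not_or] at hτ
  refine ⟨τ, fun hres => mul_ne_zero hτ.1 hτ.2 ?_⟩
  have hres' : ((a : ℂ) * (c' + τ * c'') - c * (a' + τ * a'')) ^ 2 -
      (a * (b' + τ * b'') - b * (a' + τ * a'')) *
        (b * (c' + τ * c'') - c * (b' + τ * b'')) = 0 := by
    exact_mod_cast hres
  rw [ha, hb, hc] at hres'
  linear_combination hres'

theorem mem_span_of_no_common_zero {p q r u : MvPolynomial (Fin 3) ℝ}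
    {a b c : ℝ} {l : MvPolynomial (Fin 3) ℝ} (hl : l.IsHomogeneous 1)
    (hp : p = C a * X 0 ^ 2 + C b * (X 0 * X 1) + C c * X 1 ^ 2 + X 2 * l)
    (h0 : ¬ (a = 0 ∧ b = 0 ∧ c = 0))
    (hq : q.IsHomogeneous 2) (hr : r.IsHomogeneous 2)
    (h : ∀ x : Fin 3 → ℂ, aeval x p = 0 → aeval x q = 0 → aeval x r = 0 → x = 0)
    (hu : u.IsHomogeneous 4) : u ∈ Ideal.span {p, q, r} := by
  obtain ⟨a', b', c', d', e', f', hq'⟩ := exists_quadratic_coeffs hq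
  obtain ⟨a'', b'', c'', d'', e'', f'', hr'⟩ := exists_quadratic_coeffs hr
  obtain ⟨τ, hτ⟩ := exists_resultant_ne_zero (a' := a') (b' := b') (c' := c') (a'' := a'')
    (b'' := b'') (c'' := c'') h0 (fun x y h₁ h₂ h₃ => by
      have := h ![x, y, 0] (by simpa [hp] using h₁) (by simpa [hq'] using h₂)
        (by simpa [hr'] using h₃)
      exact ⟨by simpa using congrFun this 0, by simpa using congrFun this 1⟩)
  obtain ⟨N, hN⟩ := exists_X_pow_mem (K := ℂ) (s := {p, q, r}) (fun x hx => h x (hx p (by simp))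
    (hx q (by simp)) (hx r (by simp))) (2 : Fin 3)
  have hspan : ∀ q' : MvPolynomial (Fin 3) ℝ,
      Ideal.span {p, q' + C τ * r, r} = Ideal.span {p, q', r} := by
    intro q'
    refine le_antisymm ?_ ?_ <;> rw [Ideal.span_le, Set.insert_subset_iff, Set.insert_subset_iff,
      Set.singleton_subset_iff] <;> refine ⟨?_, ?_, ?_⟩
    · exact Ideal.subset_span (by simp)
    · exact Ideal.add_mem _ (Ideal.subset_span (by simp))
        (Ideal.mul_mem_left _ _ (Ideal.subset_span (by simp)))
    · exact Ideal.subset_span (by simp)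
    · exact Ideal.subset_span (by simp)
    · rw [SetLike.mem_coe, ← Ideal.add_mem_iff_left _ (Ideal.mul_mem_left _ (C τ)
        (Ideal.subset_span (by simp : r ∈ ({p, q' + C τ * r, r} : Set _))))]
      exact Ideal.subset_span (by simp)
    · exact Ideal.subset_span (by simp)
  have hl' (d e f : ℝ) : (C d * X 0 + C e * X 1 + C f * X 2 :
      MvPolynomial (Fin 3) ℝ).IsHomogeneous 1 :=
    ((isHomogeneous_C_mul_X _ _).add (isHomogeneous_C_mul_X _ _)).add (isHomogeneous_C_mul_X _ _)
  have key : q + C τ * r =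
      C (a' + τ * a'') * X 0 ^ 2 + C (b' + τ * b'') * (X 0 * X 1) + C (c' + τ * c'') * X 1 ^ 2 +
        X 2 * (C (d' + τ * d'') * X 0 + C (e' + τ * e'') * X 1 + C (f' + τ * f'') * X 2) := by
    rw [hq', hr']
    simp only [map_add, map_mul]
    ring
  rw [← hspan, key, hp] at hN ⊢
  exact mem_span_of_resultant_ne_zero hτ hl (hl' _ _ _) hr hN hu

/-- If three real ternary quadratic forms have no nontrivial common complex zero, then every
quartic form lies in the ideal they generate. -/
theorem exists_combination_of_no_common_zero {p q r u : MvPolynomial (Fin 3) ℝ}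
    (hp : p.IsHomogeneous 2) (hq : q.IsHomogeneous 2) (hr : r.IsHomogeneous 2)
    (h : ∀ x : Fin 3 → ℂ, aeval x p = 0 → aeval x q = 0 → aeval x r = 0 → x = 0)
    (hu : u.IsHomogeneous 4) :
    ∃ a b c : MvPolynomial (Fin 3) ℝ, a.IsHomogeneous 2 ∧ b.IsHomogeneous 2 ∧
      c.IsHomogeneous 2 ∧ u = a * p + b * q + c * r := by
  refine hp.exists_combination hq hr hu rfl ?_
  obtain ⟨a, b, c, d, e, f, hp'⟩ := exists_quadratic_coeffs hp
  obtain ⟨a', b', c', d', e', f', hq'⟩ := exists_quadratic_coeffs hq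
  obtain ⟨a'', b'', c'', d'', e'', f'', hr'⟩ := exists_quadratic_coeffs hr
  have hl (d e f : ℝ) : (C d * X 0 + C e * X 1 + C f * X 2 :
      MvPolynomial (Fin 3) ℝ).IsHomogeneous 1 :=
    ((isHomogeneous_C_mul_X _ _).add (isHomogeneous_C_mul_X _ _)).add (isHomogeneous_C_mul_X _ _)
  by_cases h0 : a = 0 ∧ b = 0 ∧ c = 0
  · by_cases h1 : a' = 0 ∧ b' = 0 ∧ c' = 0
    · by_cases h2 : a'' = 0 ∧ b'' = 0 ∧ c'' = 0
      · have := h ![1, 0, 0] (by simp [hp', h0]) (by simp [hq', h1]) (by simp [hr', h2])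
        simpa using congrFun this 0
      · have := mem_span_of_no_common_zero (hl _ _ _) hr' h2 hp hq
          (fun x h₁ h₂ h₃ => h x h₂ h₃ h₁) hu
        convert this using 2
        ext; simp; tauto
    · have := mem_span_of_no_common_zero (hl _ _ _) hq' h1 hp hr
        (fun x h₁ h₂ h₃ => h x h₂ h₁ h₃) hu
      convert this using 2
      ext; simp; tauto
  · exact mem_span_of_no_common_zero (hl _ _ _) hp' h0 hq hr h hu

/-- A real quadratic form vanishing at a non-real point lies in the ideal of the two conjugate
points, written out in coordinates. -/
theorem exists_eq_of_aeval_eq_zero {p : MvPolynomial (Fin 3) ℝ} (hp : p.IsHomogeneous 2)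
    {ω : ℂ} (hω : ω.im ≠ 0) {a b : ℝ} (h : aeval ![ω, 1, -(a * ω) - b] p = 0) :
    ∃ α d e g : ℝ, p =
      C α * (X 0 ^ 2 + C (-2 * ω.re) * (X 0 * X 1) + C (Complex.normSq ω) * X 1 ^ 2) +
      (X 2 + C a * X 0 + C b * X 1) *
        (C d * X 0 + C e * X 1 + C g * (X 2 + C a * X 0 + C b * X 1)) := by
  obtain ⟨A, B, G, D, E, F, rfl⟩ := exists_quadratic_coeffs hp
  have h' : ((A - a * D + F * a ^ 2 : ℝ) : ℂ) * ω ^ 2 +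
      ((B - a * E - b * D + 2 * F * a * b : ℝ) : ℂ) * ω + ((G - b * E + F * b ^ 2 : ℝ) : ℂ) = 0 := by
    simp at h
    push_cast
    linear_combination h
  have him := congrArg Complex.im h'
  have hre := congrArg Complex.re h'
  simp [sq] at him hre
  have hB : B - a * E - b * D + 2 * F * a * b = (A - a * D + F * a ^ 2) * (-2 * ω.re) := by
    refine mul_right_cancel₀ hω ?_
    linear_combination him
  have hG : G - b * E + F * b ^ 2 = (A - a * D + F * a ^ 2) * Complex.normSq ω := by
    rw [Complex.normSq_apply]
    linear_combination hre - ω.re * hB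
  refine ⟨A - a * D + F * a ^ 2, D - 2 * F * a, E - 2 * F * b, F, ?_⟩
  have hB' := congrArg (C : ℝ → MvPolynomial (Fin 3) ℝ) hB
  have hG' := congrArg (C : ℝ → MvPolynomial (Fin 3) ℝ) hG
  simp only [map_add, map_sub, map_mul, map_pow] at hB' hG' ⊢
  simp only [show (C 2 : MvPolynomial (Fin 3) ℝ) = 2 from map_ofNat C 2] at hB' ⊢
  linear_combination X 0 * X 1 * hB' + X 1 ^ 2 * hG'

theorem exists_perm_aeval_eq_zero {x : Fin 3 → ℂ} (hx : x ≠ 0)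
    (hreal : ∀ c : ℂ, ∀ v : Fin 3 → ℝ, v ≠ 0 → x ≠ fun i => c * v i) :
    ∃ (σ : Equiv.Perm (Fin 3)) (c ω : ℂ) (a b : ℝ), c ≠ 0 ∧ ω.im ≠ 0 ∧
      x = fun i => c * ![ω, 1, -(a * ω) - b] (σ i) := by
  obtain ⟨i, hi⟩ := Function.ne_iff.1 hx
  simp only [Pi.zero_apply] at hi
  obtain ⟨j, hj⟩ : ∃ j, (x j / x i).im ≠ 0 := by
    by_contra! h
    refine hreal (x i) (fun j => (x j / x i).re) (fun h0 => ?_) ?_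
    · have := congrFun h0 i
      simp [hi] at this
    · ext j
      rw [show (((x j / x i).re : ℝ) : ℂ) = x j / x i from Complex.ext rfl (by simp [h j])]
      field_simp
  have hij : i ≠ j := by
    rintro rfl
    simp [hi] at hj
  obtain ⟨σ, k, hσj, hσi, hσk, hcover⟩ : ∃ (σ : Equiv.Perm (Fin 3)) (k : Fin 3),
      σ j = 0 ∧ σ i = 1 ∧ σ k = 2 ∧ ∀ m, m = i ∨ m = j ∨ m = k := by
    clear * - hij
    decide +revert
  refine ⟨σ, x i, x j / x i, -((x k / x i).im / (x j / x i).im),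
    -((x k / x i).re - (x k / x i).im / (x j / x i).im * (x j / x i).re), hi, hj, ?_⟩
  have hk : -(((-((x k / x i).im / (x j / x i).im) : ℝ) : ℂ) * (x j / x i)) -
      ((-((x k / x i).re - (x k / x i).im / (x j / x i).im * (x j / x i).re) : ℝ) : ℂ) =
      x k / x i := by
    generalize x j / x i = ω at *
    apply Complex.ext
    · simp
    · simp
      field_simp
  ext m
  rcases hcover m with rfl | rfl | rfl
  · simp [hσi]
  · simp only [hσj, Matrix.cons_val_zero]
    field_simp
  · simp only [hσk, Matrix.cons_val, hk]
    field_simp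

theorem aeval_mul_eq_sq_mul {p : MvPolynomial (Fin 3) ℝ} (hp : p.IsHomogeneous 2) (c : ℂ)
    (x : Fin 3 → ℂ) : aeval (fun i => c * x i) p = c ^ 2 * aeval x p := by
  obtain ⟨a, b, d, e, f, g, rfl⟩ := exists_quadratic_coeffs hp
  simp
  ring

/-- A sum of three squares of quadratic forms with a common complex zero but no common real zero
lies in one of six thirteen-dimensional families. -/
theorem exists_perm_sum_sq_eq {p q r : MvPolynomial (Fin 3) ℝ} (hp : p.IsHomogeneous 2)
    (hq : q.IsHomogeneous 2) (hr : r.IsHomogeneous 2)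
    (hreal : ∀ v : Fin 3 → ℝ, eval v p = 0 → eval v q = 0 → eval v r = 0 → v = 0)
    {x : Fin 3 → ℂ} (hx : x ≠ 0) (hxp : aeval x p = 0) (hxq : aeval x q = 0)
    (hxr : aeval x r = 0) :
    ∃ (σ : Equiv.Perm (Fin 3)) (a b m n α e₀ e₁ : ℝ) (s : MvPolynomial (Fin 3) ℝ),
      s.IsHomogeneous 2 ∧ p ^ 2 + q ^ 2 + r ^ 2 = rename σ
        (C α * (X 0 ^ 2 + C m * (X 0 * X 1) + C n * X 1 ^ 2) ^ 2 +
          (X 0 ^ 2 + C m * (X 0 * X 1) + C n * X 1 ^ 2) *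
            ((X 2 + C a * X 0 + C b * X 1) * (C e₀ * X 0 + C e₁ * X 1)) +
          (X 2 + C a * X 0 + C b * X 1) ^ 2 * s) := by
  obtain ⟨σ, c, ω, a, b, hc, hω, hxeq⟩ := exists_perm_aeval_eq_zero hx fun c v hv hxv => by
    have hc : c ≠ 0 := by
      rintro rfl
      exact hx (by rw [hxv]; ext; simp)
    have hev {g : MvPolynomial (Fin 3) ℝ} (hg : g.IsHomogeneous 2) (h : aeval x g = 0) :
        eval v g = 0 := by
      rw [hxv, aeval_mul_eq_sq_mul hg] at h
      have h' := (mul_eq_zero.1 h).resolve_left (pow_ne_zero _ hc)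
      have h'' : aeval (algebraMap ℝ ℂ ∘ v) g = 0 := h'
      rw [aeval_algebraMap_apply] at h''
      simpa using h''
    exact hv (hreal v (hev hp hxp) (hev hq hxq) (hev hr hxr))
  have hform {g : MvPolynomial (Fin 3) ℝ} (hg : g.IsHomogeneous 2) (h : aeval x g = 0) :=
    exists_eq_of_aeval_eq_zero (p := rename σ g) hg.rename_isHomogeneous hω (a := a) (b := b) (by
      rw [hxeq, aeval_mul_eq_sq_mul hg] at h
      rw [aeval_rename]
      exact (mul_eq_zero.1 h).resolve_left (pow_ne_zero _ hc))
  obtain ⟨α, d, e, g, h1⟩ := hform hp hxp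
  obtain ⟨α', d', e', g', h2⟩ := hform hq hxq
  obtain ⟨α'', d'', e'', g'', h3⟩ := hform hr hxr
  have hinv (u : MvPolynomial (Fin 3) ℝ) : rename σ.symm (rename σ u) = u := by
    rw [rename_rename]
    simp
  set Q : MvPolynomial (Fin 3) ℝ :=
    X 0 ^ 2 + C (-2 * ω.re) * (X 0 * X 1) + C (Complex.normSq ω) * X 1 ^ 2 with hQ
  set z : MvPolynomial (Fin 3) ℝ := X 2 + C a * X 0 + C b * X 1 with hz
  have hz1 : z.IsHomogeneous 1 :=
    ((isHomogeneous_X _ _).add (isHomogeneous_C_mul_X _ _)).add (isHomogeneous_C_mul_X _ _)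
  have hl (d e g : ℝ) : (C d * X 0 + C e * X 1 + C g * z).IsHomogeneous 1 :=
    ((isHomogeneous_C_mul_X _ _).add (isHomogeneous_C_mul_X _ _)).add (hz1.C_mul _)
  have hQ2 : Q.IsHomogeneous 2 :=
    ((isHomogeneous_X_pow _ _).add (((isHomogeneous_X _ _).mul (isHomogeneous_X _ _)).C_mul _)).add
      (isHomogeneous_C_mul_X_pow _ _ _)
  refine ⟨σ.symm, a, b, -2 * ω.re, Complex.normSq ω, α ^ 2 + α' ^ 2 + α'' ^ 2,
    2 * (α * d + α' * d' + α'' * d''), 2 * (α * e + α' * e' + α'' * e''),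
    C (2 * (α * g + α' * g' + α'' * g'')) * Q + (C d * X 0 + C e * X 1 + C g * z) ^ 2 +
      (C d' * X 0 + C e' * X 1 + C g' * z) ^ 2 + (C d'' * X 0 + C e'' * X 1 + C g'' * z) ^ 2,
    (((hQ2.C_mul _).add ((hl _ _ _).pow 2)).add ((hl _ _ _).pow 2)).add ((hl _ _ _).pow 2), ?_⟩
  rw [← hinv (p ^ 2 + q ^ 2 + r ^ 2)]
  congr 1
  rw [map_add, map_add, map_pow, map_pow, map_pow, h1, h2, h3, ← hQ, ← hz]
  clear_value Q z
  simp only [map_add, map_mul, map_pow, show (C 2 : MvPolynomial (Fin 3) ℝ) = 2 from map_ofNat C 2]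
  ring

/-- The space of real ternary forms of degree `n`. -/
abbrev TernaryForm (n : ℕ) : Type := homogeneousSubmodule (Fin 3) ℝ n

namespace TernaryForm

open Filter Topology Set

instance (n : ℕ) : FiniteDimensional ℝ (TernaryForm n) :=
  Module.Finite.of_fg (homogeneousSubmodule_fg (Fin 3) ℝ n)

noncomputable instance (n : ℕ) : NormedAddCommGroup (TernaryForm n) :=
  NormedAddCommGroup.induced _ _ (Module.finBasis ℝ (TernaryForm n)).equivFun
    (LinearEquiv.injective _)

noncomputable instance (n : ℕ) : NormedSpace ℝ (TernaryForm n) :=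
  NormedSpace.induced ℝ _ _ (Module.finBasis ℝ (TernaryForm n)).equivFun.toLinearMap

noncomputable instance (n : ℕ) : UniformSpace (TernaryForm n) :=
  PseudoMetricSpace.toUniformSpace

noncomputable instance (n : ℕ) : TopologicalSpace (TernaryForm n) :=
  UniformSpace.toTopologicalSpace

theorem finrank_eq (n : ℕ) : Module.finrank ℝ (TernaryForm n) = (n + 2).choose n := by
  have hset : {d : Fin 3 →₀ ℕ | d.degree = n} =
      ((Finset.univ.finsuppAntidiag n : Finset (Fin 3 →₀ ℕ)) : Set (Fin 3 →₀ ℕ)) := by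
    ext d
    simp [Finset.mem_finsuppAntidiag, Finsupp.degree_eq_sum]
  change Module.finrank ℝ (homogeneousSubmodule (Fin 3) ℝ n) = _
  rw [homogeneousSubmodule_eq_finsupp_supported, hset,
    (AddMonoidAlgebra.supportedEquivFinsupp _).finrank_eq, Module.finrank_finsupp_self]
  simp [Finset.card_finsuppAntidiag_nat_eq_choose]
  congr 1
  omega

/-- Multiplication of forms, as a continuous bilinear map. -/
noncomputable def mulL {m n k : ℕ} (h : m + n = k) :
    TernaryForm m →L[ℝ] TernaryForm n →L[ℝ] TernaryForm k :=
  LinearMap.toContinuousBilinearMap (LinearMap.mk₂ ℝ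
    (fun p q : TernaryForm _ => (⟨p * q, h ▸ p.2.mul q.2⟩ : TernaryForm k))
    (fun _ _ _ => Subtype.ext (add_mul _ _ _)) (fun _ _ _ => Subtype.ext (smul_mul_assoc _ _ _))
    (fun _ _ _ => Subtype.ext (mul_add _ _ _)) (fun _ _ _ => Subtype.ext (mul_smul_comm _ _ _)))

@[simp]
theorem coe_mulL {m n k : ℕ} (h : m + n = k) (p : TernaryForm m) (q : TernaryForm n) :
    (mulL h p q : MvPolynomial (Fin 3) ℝ) = p * q := rfl

/-- Multiplication of linear forms. -/
noncomputable abbrev mulLin : TernaryForm 1 →L[ℝ] TernaryForm 1 →L[ℝ] TernaryForm 2 :=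
  mulL one_add_one_eq_two

/-- Multiplication of quadratic forms. -/
noncomputable abbrev mulQuad : TernaryForm 2 →L[ℝ] TernaryForm 2 →L[ℝ] TernaryForm 4 :=
  mulL two_add_two_eq_four

/-- Permutation of the variables, as a continuous linear map. -/
noncomputable def renameL (n : ℕ) (σ : Equiv.Perm (Fin 3)) : TernaryForm n →L[ℝ] TernaryForm n :=
  LinearMap.toContinuousLinearMap ((rename σ).toLinearMap.restrict
    (fun _ hp => IsHomogeneous.rename_isHomogeneous hp))

@[simp]
theorem coe_renameL {n : ℕ} (σ : Equiv.Perm (Fin 3)) (p : TernaryForm n) :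
    (renameL n σ p : MvPolynomial (Fin 3) ℝ) = rename σ (p : MvPolynomial (Fin 3) ℝ) := rfl

/-- A variable, as a linear form. -/
noncomputable def var (i : Fin 3) : TernaryForm 1 := ⟨X i, isHomogeneous_X _ _⟩

@[simp]
theorem coe_var (i : Fin 3) : (var i : MvPolynomial (Fin 3) ℝ) = X i := rfl

/-- The sum of the squares of three quadratic forms. -/
noncomputable def sumSq (v : TernaryForm 2 × TernaryForm 2 × TernaryForm 2) : TernaryForm 4 :=
  mulQuad v.1 v.1 + mulQuad v.2.1 v.2.1 + mulQuad v.2.2 v.2.2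

theorem coe_sumSq (v : TernaryForm 2 × TernaryForm 2 × TernaryForm 2) :
    (sumSq v : MvPolynomial (Fin 3) ℝ) =
      (v.1 : MvPolynomial (Fin 3) ℝ) ^ 2 + (v.2.1 : MvPolynomial (Fin 3) ℝ) ^ 2 +
        (v.2.2 : MvPolynomial (Fin 3) ℝ) ^ 2 := by
  simp [sumSq, sq]

theorem continuous_sumSq : Continuous sumSq := by
  unfold sumSq
  fun_prop

theorem sumSq_smul (c : ℝ) (v : TernaryForm 2 × TernaryForm 2 × TernaryForm 2) :
    sumSq (c • v) = c ^ 2 • sumSq v := by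
  simp [sumSq, smul_smul, sq]

theorem sumSq_eq_zero {v : TernaryForm 2 × TernaryForm 2 × TernaryForm 2} (h : sumSq v = 0) :
    v = 0 := by
  have h' (x : Fin 3 → ℝ) : eval x (v.1 : MvPolynomial (Fin 3) ℝ) = 0 ∧
      eval x (v.2.1 : MvPolynomial (Fin 3) ℝ) = 0 ∧
      eval x (v.2.2 : MvPolynomial (Fin 3) ℝ) = 0 := by
    have := congrArg (fun p : TernaryForm 4 => eval x (p : MvPolynomial (Fin 3) ℝ)) h
    simp only [coe_sumSq, map_add, map_pow, ZeroMemClass.coe_zero, map_zero] at this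
    refine ⟨?_, ?_, ?_⟩ <;> refine pow_eq_zero_iff two_ne_zero |>.1 ?_ <;>
      nlinarith [sq_nonneg (eval x (v.1 : MvPolynomial (Fin 3) ℝ)),
        sq_nonneg (eval x (v.2.1 : MvPolynomial (Fin 3) ℝ)),
        sq_nonneg (eval x (v.2.2 : MvPolynomial (Fin 3) ℝ))]
  ext1
  · exact Subtype.ext (MvPolynomial.funext fun x => by simpa using (h' x).1)
  · ext1
    · exact Subtype.ext (MvPolynomial.funext fun x => by simpa using (h' x).2.1)
    · exact Subtype.ext (MvPolynomial.funext fun x => by simpa using (h' x).2.2)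

end TernaryForm

open Filter Topology Set in
/-- A continuous map that is homogeneous of degree two and anisotropic has closed range. -/
theorem isClosed_range_of_map_smul {V W : Type*} [NormedAddCommGroup V] [NormedSpace ℝ V]
    [FiniteDimensional ℝ V] [NormedAddCommGroup W] [NormedSpace ℝ W] [ProperSpace W] {φ : V → W}
    (hφ : Continuous φ) (hsmul : ∀ (c : ℝ) v, φ (c • v) = c ^ 2 • φ v)
    (h0 : ∀ v, φ v = 0 → v = 0) : IsClosed (range φ) := by
  have : ProperSpace V := FiniteDimensional.proper_real V
  rcases subsingleton_or_nontrivial V with hV | hV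
  · exact (Set.finite_range φ).isClosed
  obtain ⟨w, hw, hmin⟩ := (isCompact_sphere (0 : V) 1).exists_isMinOn
    (NormedSpace.sphere_nonempty.2 zero_le_one) hφ.norm.continuousOn
  have hδ : 0 < ‖φ w‖ := norm_pos_iff.2 fun h => by simp [h0 w h] at hw
  have hle (v : V) : ‖φ w‖ * ‖v‖ ^ 2 ≤ ‖φ v‖ := by
    rcases eq_or_ne v 0 with rfl | hv
    · simp
    have hv' := norm_ne_zero_iff.2 hv
    have hmem : ‖v‖⁻¹ • v ∈ Metric.sphere (0 : V) 1 := by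
      simp [norm_smul, hv']
    have := hmin hmem
    simp only [mem_ofPred_eq, hsmul, norm_smul, norm_pow, norm_inv, norm_norm] at this
    rw [inv_pow, ← div_eq_inv_mul, le_div_iff₀ (by positivity)] at this
    exact this
  have hproper : IsProperMap φ := by
    refine isProperMap_iff_tendsto_cocompact.2 ⟨hφ, ?_⟩
    rw [← Metric.cobounded_eq_cocompact, ← Metric.cobounded_eq_cocompact,
      ← tendsto_norm_atTop_iff_cobounded]
    exact tendsto_atTop_mono hle (((tendsto_pow_atTop two_ne_zero).comp
      tendsto_norm_cobounded_atTop).const_mul_atTop hδ)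
  exact hproper.isClosedMap.isClosed_range

namespace TernaryForm

open Filter Topology Set

theorem isClosed_range_sumSq : IsClosed (range sumSq) :=
  isClosed_range_of_map_smul continuous_sumSq sumSq_smul fun _ => sumSq_eq_zero

theorem range_sumSq_mem_nhds {v : TernaryForm 2 × TernaryForm 2 × TernaryForm 2}
    (h : ∀ x : Fin 3 → ℂ, aeval x (v.1 : MvPolynomial (Fin 3) ℝ) = 0 →
      aeval x (v.2.1 : MvPolynomial (Fin 3) ℝ) = 0 →
      aeval x (v.2.2 : MvPolynomial (Fin 3) ℝ) = 0 → x = 0) :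
    range sumSq ∈ 𝓝 (sumSq v) := by
  have h1 : HasStrictFDerivAt (fun w : TernaryForm 2 × TernaryForm 2 × TernaryForm 2 => w.1)
      _ v := hasStrictFDerivAt_fst (𝕜 := ℝ)
  have h2 : HasStrictFDerivAt (fun w : TernaryForm 2 × TernaryForm 2 × TernaryForm 2 => w.2)
      _ v := hasStrictFDerivAt_snd (𝕜 := ℝ)
  have h3 : HasStrictFDerivAt (fun w : TernaryForm 2 × TernaryForm 2 × TernaryForm 2 => w.2.1)
      _ v := h2.fst
  have h4 : HasStrictFDerivAt (fun w : TernaryForm 2 × TernaryForm 2 × TernaryForm 2 => w.2.2)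
      _ v := h2.snd
  have hd := ((mulQuad.hasStrictFDerivAt_of_bilinear h1 h1).add
    (mulQuad.hasStrictFDerivAt_of_bilinear h3 h3)).add
    (mulQuad.hasStrictFDerivAt_of_bilinear h4 h4)
  have hmap := HasStrictFDerivAt.map_nhds_eq_of_surj hd <| LinearMap.range_eq_top.2 fun u => by
    obtain ⟨a, b, c, ha, hb, hc, hu⟩ :=
      exists_combination_of_no_common_zero v.1.2 v.2.1.2 v.2.2.2 h u.2
    refine ⟨((2⁻¹ : ℝ) • ⟨a, ha⟩, (2⁻¹ : ℝ) • ⟨b, hb⟩, (2⁻¹ : ℝ) • ⟨c, hc⟩), Subtype.ext ?_⟩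
    rw [hu]
    have h2 : (C 2⁻¹ : MvPolynomial (Fin 3) ℝ) * 2 = 1 := by
      rw [← map_ofNat (C : ℝ →+* MvPolynomial (Fin 3) ℝ) 2, ← C_mul]
      norm_num
    simp [smul_eq_C_mul]
    linear_combination (a * v.1 + b * v.2.1 + c * v.2.2) * h2
  change map sumSq (𝓝 v) = 𝓝 (sumSq v) at hmap
  rw [← hmap]
  exact range_mem_map

/-- The six families containing every sum of three squares of quadratic forms with a common
complex zero but no common real zero. -/
noncomputable def family (σ : Equiv.Perm (Fin 3)) (c : Fin 7 → ℝ) (s : TernaryForm 2) :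
    TernaryForm 4 :=
  renameL 4 σ
    (c 4 • mulQuad
      (mulLin (var 0) (var 0) + c 2 • mulLin (var 0) (var 1) + c 3 • mulLin (var 1) (var 1))
      (mulLin (var 0) (var 0) + c 2 • mulLin (var 0) (var 1) + c 3 • mulLin (var 1) (var 1)) +
    mulQuad
      (mulLin (var 0) (var 0) + c 2 • mulLin (var 0) (var 1) + c 3 • mulLin (var 1) (var 1))
      (mulLin (var 2 + c 0 • var 0 + c 1 • var 1) (c 5 • var 0 + c 6 • var 1)) +
    mulQuad (mulLin (var 2 + c 0 • var 0 + c 1 • var 1) (var 2 + c 0 • var 0 + c 1 • var 1)) s)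

theorem contDiff_family (σ : Equiv.Perm (Fin 3)) :
    ContDiff ℝ 1 (fun e : (Fin 7 → ℝ) × TernaryForm 2 => family σ e.1 e.2) := by
  unfold family
  fun_prop

theorem exists_smul_family_eq (σ : Equiv.Perm (Fin 3)) (c : Fin 7 → ℝ) (s : TernaryForm 2)
    (k : ℝ) : ∃ c' s', k • family σ c s = family σ c' s' := by
  refine ⟨![c 0, c 1, c 2, c 3, k * c 4, k * c 5, k * c 6], k • s, ?_⟩
  simp only [family, ← map_smul]
  congr 1
  apply Subtype.ext
  simp [smul_eq_C_mul]
  ring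

theorem exists_family_eq {v : TernaryForm 2 × TernaryForm 2 × TernaryForm 2}
    (hpos : ∀ x : Fin 3 → ℝ, x ≠ 0 → 0 < eval x (sumSq v : MvPolynomial (Fin 3) ℝ))
    {x : Fin 3 → ℂ} (hx : x ≠ 0) (hx1 : aeval x (v.1 : MvPolynomial (Fin 3) ℝ) = 0)
    (hx2 : aeval x (v.2.1 : MvPolynomial (Fin 3) ℝ) = 0)
    (hx3 : aeval x (v.2.2 : MvPolynomial (Fin 3) ℝ) = 0) :
    ∃ σ c s, sumSq v = family σ c s := by
  obtain ⟨σ, a, b, m, n, α, e₀, e₁, s, hs, h⟩ := exists_perm_sum_sq_eq v.1.2 v.2.1.2 v.2.2.2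
    (fun y h1 h2 h3 => by
      by_contra hy
      have := hpos y hy
      simp [coe_sumSq, h1, h2, h3] at this) hx hx1 hx2 hx3
  refine ⟨σ, ![a, b, m, n, α, e₀, e₁], ⟨s, hs⟩, Subtype.ext ?_⟩
  rw [coe_sumSq, h, family, coe_renameL]
  congr 1
  simp [smul_eq_C_mul]
  ring

theorem dense_compl_family (f : TernaryForm 4) :
    Dense (⋃ σ : Equiv.Perm (Fin 3), range fun e : ((Fin 7 → ℝ) × TernaryForm 2) × ℝ =>
      family σ e.1.1 e.1.2 - e.2 • f)ᶜ := by
  refine dense_compl_of_dimH_lt_finrank ?_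
  rw [dimH_iUnion, finrank_eq]
  have hle (σ : Equiv.Perm (Fin 3)) : dimH (range fun e : ((Fin 7 → ℝ) × TernaryForm 2) × ℝ =>
      family σ e.1.1 e.1.2 - e.2 • f) ≤ (14 : ℕ) := by
    refine (ContDiff.dimH_range_le (((contDiff_family σ).comp contDiff_fst).sub
      (contDiff_snd.smul contDiff_const))).trans ?_
    simp [finrank_eq, Nat.choose]
  refine (iSup_le hle).trans_lt ?_
  norm_num [Nat.choose]

theorem eval_sumSq_nonneg (v : TernaryForm 2 × TernaryForm 2 × TernaryForm 2) (x : Fin 3 → ℝ) :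
    0 ≤ eval x (sumSq v : MvPolynomial (Fin 3) ℝ) := by
  simp only [coe_sumSq, map_add, map_pow]
  positivity

theorem segment_subset_range_sumSq {f g : TernaryForm 4}
    (hf : ∀ x : Fin 3 → ℝ, 0 ≤ eval x (f : MvPolynomial (Fin 3) ℝ))
    (hg : ∀ x : Fin 3 → ℝ, x ≠ 0 → 0 < eval x (g : MvPolynomial (Fin 3) ℝ))
    (hgS : g ∈ range sumSq)
    (hgf : ∀ (σ : Equiv.Perm (Fin 3)) (c : Fin 7 → ℝ) (s : TernaryForm 2) (k : ℝ),
      g ≠ family σ c s - k • f) :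
    Icc (0 : ℝ) 1 ⊆ {t : ℝ | (1 - t) • g + t • f ∈ range sumSq} := by
  have hcont : Continuous fun t : ℝ => (1 - t) • g + t • f := by fun_prop
  refine IsClosed.Icc_subset_of_forall_mem_nhdsWithin
    ((isClosed_range_sumSq.preimage hcont).inter isClosed_Icc) (by simpa using hgS) ?_
  rintro t ⟨⟨v, hv⟩, ht0, ht1⟩
  refine mem_nhdsWithin_of_mem_nhds (hcont.continuousAt.preimage_mem_nhds ?_)
  rw [← hv]
  refine range_sumSq_mem_nhds fun x h1 h2 h3 => ?_
  by_contra hx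
  have ht : 0 < 1 - t := sub_pos.2 ht1
  obtain ⟨σ, c, s, h⟩ := exists_family_eq (fun y hy => by
    rw [hv]
    simp only [Submodule.coe_add, Submodule.coe_smul, map_add, smul_eval]
    have := mul_pos ht (hg y hy)
    have := mul_nonneg ht0 (hf y)
    positivity) hx h1 h2 h3
  obtain ⟨c', s', h'⟩ := exists_smul_family_eq σ c s (1 - t)⁻¹
  refine hgf σ c' s' ((1 - t)⁻¹ * t) ?_
  rw [← h', ← h, hv, smul_add, inv_smul_smul₀ ht.ne', smul_smul, add_sub_cancel_right]

theorem mem_range_sumSq_of_nonneg {f : TernaryForm 4}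
    (hf : ∀ x : Fin 3 → ℝ, 0 ≤ eval x (f : MvPolynomial (Fin 3) ℝ)) : f ∈ range sumSq := by
  set v₀ : TernaryForm 2 × TernaryForm 2 × TernaryForm 2 :=
    (mulLin (var 0) (var 0), mulLin (var 1) (var 1), mulLin (var 2) (var 2)) with hv₀
  have hS : range sumSq ∈ 𝓝 (sumSq v₀) := range_sumSq_mem_nhds fun x h1 h2 h3 => by
    simp [hv₀] at h1 h2 h3
    ext i
    fin_cases i <;> simpa
  have hS' : {g | (2 : ℝ) • g - sumSq v₀ ∈ range sumSq} ∈ 𝓝 (sumSq v₀) := by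
    have hcont : Continuous fun g : TernaryForm 4 => (2 : ℝ) • g - sumSq v₀ := by fun_prop
    refine hcont.continuousAt.preimage_mem_nhds ?_
    rwa [two_smul, add_sub_cancel_right]
  obtain ⟨g, hg, hgS, w, hw⟩ := (dense_compl_family f).inter_nhds_nonempty (inter_mem hS hS')
  have hpos (x : Fin 3 → ℝ) (hx : x ≠ 0) : 0 < eval x (g : MvPolynomial (Fin 3) ℝ) := by
    have h0 : 0 < eval x (sumSq v₀ : MvPolynomial (Fin 3) ℝ) := by
      obtain ⟨i, hi⟩ := Function.ne_iff.1 hx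
      simp only [Pi.zero_apply] at hi
      simp [coe_sumSq, hv₀]
      fin_cases i <;> simp at hi <;> positivity
    have hwx := congrArg (fun p : TernaryForm 4 => eval x (p : MvPolynomial (Fin 3) ℝ)) hw
    simp only [AddSubgroupClass.coe_sub, Submodule.coe_smul, map_sub, smul_eval] at hwx
    linarith [eval_sumSq_nonneg w x]
  have := segment_subset_range_sumSq hf hpos hgS (fun σ c s k h =>
    hg (mem_iUnion.2 ⟨σ, ((c, s), k), h.symm⟩)) (right_mem_Icc.2 zero_le_one)
  simpa using this

end TernaryForm

end

/-- Hilbert's theorem on ternary quartics: every non-negative real ternary quartic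
form is a sum of three squares of real quadratic forms. -/
theorem hilbert_ternary_quartics
    (f : MvPolynomial (Fin 3) ℝ)
    (hf : f.IsHomogeneous 4)
    (hnn : ∀ x : Fin 3 → ℝ, 0 ≤ MvPolynomial.eval x f) :
    ∃ p q r : MvPolynomial (Fin 3) ℝ,
      p.IsHomogeneous 2 ∧ q.IsHomogeneous 2 ∧ r.IsHomogeneous 2 ∧
      f = p ^ 2 + q ^ 2 + r ^ 2 := by
  obtain ⟨v, hv⟩ := TernaryForm.mem_range_sumSq_of_nonneg (f := ⟨f, hf⟩) hnn
  exact ⟨v.1, v.2.1, v.2.2, v.1.2, v.2.1.2, v.2.2.2,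
    (congrArg Subtype.val hv).symm.trans (TernaryForm.coe_sumSq v)⟩
end

section
/- Let f be a non-negative real ternary quartic form which defines a smooth complex plane curve, i.e., for every nonzero point (x,y,z) ∈ ℂ³ with f(x,y,z) = 0, at least one partial derivative of f is nonzero at (x,y,z). Then f has exactly 8 equivalence classes of representations f = p² + q² + r² as a sum of three squares of real quadratic forms, where two representations are equivalent if the triples of quadratic forms have the same linear span. -/
/-- The type of representations of `f` as a sum of three squares of
real quadratic forms. -/
def SOSRep (f : MvPolynomial (Fin 3) ℝ) : Type :=
  { t : MvPolynomial (Fin 3) ℝ × MvPolynomial (Fin 3) ℝ × MvPolynomial (Fin 3) ℝ //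
      t.1.IsHomogeneous 2 ∧ t.2.1.IsHomogeneous 2 ∧ t.2.2.IsHomogeneous 2 ∧
      f = t.1 ^ 2 + t.2.1 ^ 2 + t.2.2 ^ 2 }

/-- Two representations are equivalent when the triples of quadratic forms have
the same linear span in the space of quadratic forms. -/
noncomputable def SOSRepSetoid (f : MvPolynomial (Fin 3) ℝ) : Setoid (SOSRep f) :=
  Setoid.ker (fun t =>
    Submodule.span ℝ ({t.1.1, t.1.2.1, t.1.2.2} : Set (MvPolynomial (Fin 3) ℝ)))

namespace TernaryQuartic

open Filter Topology

/-- The ternary quadratic form with coefficient vector `a`, in the monomials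
`x², y², z², yz, xz, xy`. -/
def quad {R : Type*} [CommRing R] (a : Fin 6 → R) (x : Fin 3 → R) : R :=
  a 0 * x 0 ^ 2 + a 1 * x 1 ^ 2 + a 2 * x 2 ^ 2 + a 3 * (x 1 * x 2) + a 4 * (x 0 * x 2) +
    a 5 * (x 0 * x 1)

/-- The binary quadratic form with coefficient vector `b`. -/
def binQuad (b : Fin 3 → ℂ) (s t : ℂ) : ℂ := b 0 * s ^ 2 + b 1 * (s * t) + b 2 * t ^ 2

/-- Three complex conics without a common point. -/
def NoCommonZero (p q r : Fin 6 → ℂ) : Prop :=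
  ∀ x, quad p x = 0 → quad q x = 0 → quad r x = 0 → x = 0

section Binary

open Polynomial

lemma binQuad_syzygy_of_leadingCoeff {b c q r : Fin 3 → ℂ} (hq : q 0 ≠ 0)
    (H : ∀ s t, binQuad b s t * binQuad q s t + binQuad c s t * binQuad r s t = 0)
    (N : ∀ s t, binQuad q s t = 0 → binQuad r s t = 0 → s = 0 ∧ t = 0) :
    ∃ k : ℂ, b = k • r ∧ c = -k • q := by
  let P : (Fin 3 → ℂ) → ℂ[X] := fun b => C (b 0) * X ^ 2 + C (b 1) * X + C (b 2)
  have hP : ∀ b s, (P b).eval s = binQuad b s 1 := by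
    intro b s; simp [P, binQuad]
  have hPe : ∀ (b c : Fin 3 → ℂ), P b = P c → b = c := by
    intro b c h
    have h0 := congrArg (fun p => coeff p 2) h
    have h1 := congrArg (fun p => coeff p 1) h
    have h2 := congrArg (fun p => coeff p 0) h
    simp [P, coeff_C, coeff_X] at h0 h1 h2
    ext i; fin_cases i <;> simp_all
  have hdeg : (P q).natDegree = 2 := natDegree_quadratic hq
  have hQ0 : P q ≠ 0 := by
    intro h; rw [h] at hdeg; simp at hdeg
  have heq : P b * P q + P c * P r = 0 := by
    apply Polynomial.funext
    intro s
    simpa [hP] using H s 1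
  have hcop : IsCoprime (P q) (P r) := by
    rw [Polynomial.isCoprime_iff_aeval_ne_zero_of_isAlgClosed ℂ ℂ]
    intro s
    by_contra! hs
    simp only [coe_aeval_eq_eval, hP] at hs
    exact one_ne_zero (N s 1 hs.1 hs.2).2
  have hdvd : P q ∣ P c := by
    refine hcop.dvd_of_dvd_mul_right ⟨-P b, ?_⟩
    linear_combination heq
  obtain ⟨K, hK⟩ := hdvd
  have hKdeg : K.natDegree = 0 := by
    by_cases hK0 : K = 0
    · simp [hK0]
    have h1 := natDegree_mul hQ0 hK0
    rw [← hK, hdeg] at h1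
    have h2 : (P c).natDegree ≤ 2 := natDegree_quadratic_le
    omega
  obtain ⟨k, rfl⟩ := natDegree_eq_zero.mp hKdeg
  have hc : c = k • q := by
    apply hPe
    rw [hK]; simp [P]; ring
  refine ⟨-k, ?_, by simpa using hc⟩
  apply hPe
  apply mul_right_cancel₀ hQ0
  have : P ((-k) • r) = - C k * P r := by simp [P]; ring
  rw [this]
  rw [hK] at heq
  linear_combination heq

/-- Two binary quadratic forms without a common zero have only the trivial quadratic syzygy. -/
lemma binQuad_syzygy {b c q r : Fin 3 → ℂ}
    (H : ∀ s t, binQuad b s t * binQuad q s t + binQuad c s t * binQuad r s t = 0)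
    (N : ∀ s t, binQuad q s t = 0 → binQuad r s t = 0 → s = 0 ∧ t = 0) :
    ∃ k : ℂ, b = k • r ∧ c = -k • q := by
  by_cases hq : q 0 = 0
  · have hr : r 0 ≠ 0 := by
      intro hr
      exact one_ne_zero (N 1 0 (by simp [binQuad, hq]) (by simp [binQuad, hr])).1
    obtain ⟨k, h1, h2⟩ := binQuad_syzygy_of_leadingCoeff (b := c) (c := b) (q := r) (r := q) hr
      (fun s t => by rw [add_comm]; exact H s t) (fun s t h1 h2 => N s t h2 h1)
    exact ⟨-k, h2, by simpa using h1⟩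
  · exact binQuad_syzygy_of_leadingCoeff hq H N

end Binary

lemma exists_binQuad_eq_zero (b : Fin 3 → ℂ) : ∃ s t, binQuad b s t = 0 ∧ (s ≠ 0 ∨ t ≠ 0) := by
  by_cases h : b 0 = 0
  · exact ⟨1, 0, by simp [binQuad, h]⟩
  · obtain ⟨d, hd⟩ := IsAlgClosed.exists_pow_nat_eq (b 1 ^ 2 - 4 * b 0 * b 2) (n := 2) (by norm_num)
    refine ⟨(-b 1 + d) / (2 * b 0), 1, ?_, by simp⟩
    simp only [binQuad]
    field_simp
    linear_combination hd

/-- Two binary quadratic forms without a common zero have no nonzero linear syzygy. -/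
lemma binLin_syzygy {u v u' v' : ℂ} {q r : Fin 3 → ℂ}
    (H : ∀ s t, (u * s + v * t) * binQuad q s t + (u' * s + v' * t) * binQuad r s t = 0)
    (N : ∀ s t, binQuad q s t = 0 → binQuad r s t = 0 → s = 0 ∧ t = 0) :
    u = 0 ∧ v = 0 ∧ u' = 0 ∧ v' = 0 := by
  obtain ⟨k, h1, h2⟩ := binQuad_syzygy (b := ![u, v, 0]) (c := ![u', v', 0]) (q := q) (r := r)
    (fun s t => by
      simp only [binQuad, Matrix.cons_val] at H ⊢
      linear_combination s * H s t) N
  have hk : k = 0 := by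
    by_contra hk
    have e1 := congrFun h1 2
    have e2 := congrFun h2 2
    simp [hk] at e1 e2
    exact one_ne_zero (N 0 1 (by simp [binQuad, e2]) (by simp [binQuad, e1])).2
  subst hk
  have e1 := congrFun h1 0
  have e2 := congrFun h1 1
  have e3 := congrFun h2 0
  have e4 := congrFun h2 1
  simp at e1 e2 e3 e4
  exact ⟨e1, e2, e3, e4⟩

/-- A continuous function which vanishes after multiplication by a nonzero linear form is zero. -/
lemma eq_zero_of_linear_mul {F l : (Fin 3 → ℂ) → ℂ} (hF : Continuous F) {w : Fin 3 → ℂ}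
    (hl : ∀ (x : Fin 3 → ℂ) (t : ℂ), l (x + t • w) = l x + t) (h : ∀ x, l x * F x = 0)
    (x : Fin 3 → ℂ) : F x = 0 := by
  by_cases hx : l x = 0
  · let G : ℂ → ℂ := fun t => F (x + t • w)
    have hG : Continuous G := hF.comp (by fun_prop)
    have h0 : Set.EqOn G (fun _ => 0) {0}ᶜ := by
      intro t ht
      have := h (x + t • w)
      rw [hl, hx, zero_add] at this
      exact (mul_eq_zero.mp this).resolve_left ht
    have := congrFun (Continuous.ext_on (dense_compl_singleton (0 : ℂ)) hG continuous_const h0) 0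
    simpa [G] using this
  · exact (mul_eq_zero.mp (h x)).resolve_left hx

lemma continuous_quad (a : Fin 6 → ℂ) : Continuous (quad a) := by
  unfold quad; fun_prop

/-- The syzygies of three conics without a common point, one of which is a pair of lines. -/
lemma quad_syzygy_of_split {α β : ℂ} (hαβ : α ≠ 0 ∨ β ≠ 0) {a b c p q r : Fin 6 → ℂ}
    (hp : ∀ x, quad p x = x 0 * (α * x 0 + β * x 1))
    (H : ∀ x, quad a x * quad p x + quad b x * quad q x + quad c x * quad r x = 0)
    (N : NoCommonZero p q r) :
    ∃ k l m, ∀ x, quad a x = k * quad q x + l * quad r x ∧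
      quad b x = -k * quad p x + m * quad r x ∧ quad c x = -l * quad p x - m * quad q x := by
  have hres : ∀ (a : Fin 6 → ℂ) s t, binQuad ![a 1, a 3, a 2] s t = quad a ![0, s, t] := by
    intro a s t; simp [binQuad, quad]; ring
  obtain ⟨k, hb, hc⟩ := binQuad_syzygy (b := ![b 1, b 3, b 2]) (c := ![c 1, c 3, c 2])
    (q := ![q 1, q 3, q 2]) (r := ![r 1, r 3, r 2])
    (fun s t => by
      have := H ![0, s, t]
      rw [hp] at this
      simpa [hres] using this)
    (fun s t h1 h2 => by
      rw [hres] at h1 h2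
      have := N _ (by rw [hp]; simp) h1 h2
      have e1 := congrFun this 1
      have e2 := congrFun this 2
      simp at e1 e2
      exact ⟨e1, e2⟩)
  have b1 := congrFun hb 0
  have b3 := congrFun hb 1
  have b2 := congrFun hb 2
  have c1 := congrFun hc 0
  have c3 := congrFun hc 1
  have c2 := congrFun hc 2
  simp at b1 b2 b3 c1 c2 c3
  -- the linear cofactors
  let L : (Fin 6 → ℂ) → (Fin 3 → ℂ) → ℂ := fun d x => d 0 * x 0 + d 5 * x 1 + d 4 * x 2
  have hbL : ∀ x, quad b x = k * quad r x + x 0 * L (b - k • r) x := by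
    intro x; simp [quad, L, b1, b2, b3]; ring
  have hcL : ∀ x, quad c x = -k * quad q x + x 0 * L (c + k • q) x := by
    intro x; simp [quad, L, c1, c2, c3]; ring
  have hLc : ∀ d, Continuous (L d) := by intro d; simp only [L]; fun_prop
  have h3 : ∀ x, (α * x 0 + β * x 1) * quad a x + L (b - k • r) x * quad q x +
      L (c + k • q) x * quad r x = 0 := by
    have := continuous_quad a
    have := continuous_quad q
    have := continuous_quad r
    have := hLc (b - k • r)
    have := hLc (c + k • q)
    refine eq_zero_of_linear_mul (l := fun x => x 0) (w := ![1, 0, 0]) (by fun_prop)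
      (by intro x t; simp) ?_
    intro x
    have := H x
    rw [hp, hbL, hcL] at this
    linear_combination this
  have hres2 : ∀ (a : Fin 6 → ℂ) s t,
      binQuad ![a 0 * β ^ 2 + a 1 * α ^ 2 - a 5 * (α * β), a 4 * β - a 3 * α, a 2] s t =
        quad a ![β * s, -α * s, t] := by
    intro a s t; simp [binQuad, quad]; ring
  have hlin : ∀ (d : Fin 6 → ℂ) s t, (d 0 * β - d 5 * α) * s + d 4 * t =
      L d ![β * s, -α * s, t] := by
    intro d s t; simp [L]; ring
  obtain ⟨e1, e2, e3, e4⟩ := binLin_syzygy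
    (u := (b - k • r) 0 * β - (b - k • r) 5 * α) (v := (b - k • r) 4)
    (u' := (c + k • q) 0 * β - (c + k • q) 5 * α) (v' := (c + k • q) 4)
    (q := ![q 0 * β ^ 2 + q 1 * α ^ 2 - q 5 * (α * β), q 4 * β - q 3 * α, q 2])
    (r := ![r 0 * β ^ 2 + r 1 * α ^ 2 - r 5 * (α * β), r 4 * β - r 3 * α, r 2])
    (fun s t => by
      rw [hlin, hlin, hres2, hres2]
      have := h3 ![β * s, -α * s, t]
      simp only [Matrix.cons_val] at this
      linear_combination this)
    (fun s t h1 h2 => by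
      rw [hres2] at h1 h2
      have := N _ (by rw [hp]; simp; right; ring) h1 h2
      have e0 := congrFun this 0
      have e1 := congrFun this 1
      have e2 := congrFun this 2
      simp at e0 e1 e2
      refine ⟨?_, e2⟩
      rcases hαβ with h | h <;> simp_all)
  have hmult : ∀ d : Fin 6 → ℂ, d 0 * β - d 5 * α = 0 → d 4 = 0 →
      ∃ n, ∀ x, L d x = n * (α * x 0 + β * x 1) := by
    intro d h1 h2
    by_cases hα : α = 0
    · have hβ : β ≠ 0 := by simpa [hα] using hαβ
      refine ⟨d 5 / β, fun x => ?_⟩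
      have h0 : d 0 = 0 := by simpa [hα, hβ] using h1
      simp only [L, h2, hα, h0]
      field_simp
      ring
    · refine ⟨d 0 / α, fun x => ?_⟩
      simp only [L, h2]
      field_simp
      linear_combination -x 1 * h1
  obtain ⟨n, hn⟩ := hmult _ e1 e2
  obtain ⟨n', hn'⟩ := hmult _ e3 e4
  refine ⟨-n, -n', k, fun x => ⟨?_, ?_, ?_⟩⟩
  · have hw : ∃ w : Fin 3 → ℂ, α * w 0 + β * w 1 = 1 := by
      by_cases hα : α = 0
      · have hβ : β ≠ 0 := by simpa [hα] using hαβ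
        exact ⟨![0, β⁻¹, 0], by simp [hβ]⟩
      · exact ⟨![α⁻¹, 0, 0], by simp [hα]⟩
    obtain ⟨w, hw⟩ := hw
    have := continuous_quad a
    have := continuous_quad q
    have := continuous_quad r
    have := eq_zero_of_linear_mul (l := fun x => α * x 0 + β * x 1)
      (F := fun x => quad a x + n * quad q x + n' * quad r x) (w := w) (by fun_prop)
      (by intro x t; simp; linear_combination t * hw)
      (by
        intro x
        have := h3 x
        rw [hn, hn'] at this
        linear_combination this) x
    linear_combination this
  · rw [hbL, hn, hp]; ring
  · rw [hcL, hn', hp]; ring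

lemma quad_add {R : Type*} [CommRing R] (a b : Fin 6 → R) (x : Fin 3 → R) :
    quad (a + b) x = quad a x + quad b x := by
  simp only [quad, Pi.add_apply]; ring

lemma quad_smul {R : Type*} [CommRing R] (k : R) (a : Fin 6 → R) (x : Fin 3 → R) :
    quad (k • a) x = k * quad a x := by
  simp only [quad, Pi.smul_apply, smul_eq_mul]; ring

/-- The matrix of the polar form of `quad a`. -/
def polarMatrix (a : Fin 6 → ℂ) : Matrix (Fin 3) (Fin 3) ℂ :=
  !![2 * a 0, a 5, a 4; a 5, 2 * a 1, a 3; a 4, a 3, 2 * a 2]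

lemma polarMatrix_sub_smul (a b : Fin 6 → ℂ) (k : ℂ) :
    polarMatrix (a - k • b) = polarMatrix a - k • polarMatrix b := by
  ext i j
  fin_cases i <;> fin_cases j <;> simp [polarMatrix] <;> ring

lemma quad_comp (a : Fin 6 → ℂ) (g : (Fin 3 → ℂ) →ₗ[ℂ] (Fin 3 → ℂ)) :
    ∃ a', ∀ x, quad a' x = quad a (g x) := by
  set A := LinearMap.toMatrix' g with hA
  refine ⟨![quad a (fun i => A i 0), quad a (fun i => A i 1), quad a (fun i => A i 2),
    quad a (fun i => A i 1 + A i 2) - quad a (fun i => A i 1) - quad a (fun i => A i 2),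
    quad a (fun i => A i 0 + A i 2) - quad a (fun i => A i 0) - quad a (fun i => A i 2),
    quad a (fun i => A i 0 + A i 1) - quad a (fun i => A i 0) - quad a (fun i => A i 1)],
    fun x => ?_⟩
  have hg : ∀ i, g x i = A i 0 * x 0 + A i 1 * x 1 + A i 2 * x 2 := by
    intro i
    rw [← LinearMap.toMatrix'_mulVec g x, ← hA]
    simp [Matrix.mulVec, dotProduct, Fin.sum_univ_three]
  simp only [quad, hg, Matrix.cons_val]
  ring

/-- A conic with a singular point becomes `x (α x + β y)` in suitable coordinates. -/
lemma exists_split {p : Fin 6 → ℂ} {v : Fin 3 → ℂ} (hv : v ≠ 0)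
    (hpv : (polarMatrix p).mulVec v = 0) :
    ∃ (g : (Fin 3 → ℂ) →ₗ[ℂ] (Fin 3 → ℂ)) (α β : ℂ), Function.Injective g ∧
      ∀ x, quad p (g x) = x 0 * (α * x 0 + β * x 1) := by
  obtain ⟨g, hg⟩ := SeparatingDual.exists_continuousLinearEquiv_apply_eq (R := ℂ)
    (x := (![0, 0, 1] : Fin 3 → ℂ)) (y := v) (by simp) hv
  obtain ⟨a, ha⟩ := quad_comp p (g : (Fin 3 → ℂ) →ₗ[ℂ] (Fin 3 → ℂ))
  have hshift : ∀ (x : Fin 3 → ℂ) (t : ℂ), quad p (x + t • v) = quad p x := by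
    intro x t
    have e0 := congrFun hpv 0
    have e1 := congrFun hpv 1
    have e2 := congrFun hpv 2
    simp [polarMatrix, Matrix.mulVec, dotProduct, Fin.sum_univ_three] at e0 e1 e2
    simp only [quad, Pi.add_apply, Pi.smul_apply, smul_eq_mul]
    linear_combination (t * x 0 + t ^ 2 * v 0 / 2) * e0 + (t * x 1 + t ^ 2 * v 1 / 2) * e1 +
      (t * x 2 + t ^ 2 * v 2 / 2) * e2
  have hshift' : ∀ x y z, quad a ![x, y, z] = quad a ![x, y, 0] := by
    intro x y z
    have : (![x, y, z] : Fin 3 → ℂ) = ![x, y, 0] + z • ![0, 0, 1] := by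
      ext i; fin_cases i <;> simp
    rw [this, ha, ha, map_add, map_smul]
    refine Eq.trans ?_ (hshift _ z)
    rw [← hg]
    rfl
  have h2 : a 2 = 0 := by
    have := hshift' 0 0 1
    simpa [quad] using this
  have h4 : a 4 = 0 := by
    have := hshift' 1 0 1
    simpa [quad, h2] using this
  have h3 : a 3 = 0 := by
    have := hshift' 0 1 1
    simpa [quad, h2] using this
  obtain ⟨s, t, h0, hst⟩ := exists_binQuad_eq_zero ![a 0, a 5, a 1]
  simp only [binQuad, Matrix.cons_val] at h0
  suffices ∃ (g' : (Fin 3 → ℂ) →ₗ[ℂ] (Fin 3 → ℂ)) (α β : ℂ), Function.Injective g' ∧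
      ∀ x, quad a (g' x) = x 0 * (α * x 0 + β * x 1) by
    obtain ⟨g', α, β, hinj, h⟩ := this
    refine ⟨(g : (Fin 3 → ℂ) →ₗ[ℂ] (Fin 3 → ℂ)).comp g', α, β, ?_, fun x => ?_⟩
    · exact g.injective.comp hinj
    · rw [← h, ha]; rfl
  by_cases ht : t = 0
  · have hs : s ≠ 0 := by simpa [ht] using hst
    have ha0 : a 0 = 0 := by simpa [ht, hs] using h0
    refine ⟨(!![0, s, 0; 1, 0, 0; 0, 0, 1] : Matrix (Fin 3) (Fin 3) ℂ).mulVecLin,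
      a 1, a 5 * s, ?_, fun x => ?_⟩
    · rw [injective_iff_map_eq_zero]
      intro x hx
      have e0 := congrFun hx 0
      have e1 := congrFun hx 1
      have e2 := congrFun hx 2
      simp [Matrix.mulVec, dotProduct, Fin.sum_univ_three, hs] at e0 e1 e2
      ext i; fin_cases i <;> simp [*]
    · simp [quad, Matrix.mulVec, dotProduct, Fin.sum_univ_three, h2, h3, h4, ha0]
      ring
  · refine ⟨(!![1, s, 0; 0, t, 0; 0, 0, 1] : Matrix (Fin 3) (Fin 3) ℂ).mulVecLin,
      a 0, 2 * a 0 * s + a 5 * t, ?_, fun x => ?_⟩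
    · rw [injective_iff_map_eq_zero]
      intro x hx
      have e0 := congrFun hx 0
      have e1 := congrFun hx 1
      have e2 := congrFun hx 2
      simp [Matrix.mulVec, dotProduct, Fin.sum_univ_three, ht] at e0 e1 e2
      rw [e1] at e0
      ext i; fin_cases i <;> simp_all
    · simp [quad, Matrix.mulVec, dotProduct, Fin.sum_univ_three, h2, h3, h4]
      linear_combination x 1 ^ 2 * h0

/-- Every pencil of conics has a singular member. -/
lemma exists_singular (p q : Fin 6 → ℂ) :
    (∃ v ≠ 0, (polarMatrix q).mulVec v = 0) ∨
      ∃ k : ℂ, ∃ v ≠ 0, (polarMatrix (p - k • q)).mulVec v = 0 := by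
  by_cases hdet : (polarMatrix q).det = 0
  · exact Or.inl (Matrix.exists_mulVec_eq_zero_iff.mpr hdet)
  · right
    obtain ⟨k, hk⟩ := Module.End.exists_eigenvalue
      (Matrix.toLin' ((polarMatrix q)⁻¹ * polarMatrix p))
    obtain ⟨v, hv⟩ := hk.exists_hasEigenvector
    refine ⟨k, v, hv.2, ?_⟩
    have := congrArg (polarMatrix q).mulVec hv.apply_eq_smul
    rw [Matrix.toLin'_apply, Matrix.mulVec_mulVec, ← Matrix.mul_assoc,
      Matrix.mul_nonsing_inv _ (isUnit_iff_ne_zero.mpr hdet), Matrix.one_mul,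
      Matrix.mulVec_smul] at this
    rw [polarMatrix_sub_smul, Matrix.sub_mulVec, this, Matrix.smul_mulVec, sub_self]

lemma exists_common_zero_of_singular {p : Fin 6 → ℂ} {v : Fin 3 → ℂ} (hv : v ≠ 0)
    (hpv : (polarMatrix p).mulVec v = 0) (q : Fin 6 → ℂ) :
    ∃ x ≠ 0, quad p x = 0 ∧ quad q x = 0 := by
  obtain ⟨g, α, β, hinj, hg⟩ := exists_split hv hpv
  obtain ⟨a, ha⟩ := quad_comp q g
  obtain ⟨s, t, h0, hst⟩ := exists_binQuad_eq_zero ![a 1, a 3, a 2]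
  refine ⟨g ![0, s, t], ?_, ?_, ?_⟩
  · intro h
    rw [← map_zero g] at h
    have := hinj h
    have e1 := congrFun this 1
    have e2 := congrFun this 2
    simp at e1 e2
    simp [e1, e2] at hst
  · rw [hg]; simp
  · rw [← ha]; refine Eq.trans ?_ h0; simp [quad, binQuad]; ring

/-- Two complex conics always meet. -/
lemma exists_common_zero (p q : Fin 6 → ℂ) : ∃ x ≠ 0, quad p x = 0 ∧ quad q x = 0 := by
  rcases exists_singular p q with ⟨v, hv, h⟩ | ⟨k, v, hv, h⟩
  · obtain ⟨x, hx, h1, h2⟩ := exists_common_zero_of_singular hv h p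
    exact ⟨x, hx, h2, h1⟩
  · obtain ⟨x, hx, h1, h2⟩ := exists_common_zero_of_singular hv h q
    refine ⟨x, hx, ?_, h2⟩
    have : p = (p - k • q) + k • q := by simp
    rw [this, quad_add, quad_smul, h1, h2]; simp

lemma quad_syzygy_of_singular {a b c p q r : Fin 6 → ℂ} {v : Fin 3 → ℂ} (hv : v ≠ 0)
    (hpv : (polarMatrix p).mulVec v = 0)
    (H : ∀ x, quad a x * quad p x + quad b x * quad q x + quad c x * quad r x = 0)
    (N : NoCommonZero p q r) :
    ∃ k l m, ∀ x, quad a x = k * quad q x + l * quad r x ∧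
      quad b x = -k * quad p x + m * quad r x ∧ quad c x = -l * quad p x - m * quad q x := by
  obtain ⟨g, α, β, hinj, hg⟩ := exists_split hv hpv
  have hαβ : α ≠ 0 ∨ β ≠ 0 := by
    by_contra! hcon
    obtain ⟨x, hx, h1, h2⟩ := exists_common_zero q r
    obtain ⟨y, rfl⟩ := LinearMap.injective_iff_surjective.mp hinj x
    exact hx (N _ (by rw [hg]; simp [hcon]) h1 h2)
  obtain ⟨a', ha⟩ := quad_comp a g
  obtain ⟨b', hb⟩ := quad_comp b g
  obtain ⟨c', hc⟩ := quad_comp c g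
  obtain ⟨p', hp⟩ := quad_comp p g
  obtain ⟨q', hq⟩ := quad_comp q g
  obtain ⟨r', hr⟩ := quad_comp r g
  obtain ⟨k, l, m, h⟩ := quad_syzygy_of_split (a := a') (b := b') (c := c') (p := p') (q := q')
    (r := r') hαβ (fun x => by rw [hp, hg])
    (fun x => by rw [ha, hb, hc, hp, hq, hr]; exact H _)
    (fun x h1 h2 h3 => by
      rw [hp] at h1
      rw [hq] at h2
      rw [hr] at h3
      have := N _ h1 h2 h3
      exact hinj (by rw [this, map_zero]))
  refine ⟨k, l, m, fun x => ?_⟩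
  obtain ⟨y, rfl⟩ := LinearMap.injective_iff_surjective.mp hinj x
  have := h y
  rwa [ha, hb, hc, hp, hq, hr] at this

/-- Three conics without a common point have only the Koszul syzygies in degree two. -/
theorem quad_syzygy {a b c p q r : Fin 6 → ℂ}
    (H : ∀ x, quad a x * quad p x + quad b x * quad q x + quad c x * quad r x = 0)
    (N : NoCommonZero p q r) :
    ∃ k l m, ∀ x, quad a x = k * quad q x + l * quad r x ∧
      quad b x = -k * quad p x + m * quad r x ∧ quad c x = -l * quad p x - m * quad q x := by
  rcases exists_singular p q with ⟨v, hv, hs⟩ | ⟨n, v, hv, hs⟩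
  · obtain ⟨k, l, m, h⟩ := quad_syzygy_of_singular (a := b) (b := a) (c := c) (q := p) (r := r)
      hv hs (fun x => by linear_combination H x) (fun x h1 h2 h3 => N x h2 h1 h3)
    refine ⟨-k, m, l, fun x => ?_⟩
    obtain ⟨h1, h2, h3⟩ := h x
    refine ⟨?_, ?_, ?_⟩
    · rw [h2]
    · rw [h1]; ring
    · rw [h3]; ring
  · have hp : ∀ x, quad (p - n • q) x = quad p x - n * quad q x := by
      intro x
      rw [sub_eq_add_neg, ← neg_smul, quad_add, quad_smul]; ring
    obtain ⟨k, l, m, h⟩ := quad_syzygy_of_singular (a := a) (b := b + n • a) (c := c) (q := q)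
      (r := r) hv hs (fun x => by rw [hp, quad_add, quad_smul]; linear_combination H x)
      (fun x h1 h2 h3 => N x (by rw [hp, h2] at h1; simpa using h1) h2 h3)
    refine ⟨k, l, m - n * l, fun x => ?_⟩
    obtain ⟨h1, h2, h3⟩ := h x
    rw [hp] at h2 h3
    rw [quad_add, quad_smul] at h2
    refine ⟨h1, ?_, ?_⟩
    · linear_combination h2 - n * h1
    · linear_combination h3

/-- The ternary quartic form with coefficient vector `c`. -/
def quartic {R : Type*} [CommRing R] (c : Fin 15 → R) (x : Fin 3 → R) : R :=
  c 0 * x 0 ^ 4 + c 1 * x 1 ^ 4 + c 2 * x 2 ^ 4 + c 3 * (x 0 ^ 3 * x 1) + c 4 * (x 0 ^ 3 * x 2) +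
    c 5 * (x 0 * x 1 ^ 3) + c 6 * (x 1 ^ 3 * x 2) + c 7 * (x 0 * x 2 ^ 3) + c 8 * (x 1 * x 2 ^ 3) +
    c 9 * (x 1 ^ 2 * x 2 ^ 2) + c 10 * (x 0 ^ 2 * x 2 ^ 2) + c 11 * (x 0 ^ 2 * x 1 ^ 2) +
    c 12 * (x 0 ^ 2 * x 1 * x 2) + c 13 * (x 0 * x 1 ^ 2 * x 2) + c 14 * (x 0 * x 1 * x 2 ^ 2)

/-- The coefficient vector of the product of two ternary quadratic forms. -/
def quadMul {R : Type*} [CommRing R] (a b : Fin 6 → R) : Fin 15 → R :=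
  ![a 0 * b 0, a 1 * b 1, a 2 * b 2, a 0 * b 5 + a 5 * b 0, a 0 * b 4 + a 4 * b 0,
    a 1 * b 5 + a 5 * b 1, a 1 * b 3 + a 3 * b 1, a 2 * b 4 + a 4 * b 2, a 2 * b 3 + a 3 * b 2,
    a 1 * b 2 + a 2 * b 1 + a 3 * b 3, a 0 * b 2 + a 2 * b 0 + a 4 * b 4,
    a 0 * b 1 + a 1 * b 0 + a 5 * b 5, a 0 * b 3 + a 3 * b 0 + a 4 * b 5 + a 5 * b 4,
    a 1 * b 4 + a 4 * b 1 + a 3 * b 5 + a 5 * b 3, a 2 * b 5 + a 5 * b 2 + a 3 * b 4 + a 4 * b 3]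

section CommRing

variable {R : Type*} [CommRing R]

lemma quartic_quadMul (a b : Fin 6 → R) (x : Fin 3 → R) :
    quartic (quadMul a b) x = quad a x * quad b x := by
  simp only [quartic, quadMul, quad, Matrix.cons_val]; ring

lemma quartic_add (c d : Fin 15 → R) (x : Fin 3 → R) :
    quartic (c + d) x = quartic c x + quartic d x := by
  simp only [quartic, Pi.add_apply]; ring

lemma quartic_smul (k : R) (c : Fin 15 → R) (x : Fin 3 → R) :
    quartic (k • c) x = k * quartic c x := by
  simp only [quartic, Pi.smul_apply, smul_eq_mul]; ring

lemma quadMul_comm (a b : Fin 6 → R) : quadMul a b = quadMul b a := by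
  ext i; fin_cases i <;> simp [quadMul] <;> ring

lemma quadMul_add (a b c : Fin 6 → R) : quadMul a (b + c) = quadMul a b + quadMul a c := by
  ext i; fin_cases i <;> simp [quadMul] <;> ring

lemma quadMul_smul (k : R) (a b : Fin 6 → R) : quadMul a (k • b) = k • quadMul a b := by
  ext i; fin_cases i <;> simp [quadMul] <;> ring

lemma add_quadMul (a b c : Fin 6 → R) : quadMul (a + b) c = quadMul a c + quadMul b c := by
  rw [quadMul_comm, quadMul_add, quadMul_comm c, quadMul_comm c]

lemma smul_quadMul (k : R) (a b : Fin 6 → R) : quadMul (k • a) b = k • quadMul a b := by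
  rw [quadMul_comm, quadMul_smul, quadMul_comm]

lemma quad_injective {a b : Fin 6 → R} (h : ∀ x, quad a x = quad b x) : a = b := by
  have e0 := h ![1, 0, 0]
  have e1 := h ![0, 1, 0]
  have e2 := h ![0, 0, 1]
  have e3 := h ![0, 1, 1]
  have e4 := h ![1, 0, 1]
  have e5 := h ![1, 1, 0]
  simp [quad] at e0 e1 e2 e3 e4 e5
  simp only [e0, e1, e2, add_right_inj] at e3 e4 e5
  ext i; fin_cases i <;> assumption

end CommRing

/-- A triple of real ternary quadratic forms. -/
abbrev Triple : Type := Fin 3 → Fin 6 → ℝ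

/-- The bilinear form polarising the sum of squares of a triple. -/
noncomputable def pairing : Triple →ₗ[ℝ] Triple →ₗ[ℝ] (Fin 15 → ℝ) :=
  LinearMap.mk₂ ℝ (fun S T => ∑ i, quadMul (S i) (T i))
    (fun S S' T => by simp [add_quadMul, Finset.sum_add_distrib])
    (fun k S T => by simp [smul_quadMul, Finset.smul_sum])
    (fun S T T' => by simp [quadMul_add, Finset.sum_add_distrib])
    (fun k S T => by simp [quadMul_smul, Finset.smul_sum])

lemma pairing_apply (S T : Triple) : pairing S T = ∑ i, quadMul (S i) (T i) := rfl

lemma pairing_comm (S T : Triple) : pairing S T = pairing T S := by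
  simp only [pairing_apply]
  exact Finset.sum_congr rfl fun i _ => quadMul_comm _ _

/-- The quartic form which is the sum of squares of a triple. -/
noncomputable def sumSq (T : Triple) : Fin 15 → ℝ := pairing T T

lemma quartic_sumSq (T : Triple) (x : Fin 3 → ℝ) :
    quartic (sumSq T) x = quad (T 0) x ^ 2 + quad (T 1) x ^ 2 + quad (T 2) x ^ 2 := by
  rw [sumSq, pairing_apply, Fin.sum_univ_three]
  simp only [quartic_add, quartic_quadMul]; ring

/-- The Gram matrix of a triple. -/
def gram (T : Triple) : Matrix (Fin 6) (Fin 6) ℝ := (Matrix.of T).transpose * Matrix.of T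

lemma gram_apply (T : Triple) (a b : Fin 6) :
    gram T a b = T 0 a * T 0 b + T 1 a * T 1 b + T 2 a * T 2 b := by
  simp [gram, Matrix.mul_apply, Fin.sum_univ_three]

/-- The coefficient vector of the quartic form with Gram matrix `G`. -/
def gramQuartic (G : Matrix (Fin 6) (Fin 6) ℝ) : Fin 15 → ℝ :=
  ![G 0 0, G 1 1, G 2 2, 2 * G 0 5, 2 * G 0 4, 2 * G 1 5, 2 * G 1 3, 2 * G 2 4, 2 * G 2 3,
    2 * G 1 2 + G 3 3, 2 * G 0 2 + G 4 4, 2 * G 0 1 + G 5 5, 2 * G 0 3 + 2 * G 4 5,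
    2 * G 1 4 + 2 * G 3 5, 2 * G 2 5 + 2 * G 3 4]

lemma sumSq_eq_gramQuartic (T : Triple) : sumSq T = gramQuartic (gram T) := by
  rw [sumSq, pairing_apply, Fin.sum_univ_three]
  ext i
  simp only [Pi.add_apply, gramQuartic, gram_apply, quadMul]
  fin_cases i <;> simp only [Fin.reduceFinMk, Matrix.cons_val] <;> ring

lemma sumSq_eq_of_gram_eq {S T : Triple} (h : gram S = gram T) : sumSq S = sumSq T := by
  rw [sumSq_eq_gramQuartic, sumSq_eq_gramQuartic, h]

/-- The quadratic forms of the triple have no common complex zero. -/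
def BasePointFree (T : Triple) : Prop :=
  ∀ x : Fin 3 → ℂ, (∀ i, quad (fun j => (T i j : ℂ)) x = 0) → x = 0

/-- The quartic coefficient vectors whose sum-of-squares representations are base point free. -/
def Regular (c : Fin 15 → ℝ) : Prop := ∀ T, sumSq T = c → BasePointFree T

lemma quadMul_ofReal (a b : Fin 6 → ℝ) :
    (fun i => ((quadMul a b i : ℝ) : ℂ)) = quadMul (fun j => (a j : ℂ)) (fun j => (b j : ℂ)) := by
  ext i
  simp only [quadMul]
  fin_cases i <;> simp only [Fin.reduceFinMk, Matrix.cons_val] <;> push_cast <;> ring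

lemma quartic_ofReal_quadMul (a b : Fin 6 → ℝ) (x : Fin 3 → ℂ) :
    quartic (fun i => ((quadMul a b i : ℝ) : ℂ)) x =
      quad (fun j => (a j : ℂ)) x * quad (fun j => (b j : ℂ)) x := by
  rw [quadMul_ofReal, quartic_quadMul]

/-- A base point free triple has only the Koszul syzygies in degree two. -/
lemma BasePointFree.syzygy {D T : Triple} (hT : BasePointFree T) (h : pairing D T = 0) :
    ∃ k l m : ℝ, D 0 = k • T 1 + l • T 2 ∧ D 1 = -k • T 0 + m • T 2 ∧
      D 2 = -l • T 0 - m • T 1 := by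
  obtain ⟨k, l, m, hk⟩ := quad_syzygy (a := fun j => (D 0 j : ℂ)) (b := fun j => (D 1 j : ℂ))
    (c := fun j => (D 2 j : ℂ)) (p := fun j => (T 0 j : ℂ)) (q := fun j => (T 1 j : ℂ))
    (r := fun j => (T 2 j : ℂ))
    (fun x => by
      simp only [← quartic_ofReal_quadMul, ← quartic_add]
      have : ((fun i => ((quadMul (D 0) (T 0) i : ℝ) : ℂ)) + (fun i => ((quadMul (D 1) (T 1) i : ℝ) : ℂ)) +
          fun i => ((quadMul (D 2) (T 2) i : ℝ) : ℂ)) = fun i => ((pairing D T i : ℝ) : ℂ) := by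
        ext i; simp [pairing_apply, Fin.sum_univ_three]
      rw [this, h]
      simp [quartic])
    (fun x h0 h1 h2 => hT x fun i => by fin_cases i <;> assumption)
  have e0 := quad_injective (a := fun j => (D 0 j : ℂ))
    (b := k • (fun j => (T 1 j : ℂ)) + l • (fun j => (T 2 j : ℂ)))
    (fun x => by rw [quad_add, quad_smul, quad_smul]; exact (hk x).1)
  have e1 := quad_injective (a := fun j => (D 1 j : ℂ))
    (b := (-k) • (fun j => (T 0 j : ℂ)) + m • (fun j => (T 2 j : ℂ)))
    (fun x => by rw [quad_add, quad_smul, quad_smul]; exact (hk x).2.1)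
  have e2 := quad_injective (a := fun j => (D 2 j : ℂ))
    (b := (-l) • (fun j => (T 0 j : ℂ)) + (-m) • (fun j => (T 1 j : ℂ)))
    (fun x => by
      rw [quad_add, quad_smul, quad_smul, neg_mul m, ← sub_eq_add_neg]; exact (hk x).2.2)
  refine ⟨k.re, l.re, m.re, ?_, ?_, ?_⟩
  · ext j
    have := congrArg Complex.re (congrFun e0 j)
    simpa using this
  · ext j
    have := congrArg Complex.re (congrFun e1 j)
    simpa using this
  · ext j
    have := congrArg Complex.re (congrFun e2 j)
    simpa [sub_eq_add_neg] using this

/-- The Koszul syzygies of a triple of quadratic forms. -/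
def koszul (T : Triple) : (Fin 3 → ℝ) →ₗ[ℝ] Triple where
  toFun v := ![v 0 • T 1 + v 1 • T 2, -v 0 • T 0 + v 2 • T 2, -v 1 • T 0 - v 2 • T 1]
  map_add' u v := by ext i j; fin_cases i <;> simp <;> ring
  map_smul' k v := by ext i j; fin_cases i <;> simp <;> ring

lemma BasePointFree.mem_range_koszul {D T : Triple} (hT : BasePointFree T)
    (h : pairing D T = 0) : D ∈ LinearMap.range (koszul T) := by
  obtain ⟨k, l, m, h0, h1, h2⟩ := hT.syzygy h
  refine ⟨![k, l, m], ?_⟩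
  ext i : 1
  fin_cases i
  · exact h0.symm
  · exact h1.symm
  · exact h2.symm

lemma gram_eq_of_sumSq_eq {S T : Triple} (h : sumSq S = sumSq T)
    (hST : BasePointFree (S + T)) : gram S = gram T := by
  obtain ⟨k, l, m, h0, h1, h2⟩ := hST.syzygy (D := S - T) (by
    rw [map_sub, LinearMap.sub_apply, map_add, map_add, pairing_comm T S]
    change sumSq S + pairing S T - (pairing S T + sumSq T) = 0
    rw [h]; abel)
  ext a b
  have a0 := congrFun h0 a
  have a1 := congrFun h1 a
  have a2 := congrFun h2 a
  have b0 := congrFun h0 b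
  have b1 := congrFun h1 b
  have b2 := congrFun h2 b
  simp at a0 a1 a2 b0 b1 b2
  rw [gram_apply, gram_apply]
  linear_combination ((S 0 a + T 0 a) * b0 + (S 1 a + T 1 a) * b1 + (S 2 a + T 2 a) * b2 +
    (S 0 b + T 0 b) * a0 + (S 1 b + T 1 b) * a1 + (S 2 b + T 2 b) * a2) / 2

/-- The forms of a base point free triple are linearly independent. -/
lemma BasePointFree.eq_zero_of_vecMul {T : Triple} (hT : BasePointFree T) {w : Fin 3 → ℝ}
    (hw : Matrix.vecMul w (Matrix.of T) = 0) : w = 0 := by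
  by_contra hw0
  let f : (Fin 6 → ℝ) →ₗ[ℝ] Triple :=
    { toFun := fun g i => w i • g
      map_add' := by intros; ext; simp [mul_add]
      map_smul' := by intros; ext; simp; ring }
  have hf : Function.Injective f := by
    obtain ⟨i, hi⟩ := Function.ne_iff.mp hw0
    intro g g' h
    exact smul_right_injective _ hi (congrFun h i)
  have hle : LinearMap.range f ≤ LinearMap.range (koszul T) := by
    rintro _ ⟨g, rfl⟩
    have h0 : pairing (f g) T = 0 := by
      have : pairing (f g) T = quadMul g (Matrix.vecMul w (Matrix.of T)) := by
        rw [pairing_apply, Fin.sum_univ_three]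
        simp only [f, LinearMap.coe_mk, AddHom.coe_mk, smul_quadMul, ← quadMul_smul,
          ← quadMul_add]
        congr 1
        ext j
        simp [Matrix.vecMul, dotProduct, Fin.sum_univ_three]
      rw [this, hw]
      ext i; fin_cases i <;> simp [quadMul]
    exact hT.mem_range_koszul h0
  have h1 := Submodule.finrank_mono hle
  rw [LinearMap.finrank_range_of_inj hf] at h1
  have h2 := LinearMap.finrank_range_le (koszul T)
  simp at h1 h2
  omega

/-- Triples with the same Gram matrix differ by an orthogonal matrix. -/
lemma BasePointFree.exists_orthogonal {S T : Triple} (hS : BasePointFree S)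
    (h : gram S = gram T) : ∃ R : Matrix (Fin 3) (Fin 3) ℝ, R * R.transpose = 1 ∧
      R.transpose * R = 1 ∧ Matrix.of S = R * Matrix.of T := by
  set A := Matrix.of S
  set B := Matrix.of T
  have hAB : A.transpose * A = B.transpose * B := h
  have hdet : IsUnit (A * A.transpose).det := by
    rw [isUnit_iff_ne_zero]
    intro h0
    obtain ⟨w, hw, hw0⟩ := Matrix.exists_mulVec_eq_zero_iff.mpr h0
    refine hw (hS.eq_zero_of_vecMul ?_)
    have : dotProduct (Matrix.vecMul w A) (Matrix.vecMul w A) = 0 := by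
      rw [← Matrix.dotProduct_mulVec, ← Matrix.mulVec_transpose, Matrix.mulVec_mulVec, hw0]
      simp
    exact dotProduct_self_eq_zero.mp this
  set M := A * A.transpose with hM
  have hMt : M.transpose = M := by simp [hM]
  have hMit : M⁻¹.transpose = M⁻¹ := by rw [Matrix.transpose_nonsing_inv, hMt]
  have hRR : (M⁻¹ * A * B.transpose) * (M⁻¹ * A * B.transpose).transpose = 1 := by
    calc (M⁻¹ * A * B.transpose) * (M⁻¹ * A * B.transpose).transpose
        = M⁻¹ * A * (B.transpose * B) * A.transpose * M⁻¹ := by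
          simp [Matrix.transpose_mul, hMit, Matrix.mul_assoc]
      _ = M⁻¹ * M * (M * M⁻¹) := by
          rw [← hAB, hM]; simp [Matrix.mul_assoc]
      _ = 1 := by rw [Matrix.nonsing_inv_mul _ hdet, Matrix.mul_nonsing_inv _ hdet, one_mul]
  refine ⟨M⁻¹ * A * B.transpose, hRR, mul_eq_one_comm.mp hRR, ?_⟩
  rw [Matrix.mul_assoc, ← hAB, ← Matrix.mul_assoc, Matrix.mul_assoc M⁻¹, ← hM,
    Matrix.nonsing_inv_mul _ hdet, Matrix.one_mul]

lemma continuous_gram : Continuous gram := by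
  refine continuous_pi fun a => continuous_pi fun b => ?_
  simp only [gram_apply]
  fun_prop

lemma continuous_sumSq : Continuous sumSq := by
  unfold sumSq
  exact pairing.toContinuousBilinearMap.continuous₂.comp (continuous_id.prodMk continuous_id)

/-- Near a base point free triple, the sum-of-squares map is open. -/
lemma BasePointFree.map_nhds_sumSq {T : Triple} (hT : BasePointFree T) :
    map sumSq (𝓝 T) = 𝓝 (sumSq T) := by
  have hB := pairing.toContinuousBilinearMap.hasStrictFDerivAt_of_bilinear
    (hasStrictFDerivAt_id (𝕜 := ℝ) T) (hasStrictFDerivAt_id (𝕜 := ℝ) T)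
  refine HasStrictFDerivAt.map_nhds_eq_of_surj hB ?_
  set L : Triple →ₗ[ℝ] (Fin 15 → ℝ) := pairing.flip T
  have hker : LinearMap.ker L ≤ LinearMap.range (koszul T) := fun D hD => hT.mem_range_koszul hD
  have h1 := Submodule.finrank_mono hker
  have h2 := LinearMap.finrank_range_le (koszul T)
  have h3 := LinearMap.finrank_range_add_finrank_ker L
  have h4 := Submodule.finrank_le (LinearMap.range L)
  have hL : LinearMap.range L = ⊤ := by
    apply Submodule.eq_top_of_finrank_eq
    simp only [Module.finrank_pi_fintype, Module.finrank_self, Finset.sum_const, Finset.card_univ,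
      Fintype.card_fin, smul_eq_mul, mul_one] at h1 h2 h3 h4 ⊢
    omega
  rw [LinearMap.range_eq_top] at hL ⊢
  intro y
  obtain ⟨D, hD⟩ := hL ((1 / 2 : ℝ) • y)
  refine ⟨D, ?_⟩
  have h5 : pairing D T = (1 / 2 : ℝ) • y := hD
  change pairing T D + pairing D T = y
  rw [pairing_comm T D, h5, ← add_smul]
  norm_num

lemma isOpen_basePointFree : IsOpen {T | BasePointFree T} := by
  have hcl : IsClosed {z : Metric.sphere (0 : Fin 3 → ℂ) 1 × Triple |
      ∀ i, quad (fun j => (z.2 i j : ℂ)) z.1 = 0} := by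
    simp only [Set.ofPred_forall]
    refine isClosed_iInter fun i => isClosed_eq ?_ continuous_const
    have h1 : ∀ j, Continuous fun z : Metric.sphere (0 : Fin 3 → ℂ) 1 × Triple =>
        (z.1 : Fin 3 → ℂ) j := fun j =>
      (continuous_apply j).comp (continuous_subtype_val.comp continuous_fst)
    have h2 : ∀ j, Continuous fun z : Metric.sphere (0 : Fin 3 → ℂ) 1 × Triple =>
        ((z.2 i j : ℝ) : ℂ) := fun j =>
      Complex.continuous_ofReal.comp
        ((continuous_apply j).comp ((continuous_apply i).comp continuous_snd))
    simp only [quad]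
    fun_prop
  have himg := isClosedMap_snd_of_compactSpace _ hcl
  rw [← isClosed_compl_iff]
  convert himg using 1
  ext T
  simp only [Set.mem_compl_iff, Set.mem_ofPred_eq, BasePointFree, Set.mem_image, Prod.exists,
    Subtype.exists, exists_eq_right]
  push Not
  constructor
  · rintro ⟨x, hx, hx0⟩
    have hn : ((‖x‖⁻¹ : ℝ) : ℂ) ≠ 0 := by simpa using hx0
    refine ⟨((‖x‖⁻¹ : ℝ) : ℂ) • x, ?_, fun i => ?_⟩
    · simp [norm_smul, hx0]
    · have := hx i
      simp only [quad, Pi.smul_apply, smul_eq_mul] at this ⊢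
      linear_combination ((‖x‖⁻¹ : ℝ) : ℂ) ^ 2 * this
  · rintro ⟨x, hx1, hx⟩
    refine ⟨x, hx, fun h0 => ?_⟩
    rw [h0] at hx1
    simp at hx1

lemma BasePointFree.smul {T : Triple} (hT : BasePointFree T) {k : ℝ} (hk : k ≠ 0) :
    BasePointFree (k • T) := by
  intro x hx
  refine hT x fun i => ?_
  have h := hx i
  have h' : quad (fun j => (((k • T) i j : ℝ) : ℂ)) x = k * quad (fun j => (T i j : ℂ)) x := by
    rw [← quad_smul]; congr 1; ext j; simp
  rw [h'] at h
  simpa [hk] using h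

/-- Near a base point free triple, the quartic form determines the Gram matrix. -/
lemma BasePointFree.exists_nhds_gram_eq {T : Triple} (hT : BasePointFree T) :
    ∃ W ∈ 𝓝 T, ∀ S ∈ W, ∀ S' ∈ W, sumSq S = sumSq S' → gram S = gram S' := by
  have h : ∀ᶠ z in 𝓝 T ×ˢ 𝓝 T, BasePointFree (z.1 + z.2) := by
    rw [← nhds_prod_eq]
    have hc : ContinuousAt (fun z : Triple × Triple => z.1 + z.2) (T, T) := by fun_prop
    refine hc.eventually_mem (isOpen_basePointFree.mem_nhds ?_)
    have := hT.smul (two_ne_zero (α := ℝ))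
    rwa [two_smul] at this
  obtain ⟨W, hW, hW'⟩ := (eventually_prod_self_iff (r := fun S S' => BasePointFree (S + S'))).mp h
  exact ⟨W, hW, fun S hS S' hS' heq => gram_eq_of_sumSq_eq heq (hW' S hS S' hS')⟩

lemma norm_le_of_sumSq {T : Triple} {c : Fin 15 → ℝ} (h : sumSq T = c) :
    ‖T‖ ≤ 3 * (c 0 + c 1 + c 2) + c 9 + c 10 + c 11 + 1 := by
  have key : ∀ i j, T i j ^ 2 ≤ 3 * (c 0 + c 1 + c 2) + c 9 + c 10 + c 11 := by
    have row : ∀ a0 a1 a2 a3 a4 a5 : ℝ, a0 ^ 2 + a1 ^ 2 + a2 ^ 2 + a3 ^ 2 + a4 ^ 2 + a5 ^ 2 ≤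
        3 * (a0 * a0 + a1 * a1 + a2 * a2) + (a1 * a2 + a2 * a1 + a3 * a3) +
          (a0 * a2 + a2 * a0 + a4 * a4) + (a0 * a1 + a1 * a0 + a5 * a5) := by
      intro a0 a1 a2 a3 a4 a5
      nlinarith [sq_nonneg (a0 + a1 + a2), sq_nonneg a0, sq_nonneg a1, sq_nonneg a2]
    have hsum : ∑ i, ∑ j, T i j ^ 2 ≤ 3 * (c 0 + c 1 + c 2) + c 9 + c 10 + c 11 := by
      have hrow : ∀ i, ∑ j, T i j ^ 2 ≤ 3 * (quadMul (T i) (T i) 0 + quadMul (T i) (T i) 1 +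
          quadMul (T i) (T i) 2) + quadMul (T i) (T i) 9 + quadMul (T i) (T i) 10 +
          quadMul (T i) (T i) 11 := fun i => by
        rw [Fin.sum_univ_six]
        exact row _ _ _ _ _ _
      refine (Finset.sum_le_sum fun i _ => hrow i).trans_eq ?_
      rw [← h, sumSq, pairing_apply]
      simp only [Finset.sum_apply, Finset.sum_add_distrib, ← Finset.mul_sum]
    intro i j
    refine le_trans (le_trans ?_ (Finset.single_le_sum (f := fun i => ∑ a, T i a ^ 2)
      (fun _ _ => by positivity) (Finset.mem_univ i))) hsum
    exact Finset.single_le_sum (f := fun a => T i a ^ 2)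
      (fun _ _ => by positivity) (Finset.mem_univ j)
  generalize 3 * (c 0 + c 1 + c 2) + c 9 + c 10 + c 11 = M at key
  have hpos : 0 ≤ M := le_trans (sq_nonneg _) (key 0 0)
  rw [pi_norm_le_iff_of_nonneg (by positivity)]
  intro i
  rw [pi_norm_le_iff_of_nonneg (by positivity)]
  intro j
  have h3 := key i j
  rw [Real.norm_eq_abs, abs_le]
  constructor <;> nlinarith [sq_nonneg (T i j - 1), sq_nonneg (T i j + 1)]

/-- The Gram matrices of the representations of a quartic form as a sum of three squares. -/
def grams (c : Fin 15 → ℝ) : Set (Matrix (Fin 6) (Fin 6) ℝ) := gram '' {T | sumSq T = c}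

lemma isCompact_sumSq_fiber (c : Fin 15 → ℝ) : IsCompact {T | sumSq T = c} := by
  refine Metric.isCompact_of_isClosed_isBounded (isClosed_eq continuous_sumSq continuous_const) ?_
  refine (Metric.isBounded_closedBall (x := (0 : Triple))
    (r := 3 * (c 0 + c 1 + c 2) + c 9 + c 10 + c 11 + 1)).subset fun T hT => ?_
  rw [mem_closedBall_zero_iff]
  exact norm_le_of_sumSq hT

lemma Regular.finite_grams {c : Fin 15 → ℝ} (hc : Regular c) : (grams c).Finite := by
  choose! W hW hW' using fun T hT => (hc T hT).exists_nhds_gram_eq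
  obtain ⟨s, hs, hs'⟩ := (isCompact_sumSq_fiber c).elim_nhds_subcover W hW
  refine (s.finite_toSet.image gram).subset ?_
  rintro _ ⟨T, hT, rfl⟩
  obtain ⟨S, hS, hTS⟩ := Set.mem_iUnion₂.mp (hs' hT)
  have hSc := hs S hS
  refine ⟨S, hS, ?_⟩
  exact hW' S hSc S (mem_of_mem_nhds (hW S hSc)) T hTS (hSc.trans hT.symm)

/-- The number of Gram matrices is locally constant at regular quartic forms. -/
lemma Regular.eventually_ncard_grams {c₀ : Fin 15 → ℝ} (hc : Regular c₀) :
    ∀ᶠ c in 𝓝 c₀, (grams c).ncard = (grams c₀).ncard := by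
  have hfin := hc.finite_grams
  obtain ⟨V, hV, hVd⟩ := hfin.t2_separation
  choose! τ hτ hτg using fun (G : Matrix (Fin 6) (Fin 6) ℝ) (hG : G ∈ grams c₀) => hG
  choose! W hW hW' using fun T hT => (hc T hT).exists_nhds_gram_eq
  let Z : Matrix (Fin 6) (Fin 6) ℝ → Set Triple := fun G => W (τ G) ∩ gram ⁻¹' V G
  have hZ : ∀ G ∈ grams c₀, Z G ∈ 𝓝 (τ G) := by
    intro G hG
    refine inter_mem (hW _ (hτ G hG)) ((hV G).2.preimage continuous_gram |>.mem_nhds ?_)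
    rw [Set.mem_preimage, hτg G hG]
    exact (hV G).1
  have hlift : ∀ᶠ c in 𝓝 c₀, ∀ G ∈ grams c₀, ∃ T ∈ Z G, sumSq T = c := by
    rw [eventually_all_finite hfin]
    intro G hG
    have h1 := image_mem_map (m := sumSq) (hZ G hG)
    rw [(hc _ (hτ G hG)).map_nhds_sumSq, hτ G hG] at h1
    exact h1
  have hproper : ∀ᶠ c in 𝓝 c₀, ∀ T, sumSq T = c → ∃ G ∈ grams c₀, ∃ S ∈ Z G, gram S = gram T := by
    by_contra hcon
    obtain ⟨u, hu, hu'⟩ := exists_seq_forall_of_frequently (not_eventually.mp hcon)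
    push Not at hu'
    choose T hT hTn using hu'
    have hbd : ∃ᶠ n in atTop, T n ∈ Metric.closedBall (0 : Triple)
        (3 * (c₀ 0 + c₀ 1 + c₀ 2) + c₀ 9 + c₀ 10 + c₀ 11 + 2) := by
      have h1 : Tendsto (fun n => 3 * (u n 0 + u n 1 + u n 2) + u n 9 + u n 10 + u n 11 + 1) atTop
          (𝓝 (3 * (c₀ 0 + c₀ 1 + c₀ 2) + c₀ 9 + c₀ 10 + c₀ 11 + 1)) := by
        have hcont : Continuous fun c : Fin 15 → ℝ =>
          3 * (c 0 + c 1 + c 2) + c 9 + c 10 + c 11 + 1 := by fun_prop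
        exact (hcont.tendsto c₀).comp hu
      refine Eventually.frequently ?_
      filter_upwards [h1.eventually (gt_mem_nhds (lt_add_one _))] with n hn
      rw [mem_closedBall_zero_iff]
      have := norm_le_of_sumSq (hT n)
      linarith
    obtain ⟨S, -, φ, hφ, hS⟩ := tendsto_subseq_of_frequently_bounded Metric.isBounded_closedBall hbd
    have hSc : sumSq S = c₀ := by
      refine tendsto_nhds_unique ((continuous_sumSq.tendsto S).comp hS) ?_
      have : (sumSq ∘ T ∘ φ) = u ∘ φ := by
        ext1 n; exact hT (φ n)
      rw [this]
      exact hu.comp hφ.tendsto_atTop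
    have hG : gram S ∈ grams c₀ := ⟨S, hSc, rfl⟩
    obtain ⟨R, hR1, hR2, hR3⟩ := (hc _ (hτ _ hG)).exists_orthogonal (hτg _ hG)
    let ρ : Triple → Triple := fun X => R * Matrix.of X
    have hρ : Continuous ρ := by
      refine continuous_pi fun i => continuous_pi fun j => ?_
      change Continuous fun X : Triple => (R * Matrix.of X) i j
      simp only [Matrix.mul_apply, Matrix.of_apply]
      fun_prop
    have hρg : ∀ X, gram (ρ X) = gram X := by
      intro X
      change (R * Matrix.of X).transpose * (R * Matrix.of X) = _
      rw [Matrix.transpose_mul, Matrix.mul_assoc, ← Matrix.mul_assoc R.transpose, hR2,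
        Matrix.one_mul]
      rfl
    have hlim : Tendsto (ρ ∘ T ∘ φ) atTop (𝓝 (τ (gram S))) := by
      have : τ (gram S) = ρ S := hR3
      rw [this]
      exact (hρ.tendsto S).comp hS
    obtain ⟨n, hn⟩ := (hlim.eventually_mem (hZ _ hG)).exists
    exact hTn (φ n) _ hG _ hn (hρg _)
  filter_upwards [hlift, hproper] with c h1 h2
  choose! σ hσ hσc using h1
  symm
  refine Set.ncard_congr (fun G _ => gram (σ G)) (fun G hG => ⟨σ G, hσc G hG, rfl⟩) ?_ ?_
  · intro G G' hG hG' heq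
    by_contra hne
    refine Set.disjoint_left.mp (hVd hG hG' hne) (hσ G hG).2 ?_
    rw [heq]
    exact (hσ G' hG').2
  · rintro _ ⟨T, hT, rfl⟩
    obtain ⟨G, hG, S, hS, hST⟩ := h2 T hT
    refine ⟨G, hG, ?_⟩
    rw [← hST]
    refine hW' _ (hτ G hG) _ (hσ G hG).1 _ hS.1 ?_
    rw [hσc G hG, sumSq_eq_of_gram_eq hST, hT]

/-- The coefficient vector of the product of two ternary linear forms. -/
def linMul {R : Type*} [CommRing R] (l m : Fin 3 → R) : Fin 6 → R :=
  ![l 0 * m 0, l 1 * m 1, l 2 * m 2, l 1 * m 2 + l 2 * m 1, l 0 * m 2 + l 2 * m 0,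
    l 0 * m 1 + l 1 * m 0]

lemma quad_linMul {R : Type*} [CommRing R] (l m x : Fin 3 → R) :
    quad (linMul l m) x = l ⬝ᵥ x * m ⬝ᵥ x := by
  simp only [quad, linMul, Matrix.cons_val, dotProduct, Fin.sum_univ_three]; ring

lemma quartic_injective {a b : Fin 15 → ℝ} (h : ∀ x, quartic a x = quartic b x) : a = b := by
  have edge : ∀ p q r : ℝ, p + q + r = 0 → -p + q - r = 0 → 2 * p + 4 * q + 8 * r = 0 →
      p = 0 ∧ q = 0 ∧ r = 0 := by
    intro p q r h1 h2 h3
    refine ⟨?_, ?_, ?_⟩ <;> linarith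
  obtain ⟨c, hc⟩ : ∃ c, c = a - b := ⟨_, rfl⟩
  have h' : ∀ x, quartic c x = 0 := fun x => by
    have := h x
    simp only [hc, quartic, Pi.sub_apply] at this ⊢
    linear_combination this
  suffices c = 0 from sub_eq_zero.mp (hc ▸ this)
  clear h hc
  simp only [quartic] at h'
  have c0 : c 0 = 0 := by simpa using h' ![1, 0, 0]
  have c1 : c 1 = 0 := by simpa using h' ![0, 1, 0]
  have c2 : c 2 = 0 := by simpa using h' ![0, 0, 1]
  simp only [c0, c1, c2] at h'
  obtain ⟨c6, c9, c8⟩ := edge (c 6) (c 9) (c 8)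
    (by have := h' ![0, 1, 1]; simp only [Matrix.cons_val] at this; linarith)
    (by have := h' ![0, 1, -1]; simp only [Matrix.cons_val] at this; linarith)
    (by have := h' ![0, 1, 2]; simp only [Matrix.cons_val] at this; linarith)
  obtain ⟨c4, c10, c7⟩ := edge (c 4) (c 10) (c 7)
    (by have := h' ![1, 0, 1]; simp only [Matrix.cons_val] at this; linarith)
    (by have := h' ![1, 0, -1]; simp only [Matrix.cons_val] at this; linarith)
    (by have := h' ![1, 0, 2]; simp only [Matrix.cons_val] at this; linarith)
  obtain ⟨c3, c11, c5⟩ := edge (c 3) (c 11) (c 5)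
    (by have := h' ![1, 1, 0]; simp only [Matrix.cons_val] at this; linarith)
    (by have := h' ![1, -1, 0]; simp only [Matrix.cons_val] at this; linarith)
    (by have := h' ![1, 2, 0]; simp only [Matrix.cons_val] at this; linarith)
  simp only [c3, c4, c5, c6, c7, c8, c9, c10, c11] at h'
  have e1 := h' ![1, 1, 1]
  have e2 := h' ![1, 1, -1]
  have e3 := h' ![1, -1, 1]
  simp only [Matrix.cons_val] at e1 e2 e3
  ext i
  fin_cases i <;> first | assumption | (simp only [Fin.reduceFinMk, Pi.zero_apply]; linarith)

lemma contDiff_quadMul {E : Type*} [NormedAddCommGroup E] [NormedSpace ℝ E] {a b : E → Fin 6 → ℝ}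
    (ha : ContDiff ℝ 1 a) (hb : ContDiff ℝ 1 b) : ContDiff ℝ 1 fun p => quadMul (a p) (b p) := by
  rw [contDiff_pi] at ha hb ⊢
  intro i
  fin_cases i <;> simp only [quadMul, Fin.reduceFinMk, Fin.zero_eta, Fin.mk_one, Matrix.cons_val] <;>
    fun_prop

lemma contDiff_linMul {E : Type*} [NormedAddCommGroup E] [NormedSpace ℝ E] {a b : E → Fin 3 → ℝ}
    (ha : ContDiff ℝ 1 a) (hb : ContDiff ℝ 1 b) : ContDiff ℝ 1 fun p => linMul (a p) (b p) := by
  rw [contDiff_pi] at ha hb ⊢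
  intro i
  fin_cases i <;> simp only [linMul, Fin.reduceFinMk, Fin.zero_eta, Fin.mk_one, Matrix.cons_val] <;>
    fun_prop

/-- The real linear form `xᵢ - u xⱼ - w xₖ`. -/
def chartLine (i j k : Fin 3) (u w : ℝ) : Fin 3 → ℝ :=
  Pi.single i 1 - u • Pi.single j 1 - w • Pi.single k 1

/-- The real quadratic form `xₖ² - s xₖ xⱼ + t xⱼ²`. -/
def chartConic (j k : Fin 3) (s t : ℝ) : Fin 6 → ℝ :=
  linMul (Pi.single k 1) (Pi.single k 1) - s • linMul (Pi.single k 1) (Pi.single j 1) +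
    t • linMul (Pi.single j 1) (Pi.single j 1)

/-- A parametrisation of the quartic forms singular along a pair of conjugate points. -/
def singularForm (i j k : Fin 3) (p : Fin 13 → ℝ) : Fin 15 → ℝ :=
  p 4 • quadMul (chartConic j k (p 0) (p 1)) (chartConic j k (p 0) (p 1)) +
    quadMul (chartConic j k (p 0) (p 1)) (linMul (chartLine i j k (p 2) (p 3))
      (p 5 • Pi.single j 1 + p 6 • Pi.single k 1)) +
    quadMul (linMul (chartLine i j k (p 2) (p 3)) (chartLine i j k (p 2) (p 3)))
      ![p 7, p 8, p 9, p 10, p 11, p 12]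

lemma contDiff_singularForm (i j k : Fin 3) : ContDiff ℝ 1 (singularForm i j k) := by
  have h1 : ContDiff ℝ 1 fun p : Fin 13 → ℝ => chartConic j k (p 0) (p 1) := by
    unfold chartConic; fun_prop
  have h2 : ContDiff ℝ 1 fun p : Fin 13 → ℝ => chartLine i j k (p 2) (p 3) := by
    unfold chartLine; fun_prop
  have h3 : ContDiff ℝ 1 fun p : Fin 13 → ℝ => ![p 7, p 8, p 9, p 10, p 11, p 12] := by
    rw [contDiff_pi]
    intro i
    fin_cases i <;> simp only [Fin.reduceFinMk, Fin.zero_eta, Fin.mk_one, Matrix.cons_val] <;>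
      fun_prop
  have h4 := contDiff_quadMul h1 h1
  have h5 := contDiff_quadMul h1 (contDiff_linMul h2
    (b := fun p => p 5 • Pi.single j 1 + p 6 • Pi.single k 1) (by fun_prop))
  have h6 := contDiff_quadMul (contDiff_linMul h2 h2) h3
  unfold singularForm
  fun_prop

lemma quad_sub {R : Type*} [CommRing R] (a b : Fin 6 → R) (x : Fin 3 → R) :
    quad (a - b) x = quad a x - quad b x := by
  simp only [quad, Pi.sub_apply]; ring

lemma dotProduct_chartLine (i j k : Fin 3) (u w : ℝ) (y : Fin 3 → ℝ) :
    chartLine i j k u w ⬝ᵥ y = y i - u * y j - w * y k := by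
  simp [chartLine, sub_dotProduct]

lemma quad_chartConic (j k : Fin 3) (s t : ℝ) (y : Fin 3 → ℝ) :
    quad (chartConic j k s t) y = y k ^ 2 - s * (y k * y j) + t * y j ^ 2 := by
  simp [chartConic, quad_add, quad_sub, quad_smul, quad_linMul]; ring

lemma quartic_singularForm (i j k : Fin 3) (p : Fin 13 → ℝ) (y : Fin 3 → ℝ) :
    quartic (singularForm i j k p) y =
      p 4 * (y k ^ 2 - p 0 * (y k * y j) + p 1 * y j ^ 2) ^ 2 +
      (y k ^ 2 - p 0 * (y k * y j) + p 1 * y j ^ 2) * (y i - p 2 * y j - p 3 * y k) *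
        (p 5 * y j + p 6 * y k) +
      (y i - p 2 * y j - p 3 * y k) ^ 2 * quad ![p 7, p 8, p 9, p 10, p 11, p 12] y := by
  simp only [singularForm, quartic_add, quartic_smul, quartic_quadMul, quad_linMul,
    dotProduct_chartLine, quad_chartConic, add_dotProduct, smul_dotProduct, single_dotProduct,
    smul_eq_mul, one_mul]
  ring

lemma exists_quad_perm {i j k : Fin 3} (hij : i ≠ j) (hik : i ≠ k) (hjk : j ≠ k) (a : Fin 6 → ℝ) :
    ∃ b : Fin 6 → ℝ, (∀ y, quad a y = quad b ![y i, y j, y k]) ∧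
      ∀ x, quad (fun n => (a n : ℂ)) x = quad (fun n => (b n : ℂ)) ![x i, x j, x k] := by
  fin_cases i <;> fin_cases j <;> simp only [ne_eq, not_true_eq_false] at hij <;>
    fin_cases k <;> simp only [ne_eq, not_true_eq_false] at hik hjk
  · exact ⟨a, fun y => by simp [quad], fun y => by simp [quad]⟩
  · refine ⟨![a 0, a 2, a 1, a 3, a 5, a 4], fun y => ?_, fun y => ?_⟩ <;> simp [quad] <;> ring
  · refine ⟨![a 1, a 0, a 2, a 4, a 3, a 5], fun y => ?_, fun y => ?_⟩ <;> simp [quad] <;> ring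
  · refine ⟨![a 1, a 2, a 0, a 4, a 5, a 3], fun y => ?_, fun y => ?_⟩ <;> simp [quad] <;> ring
  · refine ⟨![a 2, a 0, a 1, a 5, a 3, a 4], fun y => ?_, fun y => ?_⟩ <;> simp [quad] <;> ring
  · refine ⟨![a 2, a 1, a 0, a 5, a 4, a 3], fun y => ?_, fun y => ?_⟩ <;> simp [quad] <;> ring

/-- The real quadratic forms through a nonreal point. -/
lemma exists_quad_eq {i j k : Fin 3} (hij : i ≠ j) (hik : i ≠ k) (hjk : j ≠ k) {x : Fin 3 → ℂ}
    (hj : x j = 1) (hk : (x k).im ≠ 0) : ∃ s t u w : ℝ, ∀ a : Fin 6 → ℝ,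
      quad (fun n => (a n : ℂ)) x = 0 → ∃ c : ℝ, ∃ l : Fin 3 → ℝ, ∀ y : Fin 3 → ℝ,
        quad a y = c * (y k ^ 2 - s * (y k * y j) + t * y j ^ 2) +
          (y i - u * y j - w * y k) * l ⬝ᵥ ![y i, y j, y k] := by
  set w := (x i).im / (x k).im with hw
  set u := (x i).re - w * (x k).re with hu
  refine ⟨2 * (x k).re, (x k).re ^ 2 + (x k).im ^ 2, u, w, fun a ha => ?_⟩
  obtain ⟨b, hb, hb'⟩ := exists_quad_perm hij hik hjk a
  have hxi : x i = u + w * x k := by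
    apply Complex.ext
    · simp [hu]
    · simp [hw, hk]
  rw [hb', hj, hxi] at ha
  have hre := congrArg Complex.re ha
  have him := congrArg Complex.im ha
  simp [quad, pow_two] at hre him
  have hB : 2 * b 0 * u * w + u * b 4 + w * b 5 + b 3 =
      -2 * (x k).re * (b 0 * w ^ 2 + w * b 4 + b 2) := by
    apply mul_left_cancel₀ hk
    linear_combination him
  have hA : b 0 * u ^ 2 + u * b 5 + b 1 =
      (b 0 * w ^ 2 + w * b 4 + b 2) * ((x k).re ^ 2 + (x k).im ^ 2) := by
    linear_combination hre - (x k).re * hB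
  refine ⟨b 0 * w ^ 2 + w * b 4 + b 2, ![b 0, b 0 * u + b 5, b 0 * w + b 4], fun y => ?_⟩
  rw [hb]
  simp only [quad, Matrix.cons_val, dotProduct, Fin.sum_univ_three]
  linear_combination (y k * y j) * hB + y j ^ 2 * hA

lemma exists_singularForm_eq {T : Triple} {i j k : Fin 3} (hij : i ≠ j) (hik : i ≠ k)
    (hjk : j ≠ k) {x : Fin 3 → ℂ} (hj : x j = 1) (hk : (x k).im ≠ 0)
    (hx : ∀ n, quad (fun m => (T n m : ℂ)) x = 0) : ∃ p, singularForm i j k p = sumSq T := by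
  obtain ⟨s, t, u, w, H⟩ := exists_quad_eq hij hik hjk hj hk
  choose c l hl using fun n => H (T n) (hx n)
  have hperm : ∀ v : Fin 3 → ℝ, ∃ v' : Fin 3 → ℝ, ∀ y : Fin 3 → ℝ,
      v ⬝ᵥ ![y i, y j, y k] = v' ⬝ᵥ y := fun v =>
    ⟨v 0 • Pi.single i 1 + v 1 • Pi.single j 1 + v 2 • Pi.single k 1, fun y => by
      simp [dotProduct, Fin.sum_univ_three, add_mul, Finset.sum_add_distrib, Pi.single_apply]⟩
  choose l' hl' using fun n => hperm (l n)
  let m : Fin 3 → ℝ := fun r => ∑ n, 2 * c n * l n r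
  let Q : Fin 6 → ℝ := ∑ n, linMul (l' n) (l' n) + m 0 • chartConic j k s t
  refine ⟨![s, t, u, w, ∑ n, c n ^ 2, m 1 + m 0 * u, m 2 + m 0 * w,
    Q 0, Q 1, Q 2, Q 3, Q 4, Q 5], quartic_injective fun y => ?_⟩
  rw [quartic_singularForm, quartic_sumSq, hl, hl, hl]
  simp only [Matrix.cons_val]
  have hQ : quad ![Q 0, Q 1, Q 2, Q 3, Q 4, Q 5] y = (l 0 ⬝ᵥ ![y i, y j, y k]) ^ 2 +
      (l 1 ⬝ᵥ ![y i, y j, y k]) ^ 2 + (l 2 ⬝ᵥ ![y i, y j, y k]) ^ 2 +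
        m 0 * (y k ^ 2 - s * (y k * y j) + t * y j ^ 2) := by
    have : ![Q 0, Q 1, Q 2, Q 3, Q 4, Q 5] = Q := by ext n; fin_cases n <;> rfl
    rw [this]
    simp only [Q, Fin.sum_univ_three, quad_add, quad_smul, quad_linMul, quad_chartConic, hl']
    ring
  rw [hQ]
  simp only [m, Fin.sum_univ_three, dotProduct, Matrix.cons_val]
  ring

/-- Strict positivity of a real quartic form. -/
def Positive (c : Fin 15 → ℝ) : Prop := ∀ x : Fin 3 → ℝ, x ≠ 0 → 0 < quartic c x

lemma Positive.convexCombo {c d : Fin 15 → ℝ} (hc : Positive c) (hd : Positive d) {t : ℝ}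
    (h0 : 0 ≤ t) (h1 : t ≤ 1) : Positive (c + t • (d - c)) := by
  intro x hx
  have e : quartic (c + t • (d - c)) x = (1 - t) * quartic c x + t * quartic d x := by
    simp only [quartic, Pi.add_apply, Pi.smul_apply, Pi.sub_apply, smul_eq_mul]; ring
  rw [e]
  have hcx := hc x hx
  have hdx := hd x hx
  rcases h0.eq_or_lt with rfl | h0
  · simpa using hcx
  · have := mul_pos h0 hdx
    have := mul_nonneg (sub_nonneg.mpr h1) hcx.le
    linarith

lemma isOpen_positive : IsOpen {c | Positive c} := by
  have hcl : IsClosed {z : Metric.sphere (0 : Fin 3 → ℝ) 1 × (Fin 15 → ℝ) |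
      quartic z.2 z.1 ≤ 0} := by
    refine isClosed_le ?_ continuous_const
    have h1 : ∀ j, Continuous fun z : Metric.sphere (0 : Fin 3 → ℝ) 1 × (Fin 15 → ℝ) =>
        (z.1 : Fin 3 → ℝ) j := fun j =>
      (continuous_apply j).comp (continuous_subtype_val.comp continuous_fst)
    simp only [quartic]
    fun_prop
  have himg := isClosedMap_snd_of_compactSpace _ hcl
  rw [← isClosed_compl_iff]
  convert himg using 1
  ext c
  simp only [Set.mem_compl_iff, Set.mem_ofPred_eq, Positive, Set.mem_image, Prod.exists,
    Subtype.exists, exists_eq_right]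
  push Not
  constructor
  · rintro ⟨x, hx0, hx⟩
    have hn : ‖x‖ ≠ 0 := by simpa using hx0
    refine ⟨‖x‖⁻¹ • x, ?_, ?_⟩
    · simp [norm_smul, hx0]
    · have e : quartic c (‖x‖⁻¹ • x) = (‖x‖⁻¹) ^ 4 * quartic c x := by
        simp only [quartic, Pi.smul_apply, smul_eq_mul]; ring
      rw [e]
      exact mul_nonpos_of_nonneg_of_nonpos (by positivity) hx
  · rintro ⟨x, hx1, hx⟩
    refine ⟨x, fun h0 => ?_, hx⟩
    rw [h0] at hx1
    simp at hx1

/-- A positive form which is not regular is singular along a pair of conjugate points. -/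
lemma Positive.exists_singularForm {c : Fin 15 → ℝ} (hc : Positive c) (hr : ¬ Regular c) :
    ∃ i j k p, singularForm i j k p = c := by
  simp only [Regular, BasePointFree] at hr
  push Not at hr
  obtain ⟨T, rfl, x, hx, hx0⟩ := hr
  obtain ⟨j, hj⟩ := Function.ne_iff.mp hx0
  let x' : Fin 3 → ℂ := (x j)⁻¹ • x
  have hx' : ∀ n, quad (fun m => (T n m : ℂ)) x' = 0 := fun n => by
    have := hx n
    simp only [x', quad, Pi.smul_apply, smul_eq_mul] at this ⊢
    linear_combination ((x j)⁻¹) ^ 2 * this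
  have hj' : x' j = 1 := by simpa [x'] using inv_mul_cancel₀ hj
  by_cases h : ∃ k, (x' k).im ≠ 0
  · obtain ⟨k, hk⟩ := h
    have hjk : j ≠ k := by rintro rfl; simp [hj'] at hk
    obtain ⟨i, hij, hik⟩ : ∃ i : Fin 3, i ≠ j ∧ i ≠ k :=
      (by decide : ∀ j k : Fin 3, ∃ i, i ≠ j ∧ i ≠ k) j k
    obtain ⟨p, hp⟩ := exists_singularForm_eq hij hik hjk hj' hk hx'
    exact ⟨i, j, k, p, hp⟩
  · push Not at h
    have hre : ∀ n, x' n = ((x' n).re : ℂ) := fun n => Complex.ext (by simp) (by simp [h n])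
    have hy : (fun n => (x' n).re) ≠ 0 := fun h0 => by
      have := congrFun h0 j
      simp [hj'] at this
    have hz : ∀ n, quad (T n) (fun n => (x' n).re) = 0 := fun n => by
      have := hx' n
      rw [show x' = fun n => ((x' n).re : ℂ) from funext hre] at this
      simp only [quad] at this ⊢
      exact_mod_cast this
    have := hc _ hy
    rw [quartic_sumSq, hz, hz, hz] at this
    simp at this

/-- The cone over the singular forms with vertex `c`. -/
def singularCone (c : Fin 15 → ℝ) : Set (Fin 15 → ℝ) :=
  ⋃ n : Fin 3 × Fin 3 × Fin 3, Set.range fun z : (Fin 13 → ℝ) × ℝ =>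
    c + z.2 • (singularForm n.1 n.2.1 n.2.2 z.1 - c)

lemma dimH_singularCone (c : Fin 15 → ℝ) : dimH (singularCone c) < 15 := by
  rw [singularCone, dimH_iUnion]
  refine lt_of_le_of_lt (iSup_le fun n => ?_) (b := 14) (by norm_num)
  have hs := contDiff_singularForm n.1 n.2.1 n.2.2
  have hd : ContDiff ℝ 1 fun z : (Fin 13 → ℝ) × ℝ =>
      c + z.2 • (singularForm n.1 n.2.1 n.2.2 z.1 - c) := by fun_prop
  refine hd.dimH_range_le.trans ?_
  simp [Module.finrank_prod]

lemma Positive.regular_segment {c d : Fin 15 → ℝ} (hc : Positive c) (hcr : Regular c)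
    (hd : Positive d) (hdc : d ∉ singularCone c) {t : ℝ} (h0 : 0 ≤ t) (h1 : t ≤ 1) :
    Regular (c + t • (d - c)) := by
  rcases h0.eq_or_lt with rfl | h0
  · simpa using hcr
  by_contra hr
  obtain ⟨i, j, k, p, hp⟩ := (hc.convexCombo hd h0.le h1).exists_singularForm hr
  refine hdc (Set.mem_iUnion.mpr ⟨(i, j, k), (p, t⁻¹), ?_⟩)
  simp only
  rw [hp, add_sub_cancel_left, smul_smul, inv_mul_cancel₀ h0.ne', one_smul, add_sub_cancel]

lemma Positive.ncard_grams_eq_of_notMem {c d : Fin 15 → ℝ} (hc : Positive c) (hcr : Regular c)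
    (hd : Positive d) (hdc : d ∉ singularCone c) : (grams c).ncard = (grams d).ncard := by
  let φ : unitInterval → (Fin 15 → ℝ) := fun t => c + (t : ℝ) • (d - c)
  have hφ : Continuous φ := by fun_prop
  have hl : IsLocallyConstant fun t => (grams (φ t)).ncard := by
    rw [IsLocallyConstant.iff_eventually_eq]
    intro t
    exact (hφ.tendsto t).eventually
      (hc.regular_segment hcr hd hdc t.2.1 t.2.2).eventually_ncard_grams
  have := hl.apply_eq_of_preconnectedSpace 0 1
  simpa [φ] using this

/-- The number of Gram matrices is the same for all positive regular forms. -/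
theorem Positive.ncard_grams_eq {c d : Fin 15 → ℝ} (hc : Positive c) (hcr : Regular c)
    (hd : Positive d) (hdr : Regular d) : (grams c).ncard = (grams d).ncard := by
  have hdim : dimH (singularCone c ∪ singularCone d) < Module.finrank ℝ (Fin 15 → ℝ) := by
    rw [dimH_union]
    simpa using ⟨dimH_singularCone c, dimH_singularCone d⟩
  obtain ⟨e, he, he'⟩ := (dense_compl_of_dimH_lt_finrank hdim).inter_open_nonempty _
    isOpen_positive ⟨c, hc⟩
  simp only [Set.mem_compl_iff, Set.mem_union, not_or] at he'
  rw [hc.ncard_grams_eq_of_notMem hcr he he'.1, hd.ncard_grams_eq_of_notMem hdr he he'.2]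

/-- The gradient of a ternary quartic form. -/
def quarticGrad {R : Type*} [CommRing R] (c : Fin 15 → R) (x : Fin 3 → R) : Fin 3 → R :=
  ![4 * c 0 * x 0 ^ 3 + 3 * c 3 * (x 0 ^ 2 * x 1) + 3 * c 4 * (x 0 ^ 2 * x 2) + c 5 * x 1 ^ 3 +
      c 7 * x 2 ^ 3 + 2 * c 10 * (x 0 * x 2 ^ 2) + 2 * c 11 * (x 0 * x 1 ^ 2) +
      2 * c 12 * (x 0 * x 1 * x 2) + c 13 * (x 1 ^ 2 * x 2) + c 14 * (x 1 * x 2 ^ 2),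
    4 * c 1 * x 1 ^ 3 + c 3 * x 0 ^ 3 + 3 * c 5 * (x 0 * x 1 ^ 2) + 3 * c 6 * (x 1 ^ 2 * x 2) +
      c 8 * x 2 ^ 3 + 2 * c 9 * (x 1 * x 2 ^ 2) + 2 * c 11 * (x 0 ^ 2 * x 1) +
      c 12 * (x 0 ^ 2 * x 2) + 2 * c 13 * (x 0 * x 1 * x 2) + c 14 * (x 0 * x 2 ^ 2),
    4 * c 2 * x 2 ^ 3 + c 4 * x 0 ^ 3 + c 6 * x 1 ^ 3 + 3 * c 7 * (x 0 * x 2 ^ 2) +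
      3 * c 8 * (x 1 * x 2 ^ 2) + 2 * c 9 * (x 1 ^ 2 * x 2) + 2 * c 10 * (x 0 ^ 2 * x 2) +
      c 12 * (x 0 ^ 2 * x 1) + c 13 * (x 0 * x 1 ^ 2) + 2 * c 14 * (x 0 * x 1 * x 2)]

/-- The gradient of a ternary quadratic form. -/
def quadGrad {R : Type*} [CommRing R] (a : Fin 6 → R) (x : Fin 3 → R) : Fin 3 → R :=
  ![2 * a 0 * x 0 + a 4 * x 2 + a 5 * x 1, 2 * a 1 * x 1 + a 3 * x 2 + a 5 * x 0,
    2 * a 2 * x 2 + a 3 * x 1 + a 4 * x 0]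

lemma quarticGrad_add {R : Type*} [CommRing R] (c d : Fin 15 → R) (x : Fin 3 → R) :
    quarticGrad (c + d) x = quarticGrad c x + quarticGrad d x := by
  ext i
  fin_cases i <;> simp only [quarticGrad, Fin.reduceFinMk, Fin.zero_eta, Fin.mk_one,
    Pi.add_apply, Matrix.cons_val] <;> ring

lemma quarticGrad_quadMul {R : Type*} [CommRing R] (a b : Fin 6 → R) (x : Fin 3 → R) :
    quarticGrad (quadMul a b) x = quad a x • quadGrad b x + quad b x • quadGrad a x := by
  ext i
  fin_cases i <;> simp only [quarticGrad, quadGrad, quad, quadMul, Fin.reduceFinMk, Fin.zero_eta,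
    Fin.mk_one, Pi.add_apply, Pi.smul_apply, smul_eq_mul, Matrix.cons_val] <;> ring

/-- The complex projective curve cut out by a real quartic form is smooth. -/
def Smooth (c : Fin 15 → ℝ) : Prop :=
  ∀ x : Fin 3 → ℂ, quartic (fun i => (c i : ℂ)) x = 0 →
    quarticGrad (fun i => (c i : ℂ)) x = 0 → x = 0

lemma sumSq_ofReal (T : Triple) : (fun i => ((sumSq T i : ℝ) : ℂ)) =
    quadMul (fun j => (T 0 j : ℂ)) (fun j => (T 0 j : ℂ)) +
      quadMul (fun j => (T 1 j : ℂ)) (fun j => (T 1 j : ℂ)) +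
      quadMul (fun j => (T 2 j : ℂ)) (fun j => (T 2 j : ℂ)) := by
  simp only [← quadMul_ofReal]
  ext i
  simp [sumSq, pairing_apply, Fin.sum_univ_three]

lemma Smooth.regular {c : Fin 15 → ℝ} (hc : Smooth c) : Regular c := by
  rintro T rfl x hx
  refine hc x ?_ ?_
  · simp only [sumSq_ofReal, quartic_add, quartic_quadMul, hx]; simp
  · simp only [sumSq_ofReal, quarticGrad_add, quarticGrad_quadMul, hx]; simp

/-- The quartic form `x⁴ + 5x²y² + 4y⁴ + z⁴`. -/
def baseQuartic : Fin 15 → ℝ := ![1, 4, 1, 0, 0, 0, 0, 0, 0, 0, 0, 5, 0, 0, 0]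

lemma quartic_baseQuartic (x : Fin 3 → ℝ) :
    quartic baseQuartic x = x 0 ^ 4 + 5 * x 0 ^ 2 * x 1 ^ 2 + 4 * x 1 ^ 4 + x 2 ^ 4 := by
  simp only [quartic, baseQuartic, Matrix.cons_val]; ring

lemma baseQuartic_positive : Positive baseQuartic := by
  intro x hx
  rw [quartic_baseQuartic]
  obtain ⟨j, hj⟩ := Function.ne_iff.mp hx
  have h : 0 < x j ^ 4 := by
    have : x j ≠ 0 := hj
    positivity
  have h5 : 0 ≤ 5 * x 0 ^ 2 * x 1 ^ 2 := by positivity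
  have h0 : 0 ≤ x 0 ^ 4 := by positivity
  have h1 : 0 ≤ x 1 ^ 4 := by positivity
  have h2 : 0 ≤ x 2 ^ 4 := by positivity
  fin_cases j <;> simp only [Fin.reduceFinMk, Fin.zero_eta, Fin.mk_one] at h <;> linarith

lemma baseQuartic_smooth : Smooth baseQuartic := by
  intro x _ hx
  have h0 := congrFun hx 0
  have h1 := congrFun hx 1
  have h2 := congrFun hx 2
  simp only [quarticGrad, baseQuartic, Matrix.cons_val, Pi.zero_apply] at h0 h1 h2
  push_cast at h0 h1 h2
  have z0 : x 2 = 0 := by simpa using h2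
  have y0 : x 1 = 0 := by
    have : x 1 ^ 5 = 0 := by
      linear_combination x 1 ^ 2 / 16 * h1 + 5 / 72 * (x 0 ^ 2 * h1 - 5 / 2 * x 0 * x 1 * h0)
    simpa using this
  have x0 : x 0 = 0 := by simpa [y0] using h0
  ext i; fin_cases i <;> assumption

/-- Any triple can be rotated so that its `z²` coefficients become `(0, 0, 1)`. -/
lemma exists_gram_eq_of_unit {T : Triple} (h : gram T 2 2 = 1) :
    ∃ S : Triple, gram S = gram T ∧ S 0 2 = 0 ∧ S 1 2 = 0 ∧ S 2 2 = 1 := by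
  rw [gram_apply] at h
  set n := T 0 2 ^ 2 + T 1 2 ^ 2 + (T 2 2 - 1) ^ 2 with hn
  by_cases h0 : n = 0
  · refine ⟨T, rfl, ?_, ?_, ?_⟩ <;> nlinarith [sq_nonneg (T 0 2), sq_nonneg (T 1 2),
      sq_nonneg (T 2 2 - 1)]
  let w : Fin 6 → ℝ := fun j => T 0 2 * T 0 j + T 1 2 * T 1 j + (T 2 2 - 1) * T 2 j
  have hk : (2 / n) * n = 2 := by field_simp
  have hw : w 2 = n / 2 := by simp only [w, hn]; linear_combination h / 2
  generalize 2 / n = k at hk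
  refine ⟨![fun j => T 0 j - k * T 0 2 * w j, fun j => T 1 j - k * T 1 2 * w j,
    fun j => T 2 j - k * (T 2 2 - 1) * w j], ?_, ?_, ?_, ?_⟩
  · ext a b
    simp only [gram_apply, Matrix.cons_val]
    have : k * (k * n) = k * 2 := by rw [hk]
    rw [hn] at this
    linear_combination (exp := 1) w a * w b * this
  · simp only [Matrix.cons_val, hw]; linear_combination (- T 0 2 / 2) * hk
  · simp only [Matrix.cons_val, hw]; linear_combination (- T 1 2 / 2) * hk
  · simp only [Matrix.cons_val, hw]; linear_combination (- (T 2 2 - 1) / 2) * hk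

lemma exists_smul_of_orthogonal {v1 v2 x1 x2 : ℝ} (hv : 0 < v1 ^ 2 + v2 ^ 2)
    (h : x1 * v1 + x2 * v2 = 0) : ∃ m, x1 = -m * v2 ∧ x2 = m * v1 := by
  refine ⟨(x2 * v1 - x1 * v2) / (v1 ^ 2 + v2 ^ 2), ?_, ?_⟩
  · field_simp; linear_combination v1 * h
  · field_simp; linear_combination v2 * h

/-- The parameters of the Gram matrices of `x⁴ + 5x²y² + 4y⁴ + z⁴`. -/
def BaseSolution (p q r g e d : ℝ) : Prop :=
  (p = 0 ∧ q = 0 ∧ r = 0 ∧ g ^ 2 = 4 ∧ e = 0 ∧ d = 0) ∨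
  (p = 2 / 3 ∧ q ^ 2 = 8 / 9 ∧ r = 4 / 3 ∧ g = 2 ∧ e = 0 ∧ d = 0) ∨
  (p = 2 ∧ q = 0 ∧ r = 2 ∧ g = 1 ∧ e = 0 ∧ d ^ 2 = 6) ∨
  (p = 1 ∧ q = 0 ∧ r = 4 ∧ g = 1 ∧ e ^ 2 = 3 ∧ d = 0)

lemma baseSolution_of_det_ne_zero {p q r m n D : ℝ} (hp : 0 < p) (hr : 0 < r)
    (hD : D ^ 2 = p * r - q ^ 2)
    (h0 : p * (m ^ 2 + p / 4) = 1)
    (h1 : 2 * q * (m ^ 2 + p / 4) + p * (2 * m * n + q / 2) = 0)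
    (h2 : r * (m ^ 2 + p / 4) + 2 * q * (2 * m * n + q / 2) + p * (n ^ 2 + r / 4) = 5)
    (h3 : r * (2 * m * n + q / 2) + 2 * q * (n ^ 2 + r / 4) = 0)
    (h4 : r * (n ^ 2 + r / 4) = 4) :
    BaseSolution p q r (m * n * q + p * r / 4) (-m * D) (n * D) := by
  obtain ⟨P, hP⟩ : ∃ P, P = m ^ 2 + p / 4 := ⟨_, rfl⟩
  obtain ⟨R, hR⟩ : ∃ R, R = n ^ 2 + r / 4 := ⟨_, rfl⟩
  obtain ⟨S, hS⟩ : ∃ S, S = 2 * m * n + q / 2 := ⟨_, rfl⟩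
  rw [← hP] at h0 h1 h2
  rw [← hR] at h2 h3 h4
  rw [← hS] at h1 h2 h3
  have hq : q = 0 := by
    by_contra hq
    have e1 : p ^ 2 * S = -2 * q := by linear_combination p * h1 - 2 * q * h0
    have e2 : r ^ 2 * S = -8 * q := by linear_combination r * h3 - 2 * q * h4
    have e3 : r ^ 2 = 4 * p ^ 2 := by
      apply mul_left_cancel₀ hq
      linear_combination (-p ^ 2 * e2 + r ^ 2 * e1) / 2
    have e4 : r = 2 * p := by nlinarith
    subst e4
    have e5 : p ^ 2 * (2 * (p * P) + p * R) + 2 * q * (p ^ 2 * S) = 5 * p ^ 2 := by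
      linear_combination p ^ 2 * h2
    have e6 : p * R = 2 := by linarith
    rw [h0, e6, e1] at e5
    have : 0 < q ^ 2 := by positivity
    nlinarith [sq_nonneg p]
  subst hq
  have hS0 : S = 0 := by
    have : p * S = 0 := by linarith
    simpa [hp.ne'] using this
  have hmn : m = 0 ∨ n = 0 := by
    rw [hS0] at hS
    have : m * n = 0 := by linarith
    simpa using this
  have ht : (r - p) * (r - 4 * p) = 0 := by
    linear_combination p * r * h2 - r ^ 2 * h0 - p ^ 2 * h4
  rcases hmn with rfl | rfl
  · have hp2 : p = 2 := by
      rw [hP] at h0; nlinarith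
    subst hp2
    rcases mul_eq_zero.mp ht with h | h
    · have : r = 2 := by linarith
      subst this
      refine Or.inr (Or.inr (Or.inl ⟨rfl, rfl, rfl, by norm_num, by simp, ?_⟩))
      rw [hR] at h4
      linear_combination n ^ 2 * hD + 2 * h4
    · have : r = 8 := by linarith
      subst this
      rw [hR] at h4
      nlinarith [sq_nonneg n]
  · have hr4 : r = 4 := by
      rw [hR] at h4; nlinarith
    subst hr4
    rcases mul_eq_zero.mp ht with h | h
    · have : p = 4 := by linarith
      subst this
      rw [hP] at h0
      nlinarith [sq_nonneg m]
    · have : p = 1 := by linarith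
      subst this
      refine Or.inr (Or.inr (Or.inr ⟨rfl, rfl, rfl, by norm_num, ?_, by simp⟩))
      rw [hP] at h0
      linear_combination m ^ 2 * hD + 4 * h0

lemma baseSolution_of_parallel {p k s1 s2 s3 : ℝ} (hp : 0 < p)
    (h0 : s1 ^ 2 * p + p ^ 2 / 4 = 1) (h1 : s1 * s3 + k * p / 2 = 0)
    (h2 : 2 * (s1 * s2 * p + k ^ 2 * p ^ 2 / 4) + s3 ^ 2 * p + k ^ 2 * p ^ 2 = 5)
    (h3 : s2 * s3 + k ^ 3 * p / 2 = 0) (h4 : s2 ^ 2 * p + k ^ 4 * p ^ 2 / 4 = 4) :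
    p = 2 / 3 ∧ (k * p) ^ 2 = 8 / 9 ∧ k ^ 2 * p = 4 / 3 ∧
      s1 * s2 * p + k ^ 2 * p ^ 2 / 4 = 2 := by
  have hk : k ≠ 0 := by
    rintro rfl
    have e1 : s2 ^ 2 * p = 4 := by linarith
    have e2 : s3 = 0 := by
      rcases mul_eq_zero.mp (by linarith : s2 * s3 = 0) with h | h
      · rw [h] at e1; norm_num at e1
      · exact h
    subst e2
    have e3 : s1 * s2 * p = 5 / 2 := by linarith
    have e4 : (s1 * s2 * p) ^ 2 = s1 ^ 2 * p * 4 := by rw [← e1]; ring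
    rw [e3] at e4
    nlinarith [sq_nonneg p]
  have hs3 : s3 ≠ 0 := by
    rintro rfl
    have : k * p = 0 := by linarith
    simp [hk, hp.ne'] at this
  have e1 : s2 = k ^ 2 * s1 := by
    apply mul_right_cancel₀ hs3
    linear_combination h3 - k ^ 2 * h1
  subst e1
  have e2 : k ^ 2 = 2 := by
    have : k ^ 4 = 4 := by linear_combination h4 - k ^ 4 * h0
    nlinarith [sq_nonneg k]
  have e3 : s3 ^ 2 * p = 1 - 2 * p ^ 2 := by
    linear_combination h2 - 2 * s1 ^ 2 * p * e2 - 3 / 2 * p ^ 2 * e2 - 4 * h0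
  have e4 : s1 ^ 2 * s3 ^ 2 = p ^ 2 / 2 := by
    linear_combination (s1 * s3 - k * p / 2) * h1 + p ^ 2 / 4 * e2
  have e5 : p ^ 2 = 4 / 9 := by
    linear_combination (-4 / 9) * (p ^ 2 * e4 - s1 ^ 2 * p * e3 - (1 - 2 * p ^ 2) * h0)
  have e6 : p = 2 / 3 := by nlinarith
  refine ⟨e6, ?_, ?_, ?_⟩
  · linear_combination p ^ 2 * e2 + 2 * e5
  · rw [e2, e6]; norm_num
  · linear_combination (s1 ^ 2 * p + p ^ 2 / 4) * e2 + 2 * h0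

lemma false_of_parallel {x1 x2 y1 y2 u1 u2 w1 w2 : ℝ} (hu : 0 < u1 ^ 2 + u2 ^ 2)
    (hXX : x1 ^ 2 + x2 ^ 2 = 1) (hYY : y1 ^ 2 + y2 ^ 2 ≤ 4) (hXW : x1 * w1 + x2 * w2 = 0)
    (hXY : 2 * (x1 * y1 + x2 * y2) + w1 ^ 2 + w2 ^ 2 = 5) (hXU : x1 * u1 + x2 * u2 = 0)
    (hYU : y1 * u1 + y2 * u2 = 0) (hWU : w1 * u1 + w2 * u2 = 0) : False := by
  obtain ⟨s1, rfl, rfl⟩ := exists_smul_of_orthogonal hu hXU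
  obtain ⟨s2, rfl, rfl⟩ := exists_smul_of_orthogonal hu hYU
  obtain ⟨s3, rfl, rfl⟩ := exists_smul_of_orthogonal hu hWU
  generalize hr : u1 ^ 2 + u2 ^ 2 = r at hu
  have e1 : s1 ^ 2 * r = 1 := by rw [← hr]; linarith
  have e2 : s2 ^ 2 * r ≤ 4 := by rw [← hr]; linarith
  have e3 : s1 * s3 * r = 0 := by rw [← hr]; linarith
  have e4 : s3 = 0 := by
    have : s1 ≠ 0 := by rintro rfl; norm_num at e1
    simpa [this, hu.ne'] using e3
  subst e4
  have e5 : s1 * s2 * r = 5 / 2 := by rw [← hr]; linarith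
  have e6 : (s1 * s2 * r) ^ 2 = s1 ^ 2 * r * (s2 ^ 2 * r) := by ring
  rw [e5, e1] at e6
  linarith

lemma baseSolution_of_eq_zero {x1 x2 y1 y2 u1 u2 w1 w2 r : ℝ} (hr : r = u1 ^ 2 + u2 ^ 2)
    (hXX : x1 ^ 2 + x2 ^ 2 = 1) (hYY : y1 ^ 2 + y2 ^ 2 + r ^ 2 / 4 = 4)
    (hXW : x1 * w1 + x2 * w2 = 0) (hYW : y1 * w1 + y2 * w2 = 0)
    (hXY : 2 * (x1 * y1 + x2 * y2) + w1 ^ 2 + w2 ^ 2 = 5) (hXU : x1 * u1 + x2 * u2 = 0)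
    (hYU : y1 * u1 + y2 * u2 = 0) (hWU : w1 * u1 + w2 * u2 = 0) :
    r = 0 ∧ (x1 * y1 + x2 * y2) ^ 2 = 4 := by
  have hr0 : r = 0 := by
    by_contra h
    have hu : 0 < u1 ^ 2 + u2 ^ 2 := hr ▸ lt_of_le_of_ne (hr ▸ by positivity) (Ne.symm h)
    exact false_of_parallel hu hXX (by linarith [sq_nonneg r]) hXW hXY hXU hYU hWU
  subst hr0
  refine ⟨rfl, ?_⟩
  have hxy : x1 * y2 - x2 * y1 = 0 := by
    by_contra hne
    have e1 : w1 = 0 := by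
      apply mul_left_cancel₀ hne
      linear_combination y2 * hXW - x2 * hYW
    have e2 : w2 = 0 := by
      apply mul_left_cancel₀ hne
      linear_combination x1 * hYW - y1 * hXW
    subst e1 e2
    nlinarith [sq_nonneg (x1 * y2 - x2 * y1)]
  linear_combination (x1 ^ 2 + x2 ^ 2) * hYY + 4 * hXX - (x1 * y2 - x2 * y1) * hxy

lemma eq_zero_of_sq_add_sq {a b : ℝ} (h : a ^ 2 + b ^ 2 = 0) : a = 0 ∧ b = 0 := by
  constructor <;> nlinarith [sq_nonneg a, sq_nonneg b]

lemma baseSolution_of_linearIndependent {m y1 y2 u1 u2 v1 v2 w1 w2 p q r : ℝ}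
    (hp : p = v1 ^ 2 + v2 ^ 2) (hq : q = u1 * v1 + u2 * v2) (hr : r = u1 ^ 2 + u2 ^ 2)
    (hp' : 0 < p) (hD0 : v1 * u2 - v2 * u1 ≠ 0)
    (hXX : (-m * v2) ^ 2 + (m * v1) ^ 2 + p ^ 2 / 4 = 1) (hYY : y1 ^ 2 + y2 ^ 2 + r ^ 2 / 4 = 4)
    (hXW : -m * v2 * w1 + m * v1 * w2 + p * q / 2 = 0)
    (hYW : y1 * w1 + y2 * w2 + r * q / 2 = 0) (hYU : y1 * u1 + y2 * u2 = 0)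
    (hXY : 2 * (-m * v2 * y1 + m * v1 * y2 + p * r / 4) + w1 ^ 2 + w2 ^ 2 + q ^ 2 = 5)
    (hXU : -m * v2 * u1 + m * v1 * u2 + v1 * w1 + v2 * w2 = 0)
    (hYV : y1 * v1 + y2 * v2 + u1 * w1 + u2 * w2 = 0) :
    BaseSolution p q r (-m * v2 * y1 + m * v1 * y2 + p * r / 4) (v1 * w1 + v2 * w2)
      (u1 * w1 + u2 * w2) := by
  have hD : (v1 * u2 - v2 * u1) ^ 2 = p * r - q ^ 2 := by rw [hp, hq, hr]; ring
  have hr'' : 0 < u1 ^ 2 + u2 ^ 2 := by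
    refine lt_of_le_of_ne (by positivity) fun h => hD0 ?_
    obtain ⟨rfl, rfl⟩ := eq_zero_of_sq_add_sq h.symm
    ring
  have hr' : 0 < r := hr ▸ hr''
  obtain ⟨n, rfl, rfl⟩ := exists_smul_of_orthogonal hr'' hYU
  have hw1 : w1 = -m * u2 - n * v2 := by
    apply mul_left_cancel₀ hD0
    linear_combination u2 * hXU - v2 * hYV
  have hw2 : w2 = m * u1 + n * v1 := by
    apply mul_left_cancel₀ hD0
    linear_combination v1 * hYV - u1 * hXU
  subst hw1 hw2
  convert baseSolution_of_det_ne_zero (m := m) (n := n) hp' hr' hD ?_ ?_ ?_ ?_ ?_ using 1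
  · linear_combination -m * n * hq
  · ring
  · ring
  · linear_combination hXX + m ^ 2 * hp
  · linear_combination 2 * hXW + 2 * m ^ 2 * hq + 2 * m * n * hp
  · linear_combination hXY + 4 * m * n * hq + m ^ 2 * hr + n ^ 2 * hp
  · linear_combination 2 * hYW + 2 * n ^ 2 * hq + 2 * m * n * hr
  · linear_combination hYY + n ^ 2 * hr

lemma baseSolution_of_equations {x1 x2 y1 y2 u1 u2 v1 v2 w1 w2 p q r : ℝ}
    (hp : p = v1 ^ 2 + v2 ^ 2) (hq : q = u1 * v1 + u2 * v2) (hr : r = u1 ^ 2 + u2 ^ 2)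
    (hXX : x1 ^ 2 + x2 ^ 2 + p ^ 2 / 4 = 1) (hYY : y1 ^ 2 + y2 ^ 2 + r ^ 2 / 4 = 4)
    (hXW : x1 * w1 + x2 * w2 + p * q / 2 = 0) (hYW : y1 * w1 + y2 * w2 + r * q / 2 = 0)
    (hXV : x1 * v1 + x2 * v2 = 0) (hYU : y1 * u1 + y2 * u2 = 0)
    (hXY : 2 * (x1 * y1 + x2 * y2 + p * r / 4) + w1 ^ 2 + w2 ^ 2 + q ^ 2 = 5)
    (hXU : x1 * u1 + x2 * u2 + v1 * w1 + v2 * w2 = 0)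
    (hYV : y1 * v1 + y2 * v2 + u1 * w1 + u2 * w2 = 0) :
    BaseSolution p q r (x1 * y1 + x2 * y2 + p * r / 4) (v1 * w1 + v2 * w2)
      (u1 * w1 + u2 * w2) := by
  have hp0 : 0 ≤ p := by rw [hp]; positivity
  rcases hp0.eq_or_lt with hp' | hp'
  · have hv1 : v1 = 0 := by nlinarith
    have hv2 : v2 = 0 := by nlinarith
    subst hv1 hv2
    have hq0 : q = 0 := by simpa using hq
    have hp0 : p = 0 := hp'.symm
    clear hp hq
    subst hp0 hq0
    simp only [mul_zero, zero_mul, add_zero, ne_eq, OfNat.ofNat_ne_zero, not_false_eq_true,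
      zero_pow, zero_div, zero_add] at hXX hXY hXU hXW hYW hYV ⊢
    obtain ⟨h1, h2⟩ := baseSolution_of_eq_zero hr hXX hYY hXW hYW hXY hXU hYU (by linarith)
    exact Or.inl ⟨rfl, rfl, h1, h2, rfl, by linarith⟩
  have hp'' := hp'
  rw [hp] at hp''
  obtain ⟨m, rfl, rfl⟩ := exists_smul_of_orthogonal hp'' hXV
  by_cases hD0 : v1 * u2 - v2 * u1 = 0
  · obtain ⟨k, hk1, hk2⟩ : ∃ k, u1 = k * v1 ∧ u2 = k * v2 := by
      obtain ⟨k, h1, h2⟩ := exists_smul_of_orthogonal (x1 := -u2) (x2 := u1) hp'' (by linarith)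
      exact ⟨k, h2, by linarith⟩
    subst hk1 hk2
    obtain ⟨s3, rfl, rfl⟩ := exists_smul_of_orthogonal hp'' (by linarith : w1 * v1 + w2 * v2 = 0)
    obtain ⟨s2, rfl, rfl⟩ := exists_smul_of_orthogonal hp'' (by linarith : y1 * v1 + y2 * v2 = 0)
    have hq' : q = k * p := by rw [hq, hp]; ring
    have hr' : r = k ^ 2 * p := by rw [hr, hp]; ring
    clear hq hr
    subst hq' hr'
    obtain ⟨a1, a2, a3, a4⟩ := baseSolution_of_parallel (p := p) (k := k) (s1 := m) (s2 := s2) (s3 := s3) hp'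
      (by linear_combination hXX + m ^ 2 * hp)
      (by apply mul_left_cancel₀ hp'.ne'; linear_combination hXW + m * s3 * hp)
      (by linear_combination hXY + (2 * m * s2 + s3 ^ 2) * hp)
      (by apply mul_left_cancel₀ hp'.ne'; linear_combination hYW + s2 * s3 * hp)
      (by linear_combination hYY + s2 ^ 2 * hp)
    refine Or.inr (Or.inl ⟨a1, a2, a3, ?_, by ring, by ring⟩)
    linear_combination a4 - m * s2 * hp
  · exact baseSolution_of_linearIndependent hp hq hr hp' hD0 hXX hYY hXW hYW hYU hXY hXU hYV

/-- The coordinates determining a Gram matrix of the base quartic. -/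
def gramParam (G : Matrix (Fin 6) (Fin 6) ℝ) : Fin 6 → ℝ :=
  ![G 4 4, G 3 4, G 3 3, G 0 1, G 4 5, G 3 5]

lemma gramQuartic_eq_baseQuartic {G : Matrix (Fin 6) (Fin 6) ℝ} (h : gramQuartic G = baseQuartic) :
    G 0 0 = 1 ∧ G 1 1 = 4 ∧ G 2 2 = 1 ∧ G 0 5 = 0 ∧ G 0 4 = 0 ∧ G 1 5 = 0 ∧ G 1 3 = 0 ∧
      G 2 4 = 0 ∧ G 2 3 = 0 ∧ 2 * G 1 2 + G 3 3 = 0 ∧ 2 * G 0 2 + G 4 4 = 0 ∧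
      2 * G 0 1 + G 5 5 = 5 ∧ G 0 3 + G 4 5 = 0 ∧ G 1 4 + G 3 5 = 0 ∧ G 2 5 + G 3 4 = 0 := by
  have e := fun i => congrFun h i
  simp only [gramQuartic, baseQuartic, Fin.forall_fin_succ, Fin.isValue, Fin.succ_zero_eq_one,
    Fin.succ_one_eq_two, Fin.reduceSucc, Matrix.cons_val, IsEmpty.forall_iff] at e
  obtain ⟨h0, h1, h2, h3, h4, h5, h6, h7, h8, h9, h10, h11, h12, h13, h14, -⟩ := e
  refine ⟨h0, h1, h2, ?_, ?_, ?_, ?_, ?_, ?_, h9, h10, h11, ?_, ?_, ?_⟩ <;> linarith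

lemma gram_symm (T : Triple) (a b : Fin 6) : gram T a b = gram T b a := by
  rw [gram_apply, gram_apply]; ring

lemma gramQuartic_of_mem_grams {c : Fin 15 → ℝ} {G : Matrix (Fin 6) (Fin 6) ℝ}
    (h : G ∈ grams c) : gramQuartic G = c := by
  obtain ⟨T, hT, rfl⟩ := h
  rw [← sumSq_eq_gramQuartic]; exact hT

lemma baseSolution_of_mem_grams {G : Matrix (Fin 6) (Fin 6) ℝ} (h : G ∈ grams baseQuartic) :
    BaseSolution (G 4 4) (G 3 4) (G 3 3) (G 0 1) (G 4 5) (G 3 5) := by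
  have hG := gramQuartic_of_mem_grams h
  obtain ⟨T, -, rfl⟩ := h
  obtain ⟨S, hS, s0, s1, s2⟩ := exists_gram_eq_of_unit (gramQuartic_eq_baseQuartic hG).2.2.1
  rw [← hS] at hG ⊢
  obtain ⟨h0, h1, -, h3, h4, h5, h6, h7, h8, h9, h10, h11, h12, h13, h14⟩ :=
    gramQuartic_eq_baseQuartic hG
  clear hG hS
  have e4 : S 2 4 = 0 := by simpa [gram_apply, s0, s1, s2] using h7
  have e3 : S 2 3 = 0 := by simpa [gram_apply, s0, s1, s2] using h8
  generalize hp : gram S 4 4 = p at *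
  generalize hq : gram S 3 4 = q at *
  generalize hr : gram S 3 3 = r at *
  simp only [gram_apply, s0, s1, s2, e3, e4, mul_zero, zero_mul, mul_one, one_mul, add_zero,
    zero_add] at h0 h1 h3 h4 h5 h6 h9 h10 h11 h12 h13 h14 hp hq hr ⊢
  have e0 : S 2 0 = -p / 2 := by linarith
  have e1 : S 2 1 = -r / 2 := by linarith
  have e5 : S 2 5 = -q := by linarith
  simp only [e0, e1, e5] at h0 h1 h3 h5 h11 ⊢
  have := baseSolution_of_equations (x1 := S 0 0) (x2 := S 1 0) (y1 := S 0 1) (y2 := S 1 1)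
    (u1 := S 0 3) (u2 := S 1 3) (v1 := S 0 4) (v2 := S 1 4) (w1 := S 0 5) (w2 := S 1 5)
    (p := p) (q := q) (r := r) (by linarith) (by linarith) (by linarith) (by linarith) (by linarith)
    (by linarith) (by linarith) (by linarith) (by linarith) (by linarith) (by linarith)
    (by linarith)
  convert this using 1
  ring

lemma injOn_gramParam : Set.InjOn gramParam (grams baseQuartic) := by
  intro G hG H hH h
  obtain ⟨h0, h1, h2, h3, h4, h5, h6, h7, h8, h9, h10, h11, h12, h13, h14⟩ :=
    gramQuartic_eq_baseQuartic (gramQuartic_of_mem_grams hG)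
  obtain ⟨k0, k1, k2, k3, k4, k5, k6, k7, k8, k9, k10, k11, k12, k13, k14⟩ :=
    gramQuartic_eq_baseQuartic (gramQuartic_of_mem_grams hH)
  have e := fun i => congrFun h i
  simp only [gramParam, Fin.forall_fin_succ, Fin.isValue, Fin.succ_zero_eq_one,
    Fin.succ_one_eq_two, Fin.reduceSucc, Matrix.cons_val, IsEmpty.forall_iff] at e
  obtain ⟨e0, e1, e2, e3, e4, e5, -⟩ := e
  have key : ∀ a b : Fin 6, a ≤ b → G a b = H a b := by
    intro a b hab
    fin_cases a <;> fin_cases b <;> first | (exact absurd hab (by decide)) | skip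
    all_goals simp only [Fin.reduceFinMk, Fin.zero_eta, Fin.mk_one]
    all_goals linarith
  have hsymm : ∀ {K}, K ∈ grams baseQuartic → ∀ a b, K a b = K b a := by
    rintro _ ⟨T, -, rfl⟩ a b
    exact gram_symm T a b
  ext a b
  rcases le_total a b with hab | hab
  · exact key a b hab
  · rw [hsymm hG, hsymm hH, key b a hab]

lemma exists_mem_grams_of_eq {p q r g e d : ℝ} (T : Triple)
    (h : ∀ x, quad (T 0) x ^ 2 + quad (T 1) x ^ 2 + quad (T 2) x ^ 2 =
      x 0 ^ 4 + 5 * x 0 ^ 2 * x 1 ^ 2 + 4 * x 1 ^ 4 + x 2 ^ 4)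
    (hT : gramParam (gram T) = ![p, q, r, g, e, d]) :
    ∃ G ∈ grams baseQuartic, gramParam G = ![p, q, r, g, e, d] := by
  refine ⟨gram T, ⟨T, quartic_injective fun x => ?_, rfl⟩, hT⟩
  rw [quartic_sumSq, quartic_baseQuartic, h]

lemma exists_mem_grams_of_baseSolution {p q r g e d : ℝ} (h : BaseSolution p q r g e d) :
    ∃ G ∈ grams baseQuartic, gramParam G = ![p, q, r, g, e, d] := by
  rcases h with ⟨rfl, rfl, rfl, hg, rfl, rfl⟩ | ⟨rfl, hq, rfl, rfl, rfl, rfl⟩ |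
    ⟨rfl, rfl, rfl, rfl, rfl, hd⟩ | ⟨rfl, rfl, rfl, rfl, he, rfl⟩
  · have hw : √(5 - 2 * g) ^ 2 = 5 - 2 * g := Real.sq_sqrt (by nlinarith)
    refine exists_mem_grams_of_eq
      ![![1, g, 0, 0, 0, 0], ![0, 0, 0, 0, 0, √(5 - 2 * g)], ![0, 0, 1, 0, 0, 0]] ?_ ?_
    · intro x
      simp only [quad, Matrix.cons_val]
      linear_combination (x 0 * x 1) ^ 2 * hw + x 1 ^ 4 * hg
    · simp only [gramParam, gram_apply, Matrix.cons_val]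
      norm_num
  · have hw : √(2 / 3) ^ 2 = 2 / 3 := Real.sq_sqrt (by norm_num)
    generalize √(2 / 3) = w at hw
    refine exists_mem_grams_of_eq
      ![![0, 0, 0, w * (3 * q / 2), w, 0], ![q, 2 * q, 0, 0, 0, -1 / 3],
        ![-1 / 3, -2 / 3, 1, 0, 0, -q]] ?_ ?_
    · intro x
      simp only [quad, Matrix.cons_val]
      linear_combination (x 2 * (x 0 + 3 * q / 2 * x 1)) ^ 2 * hw +
        ((x 0 ^ 2 + 2 * x 1 ^ 2) ^ 2 + (x 0 * x 1) ^ 2 + 3 / 2 * (x 1 * x 2) ^ 2) * hq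
    · simp only [gramParam, gram_apply, Matrix.cons_val]
      ext i
      fin_cases i <;> simp only [Fin.reduceFinMk, Fin.zero_eta, Fin.mk_one, Matrix.cons_val]
      · linear_combination hw
      · linear_combination 3 / 2 * q * hw
      · linear_combination 9 / 4 * q ^ 2 * hw + 3 / 2 * hq
      · linear_combination 2 * hq
      · ring
      · ring
  · have ht : √2 ^ 2 = 2 := Real.sq_sqrt (by norm_num)
    generalize √2 = t at ht
    have hs : (t * d / 2) ^ 2 = 3 := by linear_combination d ^ 2 / 4 * ht + hd / 2
    have hts : t * (t * d / 2) = d := by linear_combination d / 2 * ht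
    generalize t * d / 2 = s at hs hts
    refine exists_mem_grams_of_eq
      ![![0, -s, 0, 0, t, 0], ![0, 0, 0, t, 0, s], ![-1, -1, 1, 0, 0, 0]] ?_ ?_
    · intro x
      simp only [quad, Matrix.cons_val]
      linear_combination (x 0 ^ 2 * x 2 ^ 2 + x 1 ^ 2 * x 2 ^ 2) * ht +
        (x 1 ^ 4 + x 0 ^ 2 * x 1 ^ 2) * hs
    · simp only [gramParam, gram_apply, Matrix.cons_val]
      ext i
      fin_cases i <;> simp only [Fin.reduceFinMk, Fin.zero_eta, Fin.mk_one, Matrix.cons_val] <;>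
        linarith
  · refine exists_mem_grams_of_eq
      ![![0, 0, 0, 0, 1, e], ![-e / 2, 0, 0, 2, 0, 0], ![-1 / 2, -2, 1, 0, 0, 0]] ?_ ?_
    · intro x
      simp only [quad, Matrix.cons_val]
      linear_combination (x 0 ^ 4 / 4 + x 0 ^ 2 * x 1 ^ 2) * he
    · simp only [gramParam, gram_apply, Matrix.cons_val]
      norm_num

/-- The eight parameter vectors of the base quartic. -/
noncomputable def baseParam (z : Fin 4 × ℤˣ) : Fin 6 → ℝ :=
  ![![0, 0, 0, 2 * ((z.2 : ℤ) : ℝ), 0, 0], ![2 / 3, √(8 / 9) * ((z.2 : ℤ) : ℝ), 4 / 3, 2, 0, 0],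
    ![2, 0, 2, 1, 0, √6 * ((z.2 : ℤ) : ℝ)], ![1, 0, 4, 1, √3 * ((z.2 : ℤ) : ℝ), 0]] z.1

lemma mul_unit_sq (b : ℝ) (s : ℤˣ) : (b * ((s : ℤ) : ℝ)) ^ 2 = b ^ 2 := by
  rcases Int.units_eq_one_or s with rfl | rfl <;> simp

lemma exists_eq_mul_unit {a b : ℝ} (hb : 0 ≤ b) (h : a ^ 2 = b) : ∃ s : ℤˣ, √b * ((s : ℤ) : ℝ) = a := by
  rw [← Real.sq_sqrt hb] at h
  rcases sq_eq_sq_iff_eq_or_eq_neg.mp h with rfl | rfl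
  · exact ⟨1, by simp⟩
  · exact ⟨-1, by simp⟩

lemma baseParam_injective : Function.Injective baseParam := by
  rintro ⟨i, s⟩ ⟨j, t⟩ h
  have h0 := congrFun h 0
  have h1 := congrFun h 1
  have h3 := congrFun h 3
  have h4 := congrFun h 4
  have h5 := congrFun h 5
  fin_cases i <;> fin_cases j <;>
    simp only [baseParam, Fin.reduceFinMk, Fin.zero_eta, Fin.mk_one, Matrix.cons_val]
      at h0 h1 h3 h4 h5
  all_goals try (exfalso; norm_num at h0; done)
  all_goals norm_num at h1 h3 h4 h5
  all_goals exact Prod.ext rfl (Units.ext (by assumption))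

lemma image_gramParam : gramParam '' grams baseQuartic = Set.range baseParam := by
  ext v
  constructor
  · rintro ⟨G, hG, rfl⟩
    rcases baseSolution_of_mem_grams hG with ⟨hp, hq, hr, hg, he, hd⟩ |
      ⟨hp, hq, hr, hg, he, hd⟩ | ⟨hp, hq, hr, hg, he, hd⟩ | ⟨hp, hq, hr, hg, he, hd⟩
    · obtain ⟨s, hs⟩ := exists_eq_mul_unit (by norm_num) hg
      refine ⟨(0, s), ?_⟩
      rw [show (4 : ℝ) = 2 ^ 2 by norm_num, Real.sqrt_sq (by norm_num)] at hs
      simp [baseParam, gramParam, *]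
    · obtain ⟨s, hs⟩ := exists_eq_mul_unit (by norm_num) hq
      refine ⟨(1, s), ?_⟩
      simp only [baseParam, gramParam, hp, ← hs, hr, hg, he, hd, Matrix.cons_val]
    · obtain ⟨s, hs⟩ := exists_eq_mul_unit (by norm_num) hd
      refine ⟨(2, s), ?_⟩
      simp only [baseParam, gramParam, hp, ← hs, hr, hg, he, hq, Matrix.cons_val]
    · obtain ⟨s, hs⟩ := exists_eq_mul_unit (by norm_num) he
      refine ⟨(3, s), ?_⟩
      simp only [baseParam, gramParam, hp, ← hs, hr, hg, hq, hd, Matrix.cons_val]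
  · rintro ⟨⟨i, s⟩, rfl⟩
    fin_cases i
    · exact exists_mem_grams_of_baseSolution
        (Or.inl ⟨rfl, rfl, rfl, by rw [mul_unit_sq]; norm_num, rfl, rfl⟩)
    · exact exists_mem_grams_of_baseSolution
        (Or.inr (Or.inl ⟨rfl, by rw [mul_unit_sq, Real.sq_sqrt (by norm_num)], rfl, rfl, rfl, rfl⟩))
    · exact exists_mem_grams_of_baseSolution
        (Or.inr (Or.inr (Or.inl ⟨rfl, rfl, rfl, rfl, rfl,
          by rw [mul_unit_sq, Real.sq_sqrt (by norm_num)]⟩)))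
    · exact exists_mem_grams_of_baseSolution
        (Or.inr (Or.inr (Or.inr ⟨rfl, rfl, rfl, rfl,
          by rw [mul_unit_sq, Real.sq_sqrt (by norm_num)], rfl⟩)))

theorem ncard_grams_baseQuartic : (grams baseQuartic).ncard = 8 := by
  rw [← injOn_gramParam.ncard_image, image_gramParam,
    Set.ncard_range_of_injective baseParam_injective]
  simp

lemma span_range_eq_iff {S T : Triple} (hS : BasePointFree S) (hT : BasePointFree T)
    (h : sumSq S = sumSq T) :
    Submodule.span ℝ (Set.range S) = Submodule.span ℝ (Set.range T) ↔ gram S = gram T := by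
  constructor
  · intro hspan
    have hmem : ∀ i, ∃ m : Fin 3 → ℝ, ∑ j, m j • T j = S i := fun i =>
      (Submodule.mem_span_range_iff_exists_fun ℝ).mp (hspan ▸ Submodule.subset_span ⟨i, rfl⟩)
    choose M hM using hmem
    let N : Matrix (Fin 3) (Fin 3) ℝ := (Matrix.of M).transpose * Matrix.of M - 1
    have hN : N.transpose = N := by simp [N]
    let D : Triple := fun i => N i 0 • T 0 + N i 1 • T 1 + N i 2 • T 2
    obtain ⟨k, l, m, h0, h1, h2⟩ := hT.syzygy (D := D) (by
      refine quartic_injective fun x => ?_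
      have hx := congrArg (fun c => quartic c x) h
      simp only [quartic_sumSq, ← hM, Fin.sum_univ_three, quad_add, quad_smul] at hx
      simp only [pairing_apply, Fin.sum_univ_three, quartic_add, quartic_quadMul, D, quad_add,
        quad_smul]
      simp only [N, Matrix.sub_apply, Matrix.mul_apply, Fin.sum_univ_three, Matrix.transpose_apply,
        Matrix.of_apply, Matrix.one_apply]
      simp [quartic]
      linear_combination hx)
    have hrow : ∀ (w : Fin 3 → ℝ) i, D i = w 0 • T 0 + w 1 • T 1 + w 2 • T 2 → N i = w := by
      intro w i hw
      rw [← sub_eq_zero]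
      refine hT.eq_zero_of_vecMul ?_
      ext j
      have := congrFun hw j
      simp [D] at this
      simp [Matrix.vecMul, dotProduct, Fin.sum_univ_three]
      linear_combination this
    have e0 := hrow ![0, k, l] 0 (by rw [h0]; simp)
    have e1 := hrow ![-k, 0, m] 1 (by rw [h1]; simp)
    have e2 := hrow ![-l, -m, 0] 2 (by rw [h2]; simp [sub_eq_add_neg])
    have hN0 : N = 0 := by
      have s01 := congrFun (congrFun hN 0) 1
      have s02 := congrFun (congrFun hN 0) 2
      have s12 := congrFun (congrFun hN 1) 2
      simp [e0, e1, e2] at s01 s02 s12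
      have hk : k = 0 := by linarith
      have hl : l = 0 := by linarith
      have hm : m = 0 := by linarith
      ext i j
      fin_cases i <;> fin_cases j <;> simp [e0, e1, e2, hk, hl, hm]
    have hS' : Matrix.of S = Matrix.of M * Matrix.of T := by
      ext i j
      simp [← hM, Matrix.mul_apply]
    rw [gram, gram, hS', Matrix.transpose_mul, Matrix.mul_assoc, ← Matrix.mul_assoc _ _ (Matrix.of T),
      sub_eq_zero.mp hN0, Matrix.one_mul]
  · have key : ∀ {S T : Triple}, BasePointFree S → gram S = gram T →
        Submodule.span ℝ (Set.range S) ≤ Submodule.span ℝ (Set.range T) := by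
      intro S T hS hG
      obtain ⟨R, -, -, hR⟩ := hS.exists_orthogonal hG
      rw [Submodule.span_le]
      rintro _ ⟨i, rfl⟩
      refine (Submodule.mem_span_range_iff_exists_fun ℝ).mpr ⟨R i, ?_⟩
      ext j
      have := congrFun (congrFun hR i) j
      simpa [Matrix.mul_apply] using this.symm
    exact fun hG => le_antisymm (key hS hG) (key hT hG.symm)

section Polynomial

open MvPolynomial

/-- The ternary quadratic form with coefficient vector `a`, as a polynomial. -/
noncomputable def quadPoly : (Fin 6 → ℝ) →ₗ[ℝ] MvPolynomial (Fin 3) ℝ where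
  toFun a := quad (fun j => C (a j)) X
  map_add' a b := by simp only [quad, Pi.add_apply, map_add]; ring
  map_smul' k a := by
    simp only [quad, Pi.smul_apply, smul_eq_mul, map_mul, smul_eq_C_mul, RingHom.id_apply]; ring

/-- The ternary quartic form with coefficient vector `c`, as a polynomial. -/
noncomputable def quarticPoly : (Fin 15 → ℝ) →ₗ[ℝ] MvPolynomial (Fin 3) ℝ where
  toFun c := quartic (fun j => C (c j)) X
  map_add' a b := by simp only [quartic, Pi.add_apply, map_add]; ring
  map_smul' k a := by
    simp only [quartic, Pi.smul_apply, smul_eq_mul, map_mul, smul_eq_C_mul, RingHom.id_apply]; ring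

lemma eval_quadPoly (a : Fin 6 → ℝ) (x : Fin 3 → ℝ) : eval x (quadPoly a) = quad a x := by
  simp [quadPoly, quad]

lemma eval_quarticPoly (c : Fin 15 → ℝ) (x : Fin 3 → ℝ) :
    eval x (quarticPoly c) = quartic c x := by
  simp [quarticPoly, quartic]

lemma map_quarticPoly (c : Fin 15 → ℝ) :
    map (algebraMap ℝ ℂ) (quarticPoly c) = quartic (fun j => C (c j : ℂ)) X := by
  simp [quarticPoly, quartic]

lemma eval_pderiv_quartic (c : Fin 15 → ℂ) (x : Fin 3 → ℂ) (i : Fin 3) :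
    eval x (pderiv i (quartic (fun j => C (c j)) X)) = quarticGrad c x i := by
  have h : pderiv i (quartic (fun j => C (c j)) X) =
      ∑ j, quarticGrad (fun j => C (c j)) X j * pderiv i (X j) := by
    simp only [quartic, quarticGrad, map_add, Derivation.leibniz, Derivation.leibniz_pow, pderiv_C,
      smul_eq_mul, nsmul_eq_mul, Fin.sum_univ_three, Matrix.cons_val]
    push_cast
    ring
  rw [h, map_sum]
  simp only [map_mul, pderiv_X]
  fin_cases i <;> simp [quarticGrad, Pi.single_apply]

lemma quadPoly_injective : Function.Injective quadPoly := fun a b h =>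
  quad_injective fun x => by rw [← eval_quadPoly, h, eval_quadPoly]

lemma quarticPoly_quadMul (a b : Fin 6 → ℝ) :
    quarticPoly (quadMul a b) = quadPoly a * quadPoly b := by
  refine MvPolynomial.funext fun x => ?_
  rw [map_mul, eval_quarticPoly, eval_quadPoly, eval_quadPoly, quartic_quadMul]

lemma isHomogeneous_quadPoly (a : Fin 6 → ℝ) : (quadPoly a).IsHomogeneous 2 := by
  have hX : ∀ (c : ℝ) (i j : Fin 3), (C c * (X i * X j : MvPolynomial (Fin 3) ℝ)).IsHomogeneous 2 :=
    fun c i j => ((isHomogeneous_X ℝ i).mul (isHomogeneous_X ℝ j)).C_mul c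
  have hX2 : ∀ (c : ℝ) (i : Fin 3), (C c * (X i ^ 2 : MvPolynomial (Fin 3) ℝ)).IsHomogeneous 2 :=
    fun c i => (isHomogeneous_X_pow i 2).C_mul c
  exact (((((hX2 _ _).add (hX2 _ _)).add (hX2 _ _)).add (hX _ _ _)).add (hX _ _ _)).add (hX _ _ _)

lemma homogeneousSubmodule_two_le :
    homogeneousSubmodule (Fin 3) ℝ 2 ≤ LinearMap.range quadPoly := by
  have hlin : ∀ p ∈ homogeneousSubmodule (Fin 3) ℝ 1, ∃ l : Fin 3 → ℝ, ∑ i, l i • X i = p := by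
    intro p hp
    rw [homogeneousSubmodule_one_eq_span_X] at hp
    exact (Submodule.mem_span_range_iff_exists_fun ℝ).mp hp
  rw [← homogeneousSubmodule_one_pow, sq, Submodule.mul_le]
  intro p hp q hq
  obtain ⟨l, rfl⟩ := hlin p hp
  obtain ⟨m, rfl⟩ := hlin q hq
  refine ⟨linMul l m, MvPolynomial.funext fun x => ?_⟩
  rw [eval_quadPoly, quad_linMul]
  simp [dotProduct, Fin.sum_univ_three, smul_eval]

lemma homogeneousSubmodule_four_le :
    homogeneousSubmodule (Fin 3) ℝ 4 ≤ LinearMap.range quarticPoly := by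
  rw [← homogeneousSubmodule_one_pow, show 4 = 2 * 2 from rfl, pow_mul, sq (_ ^ 2),
    homogeneousSubmodule_one_pow, Submodule.mul_le]
  intro p hp q hq
  obtain ⟨a, rfl⟩ := homogeneousSubmodule_two_le hp
  obtain ⟨b, rfl⟩ := homogeneousSubmodule_two_le hq
  exact ⟨quadMul a b, quarticPoly_quadMul a b⟩

end Polynomial

lemma quarticGrad_eq_zero_of_nonneg {c : Fin 15 → ℝ} (hc : ∀ x, 0 ≤ quartic c x)
    {x : Fin 3 → ℝ} (hx : quartic c x = 0) : quarticGrad c x = 0 := by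
  have key : ∀ v : Fin 3 → ℝ, quarticGrad c x ⬝ᵥ v = 0 := by
    intro v
    let P : Polynomial ℝ := quartic (fun j => Polynomial.C (c j))
      (fun j => Polynomial.C (x j) + Polynomial.C (v j) * Polynomial.X)
    have hP : ∀ t, P.eval t = quartic c (fun j => x j + v j * t) := by
      intro t; simp [P, quartic]
    have hmin : IsLocalMin (fun t => P.eval t) 0 := Filter.Eventually.of_forall fun t => by
      simp only [hP, mul_zero, add_zero, hx, hc]
    have := hmin.hasDerivAt_eq_zero (P.hasDerivAt 0)
    rw [← this]
    simp [P, quartic, quarticGrad, dotProduct, Fin.sum_univ_three, Polynomial.derivative_pow]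
    ring
  exact dotProduct_eq_zero _ key

lemma Smooth.positive {c : Fin 15 → ℝ} (hs : Smooth c) (hc : ∀ x, 0 ≤ quartic c x) :
    Positive c := by
  intro x hx
  refine lt_of_le_of_ne (hc x) fun h0 => hx ?_
  have hg := quarticGrad_eq_zero_of_nonneg hc h0.symm
  have := hs (fun i => (x i : ℂ)) ?_ ?_
  · ext i; simpa using congrFun this i
  · have := congrArg (fun r : ℝ => (r : ℂ)) h0.symm
    simpa [quartic] using this
  · ext i
    have := congrArg (fun r : ℝ => (r : ℂ)) (congrFun hg i)
    fin_cases i <;> simpa [quarticGrad] using this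

theorem Smooth.ncard_grams {c : Fin 15 → ℝ} (hs : Smooth c) (hc : ∀ x, 0 ≤ quartic c x) :
    (grams c).ncard = 8 :=
  ((hs.positive hc).ncard_grams_eq hs.regular baseQuartic_positive baseQuartic_smooth.regular).trans
    ncard_grams_baseQuartic

lemma quarticPoly_sumSq (T : Triple) :
    quarticPoly (sumSq T) = quadPoly (T 0) ^ 2 + quadPoly (T 1) ^ 2 + quadPoly (T 2) ^ 2 := by
  refine MvPolynomial.funext fun x => ?_
  simp [eval_quarticPoly, quartic_sumSq, eval_quadPoly]

lemma quarticPoly_injective : Function.Injective quarticPoly := fun a b h =>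
  quartic_injective fun x => by rw [← eval_quarticPoly, h, eval_quarticPoly]

/-- Representations of a quartic form as coefficient triples. -/
lemma exists_triple {c : Fin 15 → ℝ} (t : SOSRep (quarticPoly c)) :
    ∃ T : Triple, sumSq T = c ∧ quadPoly (T 0) = t.1.1 ∧ quadPoly (T 1) = t.1.2.1 ∧
      quadPoly (T 2) = t.1.2.2 := by
  obtain ⟨⟨p, q, r⟩, hp, hq, hr, h⟩ := t
  obtain ⟨a, rfl⟩ := homogeneousSubmodule_two_le hp
  obtain ⟨b, rfl⟩ := homogeneousSubmodule_two_le hq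
  obtain ⟨d, rfl⟩ := homogeneousSubmodule_two_le hr
  refine ⟨![a, b, d], quarticPoly_injective ?_, rfl, rfl, rfl⟩
  rw [quarticPoly_sumSq, h]
  rfl

lemma span_quadPoly (T : Triple) :
    Submodule.span ℝ {quadPoly (T 0), quadPoly (T 1), quadPoly (T 2)} =
      (Submodule.span ℝ (Set.range T)).map quadPoly := by
  rw [Submodule.map_span, ← Set.range_comp]
  congr 1
  ext p
  simp [Fin.exists_fin_succ, eq_comm]

theorem Regular.card_quotient {c : Fin 15 → ℝ} (hc : Regular c) :
    Nat.card (Quotient (SOSRepSetoid (quarticPoly c))) = (grams c).ncard := by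
  choose T hT h0 h1 h2 using exists_triple (c := c)
  have hker : SOSRepSetoid (quarticPoly c) = Setoid.ker fun t => gram (T t) := by
    ext t t'
    rw [SOSRepSetoid, Setoid.ker_def, Setoid.ker_def, ← h0, ← h1, ← h2, ← h0, ← h1, ← h2,
      span_quadPoly, span_quadPoly, (Submodule.map_injective_of_injective quadPoly_injective).eq_iff]
    exact span_range_eq_iff (hc _ (hT t)) (hc _ (hT t')) ((hT t).trans (hT t').symm)
  have hrange : Set.range (fun t => gram (T t)) = grams c := by
    ext G
    constructor
    · rintro ⟨t, rfl⟩
      exact ⟨T t, hT t, rfl⟩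
    · rintro ⟨S, hS, rfl⟩
      let t : SOSRep (quarticPoly c) := ⟨(quadPoly (S 0), quadPoly (S 1), quadPoly (S 2)),
        isHomogeneous_quadPoly _, isHomogeneous_quadPoly _, isHomogeneous_quadPoly _,
        by rw [← hS, quarticPoly_sumSq]⟩
      refine ⟨t, congrArg gram ?_⟩
      ext i : 1
      fin_cases i
      · exact quadPoly_injective (h0 t)
      · exact quadPoly_injective (h1 t)
      · exact quadPoly_injective (h2 t)
  rw [hker, Nat.card_congr (Setoid.quotientKerEquivRange _), Nat.card_coe_set_eq, hrange]

end TernaryQuartic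

/-- A non-negative real ternary quartic form defining a smooth complex plane curve
has exactly 8 inequivalent representations as a sum of three squares of real
quadratic forms. -/
theorem eight_sos_representations
    (f : MvPolynomial (Fin 3) ℝ)
    (hf : f.IsHomogeneous 4)
    (hnn : ∀ x : Fin 3 → ℝ, 0 ≤ MvPolynomial.eval x f)
    (hsmooth : ∀ x : Fin 3 → ℂ, x ≠ 0 →
      MvPolynomial.eval x (MvPolynomial.map (algebraMap ℝ ℂ) f) = 0 →
      ∃ i : Fin 3,
        MvPolynomial.eval x (MvPolynomial.pderiv i (MvPolynomial.map (algebraMap ℝ ℂ) f)) ≠ 0) :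
    Nat.card (Quotient (SOSRepSetoid f)) = 8 := by
  obtain ⟨c, rfl⟩ := TernaryQuartic.homogeneousSubmodule_four_le hf
  simp only [TernaryQuartic.map_quarticPoly, TernaryQuartic.eval_pderiv_quartic,
    TernaryQuartic.eval_quarticPoly] at hnn hsmooth
  have hs : TernaryQuartic.Smooth c := by
    intro x hx hg
    by_contra hx0
    obtain ⟨i, hi⟩ := hsmooth x hx0 (by simpa [TernaryQuartic.quartic] using hx)
    exact hi (congrFun hg i)
  rw [hs.regular.card_quotient, hs.ncard_grams hnn]
end
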